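/- Let d > 0 and θ be real numbers. Then for every integer N ≥ 2 there exists a complex number G_N with |G_N| ≤ Σ_{0 < h < d log N, h ∈ ℤ} min(1/2, 1/(2π·‖e^{(h+θ)/d}‖·(2dN·e^{−(h+θ)/d} + 1))) such that (1/(2πi)) · Σ_{1 ≤ |n| ≤ N} ζ(2πidn) · e^{2πiθn}/n = −Σ_{0 < h < d log N, h ∈ ℤ} ψ_1(e^{(h+θ)/d}) + G_N + O((log N)^{2/3}·(log log N)^{5/9}), where the implied constant may depend on d and θ. -/

import Mathlib

/-- Distance from `x` to the nearest integer. -/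
noncomputable def nearestIntDist (x : ℝ) : ℝ := |x - round x|

/-- The first periodic Bernoulli polynomial `ψ_1`. -/
noncomputable def psiOne (x : ℝ) : ℝ :=
  if Int.fract x = 0 then 0 else Int.fract x - 1 / 2

namespace S3
open MeasureTheory Set intervalIntegral

noncomputable def saw (t : ℝ) : ℝ := Int.fract t - 1 / 2
noncomputable def Bt (t : ℝ) : ℝ := (Int.fract t ^ 2 - Int.fract t) / 2

lemma saw_abs (t : ℝ) : |saw t| ≤ 1 / 2 := by
  have h1 := Int.fract_nonneg t
  have h2 := Int.fract_lt_one t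
  rw [saw, abs_le]; constructor <;> linarith

lemma Bt_abs (t : ℝ) : |Bt t| ≤ 1 := by
  have h1 := Int.fract_nonneg t
  have h2 := Int.fract_lt_one t
  rw [Bt, abs_le]; constructor <;> nlinarith

lemma saw_meas : Measurable saw := measurable_fract.sub_const _

lemma Bt_cont : Continuous Bt := by
  have : Continuous ((fun t : ℝ => (t ^ 2 - t) / 2) ∘ Int.fract) := by
    apply ContinuousOn.comp_fract''
    · fun_prop
    · norm_num
  exact this

lemma Bt_deriv (x : ℝ) : HasDerivWithinAt Bt (saw x) (Ioi x) x := by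
  have h1 : HasDerivAt (fun t : ℝ => ((t - ⌊x⌋) ^ 2 - (t - ⌊x⌋)) / 2) (saw x) x := by
    have h0 : HasDerivAt (fun t : ℝ => t - (⌊x⌋ : ℝ)) 1 x := (hasDerivAt_id x).sub_const _
    refine (((h0.pow 2).sub h0).div_const 2).congr_deriv ?_
    rw [saw, ← Int.self_sub_floor]; simp only [Nat.cast_ofNat]; ring
  refine (h1.hasDerivWithinAt (s := Ioi x)).congr_of_eventuallyEq ?_ ?_
  · have : Ioo x (⌊x⌋ + 1) ∈ nhdsWithin x (Ioi x) := Ioo_mem_nhdsGT (Int.lt_floor_add_one x)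
    filter_upwards [this] with t ht
    have : ⌊t⌋ = ⌊x⌋ := by
      rw [Int.floor_eq_iff]; exact ⟨(Int.floor_le x).trans ht.1.le, ht.2⟩
    rw [Bt, ← Int.self_sub_floor, this]
  · rw [Bt, ← Int.self_sub_floor]

lemma saw_ii (a b : ℝ) : IntervalIntegrable saw volume a b := by
  refine (intervalIntegrable_const (c := (1 / 2 : ℝ))).mono_fun saw_meas.aestronglyMeasurable ?_
  filter_upwards with t
  simpa using saw_abs t

lemma sawK_ii {𝕜 : Type*} [RCLike 𝕜] (a b : ℝ) :
    IntervalIntegrable (fun t => (saw t : 𝕜)) volume a b := by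
  have := saw_ii a b
  rw [intervalIntegrable_iff] at this ⊢
  exact this.ofReal

lemma parts {𝕜 : Type*} [RCLike 𝕜] {a b : ℝ} (hab : a ≤ b) (g g' : ℝ → 𝕜)
    (hg : ∀ t ∈ Icc a b, HasDerivAt g (g' t) t) (hg' : ContinuousOn g' (Icc a b)) :
    ∫ t in a..b, g t * (saw t : 𝕜) = g b * (Bt b : 𝕜) - g a * (Bt a : 𝕜) - ∫ t in a..b, g' t * (Bt t : 𝕜) := by
  apply integral_mul_deriv_eq_deriv_mul_of_hasDeriv_right
  · rw [uIcc_of_le hab]; exact fun t ht => (hg t ht).continuousAt.continuousWithinAt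
  · exact (RCLike.continuous_ofReal.comp Bt_cont).continuousOn
  · rw [min_eq_left hab, max_eq_right hab]
    exact fun t ht => (hg t (Ioo_subset_Icc_self ht)).hasDerivWithinAt
  · intro t _
    exact (RCLike.ofRealCLM (K := 𝕜)).hasFDerivAt.comp_hasDerivWithinAt t (Bt_deriv t)
  · apply ContinuousOn.intervalIntegrable; rwa [uIcc_of_le hab]
  · exact sawK_ii a b

lemma EM {𝕜 : Type*} [RCLike 𝕜] {a b : ℝ} (ha : 0 ≤ a) (hab : a ≤ b) (f f' : ℝ → 𝕜)
    (hf : ∀ t ∈ Icc a b, HasDerivAt f (f' t) t) (hf' : ContinuousOn f' (Icc a b)) :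
    ∫ t in a..b, f' t * (saw t : 𝕜) = f b * (saw b : 𝕜) - f a * (saw a : 𝕜) - (∫ t in a..b, f t)
      + ∑ k ∈ Finset.Ioc ⌊a⌋₊ ⌊b⌋₊, f k := by
  have hfc : ContinuousOn f (uIcc a b) := by
    rw [uIcc_of_le hab]; exact fun t ht => (hf t ht).continuousAt.continuousWithinAt
  have hf'i : IntervalIntegrable f' volume a b := by
    apply ContinuousOn.intervalIntegrable; rwa [uIcc_of_le hab]
  have key := sum_mul_eq_sub_sub_integral_mul (f := f) (fun _ => (1 : 𝕜)) ha hab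
    (fun t ht => (hf t ht).differentiableAt) (by
      refine (hf'.integrableOn_Icc).congr_fun (fun t ht => (hf t ht).deriv.symm) measurableSet_Icc)
  have hfl : ∀ t : ℝ, 0 ≤ t → ((⌊t⌋₊ : ℝ)) = t - saw t - 1 / 2 := by
    intro t ht
    rw [natCast_floor_eq_intCast_floor ht, saw, Int.fract]; ring
  have hfl' : ∀ t : ℝ, 0 ≤ t → ((⌊t⌋₊ : 𝕜)) = ((t - saw t - 1 / 2 : ℝ) : 𝕜) := by
    intro t ht; rw [← hfl t ht]; simp
  have hS : ∀ t : ℝ, 0 ≤ t → ∑ k ∈ Finset.Icc 0 ⌊t⌋₊, (1 : 𝕜) = (t : 𝕜) - (saw t : 𝕜) + 1 / 2 := by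
    intro t ht
    simp only [Finset.sum_const, Nat.card_Icc, nsmul_eq_mul, mul_one, tsub_zero]
    push_cast
    rw [hfl' t ht]; push_cast; ring
  rw [hS b (ha.trans hab), hS a ha, ← integral_of_le hab] at key
  have e1 : ∫ t in a..b, deriv f t * ∑ k ∈ Finset.Icc 0 ⌊t⌋₊, (1 : 𝕜) =
      (∫ t in a..b, f' t * ((t : 𝕜) + 1 / 2)) - ∫ t in a..b, f' t * (saw t : 𝕜) := by
    rw [← intervalIntegral.integral_sub]
    · apply integral_congr
      intro t ht
      rw [uIcc_of_le hab] at ht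
      simp only
      rw [hS t (ha.trans ht.1), (hf t ht).deriv]; ring
    · apply ContinuousOn.intervalIntegrable; rw [uIcc_of_le hab]
      exact hf'.mul (by fun_prop)
    · exact (sawK_ii a b).continuousOn_mul (by rwa [uIcc_of_le hab])
  have e2 : ∫ t in a..b, ((t : 𝕜) + 1 / 2) * f' t = ((b : 𝕜) + 1 / 2) * f b - ((a : 𝕜) + 1 / 2) * f a
      - ∫ t in a..b, (1 : 𝕜) * f t := by
    apply integral_mul_deriv_eq_deriv_mul_of_hasDerivAt (u := fun t : ℝ => (t : 𝕜) + 1 / 2) (u' := fun _ => 1)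
    · fun_prop
    · exact hfc
    · intro t _
      have := ((RCLike.ofRealCLM (K := 𝕜)).hasFDerivAt.comp_hasDerivAt t (hasDerivAt_id t)).add_const (1 / 2 : 𝕜)
      simpa [Function.comp_def] using this
    · rw [min_eq_left hab, max_eq_right hab]
      exact fun t ht => (hf t (Ioo_subset_Icc_self ht))
    · exact intervalIntegrable_const
    · exact hf'i
  simp only [mul_one, one_mul] at key e2
  have e3 : ∫ t in a..b, f' t * ((t : 𝕜) + 1 / 2) = ∫ t in a..b, ((t : 𝕜) + 1 / 2) * f' t := by
    congr 1; ext t; ring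
  rw [key, e1, e3, e2]; ring
end S3

namespace S3
open MeasureTheory Set Filter Topology

noncomputable def ZU (U : ℝ) (s : ℂ) : ℂ :=
  ∑ k ∈ Finset.Ioc 0 ⌊U⌋₊, (k : ℂ) ^ (-s) + (U : ℂ) ^ (-s) * (saw U : ℂ) + (U : ℂ) ^ (1 - s) / (s - 1)

lemma cpow_der {t : ℝ} (ht : 0 < t) {r : ℂ} :
    HasDerivAt (fun y : ℝ => (y : ℂ) ^ r) (r * (t : ℂ) ^ (r - 1)) t := by
  by_cases hr : r = 0
  · subst hr; simpa using hasDerivAt_const t (1 : ℂ)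
  · exact hasDerivAt_ofReal_cpow_const ht.ne' hr

lemma cpow_contOn {A U : ℝ} (hA : 0 < A) (r : ℂ) :
    ContinuousOn (fun y : ℝ => (y : ℂ) ^ r) (Icc A U) :=
  fun _ ht => (cpow_der (hA.trans_le ht.1)).continuousAt.continuousWithinAt

lemma ZU_step {A U : ℝ} (hA : 1 ≤ A) (hAU : A ≤ U) {s : ℂ} (hs : s ≠ 1) :
    ZU A s - ∫ u in A..U, s * (u : ℂ) ^ (-s - 1) * (saw u : ℂ) = ZU U s := by
  have h := EM (𝕜 := ℂ) (zero_le_one.trans hA) hAU (fun y : ℝ => (y : ℂ) ^ (-s)) (fun y => -s * (y : ℂ) ^ (-s - 1))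
    (fun t ht => cpow_der (by linarith [ht.1])) ((cpow_contOn (by linarith) _).const_smul (-s))
  have h2 : ∫ t in A..U, (t : ℂ) ^ (-s) = ((U : ℂ) ^ (-s + 1) - (A : ℂ) ^ (-s + 1)) / (-s + 1) := by
    apply integral_cpow
    right
    refine ⟨fun h => hs (neg_injective h), ?_⟩
    rw [uIcc_of_le hAU]; intro h; linarith [h.1]
  rw [h2] at h
  have h3 : ∫ u in A..U, s * (u : ℂ) ^ (-s - 1) * (saw u : ℂ) =
     - ∫ u in A..U, -s * (u : ℂ) ^ (-s - 1) * (saw u : ℂ) := by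
    rw [← intervalIntegral.integral_neg]; congr 1; ext u; ring
  rw [h3]
  have h4 : ∑ k ∈ Finset.Ioc 0 ⌊U⌋₊, (k : ℂ) ^ (-s) = ∑ k ∈ Finset.Ioc 0 ⌊A⌋₊, (k : ℂ) ^ (-s) +
      ∑ k ∈ Finset.Ioc ⌊A⌋₊ ⌊U⌋₊, (k : ℂ) ^ (-s) := by
    rw [Finset.sum_Ioc_consecutive _ (Nat.zero_le _) (Nat.floor_le_floor hAU)]
  have h5 : s - 1 ≠ 0 := sub_ne_zero.2 hs
  have h5' : -s + 1 ≠ 0 := by intro h; apply h5; linear_combination -h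
  erw [h]
  rw [ZU, ZU, h4, show -s + 1 = 1 - s by ring]
  simp only [RCLike.ofReal_eq_complex_ofReal]
  have h6 : ((U : ℂ) ^ (1 - s) - (A : ℂ) ^ (1 - s)) / (1 - s) = - (U : ℂ) ^ (1 - s) / (s - 1) + (A : ℂ) ^ (1 - s) / (s - 1) := by
    rw [show 1 - s = -(s - 1) by ring] at *
    field_simp
    ring
  rw [h6]
  push_cast
  ring

lemma saw_int_parts {A U : ℝ} (hA : 1 ≤ A) (hAU : A ≤ U) (s : ℂ) :
    ∫ u in A..U, s * (u : ℂ) ^ (-s - 1) * (saw u : ℂ) =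
      s * (U : ℂ) ^ (-s - 1) * (Bt U : ℂ) - s * (A : ℂ) ^ (-s - 1) * (Bt A : ℂ)
      + s * (s + 1) * ∫ u in A..U, (u : ℂ) ^ (-s - 2) * (Bt u : ℂ) := by
  have h := parts (𝕜 := ℂ) hAU (fun y : ℝ => s * (y : ℂ) ^ (-s - 1)) (fun y => s * ((-s - 1) * (y : ℂ) ^ (-s - 1 - 1)))
    (fun t ht => (cpow_der (by linarith [ht.1])).const_mul s)
    (((cpow_contOn (by linarith) _).const_smul (-s - 1)).const_smul s)
  erw [h]
  rw [← intervalIntegral.integral_const_mul, sub_eq_add_neg _ (∫ t in A..U, _), ← intervalIntegral.integral_neg]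
  congr 2
  ext u
  rw [show -s - 1 - 1 = -s - 2 by ring]
  simp only [RCLike.ofReal_eq_complex_ofReal]
  ring

lemma B_int {A : ℝ} (hA : 1 ≤ A) {s : ℂ} (hs : -1 < s.re) :
    IntegrableOn (fun u : ℝ => (u : ℂ) ^ (-s - 2) * (Bt u : ℂ)) (Ioi A) := by
  have h0 : IntegrableOn (fun u : ℝ => u ^ (-s.re - 2)) (Ioi A) :=
    integrableOn_Ioi_rpow_of_lt (by linarith) (by linarith)
  refine Integrable.mono' h0 ?_ ?_
  · apply ContinuousOn.aestronglyMeasurable _ measurableSet_Ioi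
    refine ContinuousOn.mul ?_ (Complex.continuous_ofReal.comp Bt_cont).continuousOn
    exact fun t ht => (cpow_der (by linarith [mem_Ioi.1 ht])).continuousAt.continuousWithinAt
  · filter_upwards [ae_restrict_mem measurableSet_Ioi] with u hu
    have : 0 < u := by linarith [mem_Ioi.1 hu]
    rw [norm_mul, Complex.norm_cpow_eq_rpow_re_of_pos this, Complex.norm_real]
    simp only [Complex.sub_re, Complex.neg_re, Complex.re_ofNat]
    have := Bt_abs u
    rw [Real.norm_eq_abs]
    exact mul_le_of_le_one_right (by positivity) this

lemma B_bound {A : ℝ} (hA : 1 ≤ A) {s : ℂ} (hs : -1 < s.re) :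
    ‖∫ u in Ioi A, (u : ℂ) ^ (-s - 2) * (Bt u : ℂ)‖ ≤ A ^ (-s.re - 1) / (s.re + 1) := by
  have h0 : IntegrableOn (fun u : ℝ => u ^ (-s.re - 2)) (Ioi A) :=
    integrableOn_Ioi_rpow_of_lt (by linarith) (by linarith)
  refine (norm_integral_le_of_norm_le h0 (f := fun u : ℝ => (u : ℂ) ^ (-s - 2) * (Bt u : ℂ)) ?_).trans ?_
  · filter_upwards [ae_restrict_mem measurableSet_Ioi] with u hu
    have : 0 < u := by linarith [mem_Ioi.1 hu]
    rw [norm_mul, Complex.norm_cpow_eq_rpow_re_of_pos this, Complex.norm_real]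
    simp only [Complex.sub_re, Complex.neg_re, Complex.re_ofNat]
    have := Bt_abs u
    rw [Real.norm_eq_abs]
    exact mul_le_of_le_one_right (by positivity) this
  · rw [integral_Ioi_rpow_of_lt (by linarith) (by linarith)]
    rw [show -s.re - 2 + 1 = -(s.re + 1) by ring, show -s.re - 1 = -(s.re + 1) by ring]
    rw [neg_div_neg_eq]

noncomputable def Mf (s : ℂ) : ℂ := ∫ u in Ioi (1 : ℝ), (u : ℂ) ^ (-s - 2) * (Bt u : ℂ)

lemma Mf_mellin (s : ℂ) : Mf s = mellin (indicator (Ioi (1 : ℝ)) (fun u => (Bt u : ℂ))) (-s - 1) := by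
  rw [Mf, mellin]
  have : ∀ t : ℝ, (t : ℂ) ^ (-s - 1 - 1) • indicator (Ioi (1 : ℝ)) (fun u => (Bt u : ℂ)) t
      = indicator (Ioi (1 : ℝ)) (fun u => (u : ℂ) ^ (-s - 2) * (Bt u : ℂ)) t := by
    intro t
    by_cases h : t ∈ Ioi (1 : ℝ)
    · simp only [indicator_of_mem h, smul_eq_mul]; rw [show -s - 1 - 1 = -s - 2 by ring]
    · simp only [indicator_of_notMem h, smul_zero]
  simp_rw [this]
  rw [setIntegral_indicator measurableSet_Ioi, Ioi_inter_Ioi]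
  simp

lemma Mf_diff {s : ℂ} (hs : -1 < s.re) : DifferentiableAt ℂ Mf s := by
  have : Mf = (mellin (indicator (Ioi (1 : ℝ)) (fun u => (Bt u : ℂ)))) ∘ (fun s => -s - 1) := by
    ext s; exact Mf_mellin s
  rw [this]
  refine DifferentiableAt.comp s ?_ (by fun_prop)
  apply mellin_differentiableAt_of_isBigO_rpow (a := 0) (b := (-s - 1).re - 1)
  · apply LocallyIntegrable.locallyIntegrableOn
    apply LocallyIntegrable.indicator _ measurableSet_Ioi
    exact (Complex.continuous_ofReal.comp Bt_cont).locallyIntegrable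
  · refine Asymptotics.IsBigO.of_bound 1 (Eventually.of_forall fun x => ?_)
    simp only [neg_zero, Real.rpow_zero, norm_one, mul_one]
    refine (norm_indicator_le_norm_self _ _).trans ?_
    simpa using Bt_abs x
  · simp; linarith
  · have : (indicator (Ioi (1 : ℝ)) (fun u => (Bt u : ℂ))) =ᶠ[𝓝[>] 0] fun _ => 0 := by
      filter_upwards [Ioo_mem_nhdsGT (zero_lt_one (α := ℝ))] with t ht
      exact indicator_of_notMem (by simp [ht.2.le]) _
    exact this.trans_isBigO (Asymptotics.isBigO_zero _ _)
  · linarith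

lemma Bt_one : Bt 1 = 0 := by simp [Bt]

lemma ZU_one (s : ℂ) : ZU 1 s = 1 / 2 + 1 / (s - 1) := by
  simp [ZU, saw]; ring

lemma ZU_tendsto {s : ℂ} (hs : 1 < s.re) : Tendsto (fun n : ℕ => ZU n s) atTop (𝓝 (riemannZeta s)) := by
  have hs1 : s ≠ 1 := by rintro rfl; simp at hs
  have h1 : Tendsto (fun n : ℕ => ∑ k ∈ Finset.Ioc 0 n, (k : ℂ) ^ (-s)) atTop (𝓝 (riemannZeta s)) := by
    have := ((Complex.summable_one_div_nat_cpow.2 hs).hasSum.tendsto_sum_nat).comp (tendsto_add_atTop_nat 1)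
    rw [← zeta_eq_tsum_one_div_nat_cpow hs] at this
    refine this.congr fun n => ?_
    simp only [Function.comp]
    rw [Finset.range_eq_Ico, Finset.sum_eq_sum_Ico_succ_bot (by omega)]
    have h0 : s ≠ 0 := by rintro rfl; simp at hs; linarith
    simp only [Nat.cast_zero, Complex.zero_cpow h0, div_zero, zero_add, Complex.cpow_neg, one_div]
    rfl
  have h2 : Tendsto (fun n : ℕ => ((n : ℝ) : ℂ) ^ (-s) * (saw n : ℂ)) atTop (𝓝 0) := by
    rw [tendsto_zero_iff_norm_tendsto_zero]
    have h : Tendsto (fun n : ℕ => (n : ℝ) ^ (-s.re)) atTop (𝓝 0) :=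
      (tendsto_rpow_neg_atTop (by linarith)).comp tendsto_natCast_atTop_atTop
    refine squeeze_zero' (Eventually.of_forall fun _ => norm_nonneg _) ?_ h
    filter_upwards [eventually_gt_atTop 0] with n hn
    rw [norm_mul, Complex.norm_cpow_eq_rpow_re_of_pos (by exact_mod_cast hn), Complex.norm_real]
    rw [Complex.neg_re]
    exact mul_le_of_le_one_right (by positivity) ((saw_abs n).trans (by norm_num))
  have h3 : Tendsto (fun n : ℕ => ((n : ℝ) : ℂ) ^ (1 - s) / (s - 1)) atTop (𝓝 0) := by
    rw [← zero_div (s - 1)]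
    apply Tendsto.div_const
    rw [tendsto_zero_iff_norm_tendsto_zero]
    have h : Tendsto (fun n : ℕ => (n : ℝ) ^ (-(s.re - 1))) atTop (𝓝 0) :=
      (tendsto_rpow_neg_atTop (by linarith)).comp tendsto_natCast_atTop_atTop
    refine h.congr' ?_
    filter_upwards [eventually_gt_atTop 0] with n hn
    rw [Complex.norm_cpow_eq_rpow_re_of_pos (by exact_mod_cast hn)]
    simp
  have := (h1.add h2).add h3
  simp only [add_zero] at this
  refine this.congr fun n => ?_
  simp [ZU]

lemma ZU_formula {U : ℝ} (hU : 1 ≤ U) {s : ℂ} (hs : s ≠ 1) :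
    ZU U s = ZU 1 s - (s * (U : ℂ) ^ (-s - 1) * (Bt U : ℂ) + s * (s + 1) * ∫ u in (1:ℝ)..U, (u : ℂ) ^ (-s - 2) * (Bt u : ℂ)) := by
  rw [← ZU_step le_rfl hU hs, saw_int_parts le_rfl hU, Bt_one]
  simp

lemma zeta_gt {s : ℂ} (hs : 1 < s.re) : riemannZeta s = ZU 1 s - s * (s + 1) * Mf s := by
  have hs1 : s ≠ 1 := by rintro rfl; simp at hs
  refine tendsto_nhds_unique (ZU_tendsto hs) ?_
  have h1 : Tendsto (fun n : ℕ => s * ((n : ℝ) : ℂ) ^ (-s - 1) * (Bt n : ℂ)) atTop (𝓝 0) := by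
    rw [tendsto_zero_iff_norm_tendsto_zero]
    have h : Tendsto (fun n : ℕ => ‖s‖ * (n : ℝ) ^ (-(s.re + 1))) atTop (𝓝 (‖s‖ * 0)) :=
      ((tendsto_rpow_neg_atTop (by linarith)).comp tendsto_natCast_atTop_atTop).const_mul _
    rw [mul_zero] at h
    refine squeeze_zero' (Eventually.of_forall fun _ => norm_nonneg _) ?_ h
    filter_upwards [eventually_gt_atTop 0] with n hn
    rw [norm_mul, norm_mul, Complex.norm_cpow_eq_rpow_re_of_pos (by exact_mod_cast hn), Complex.norm_real]
    rw [Complex.sub_re, Complex.neg_re, Complex.one_re, show -s.re - 1 = -(s.re + 1) by ring]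
    exact mul_le_of_le_one_right (by positivity) ((Bt_abs n))
  have h2 := intervalIntegral_tendsto_integral_Ioi (1:ℝ) (B_int le_rfl (s := s) (by linarith))
    (tendsto_natCast_atTop_atTop (R := ℝ))
  have h3 := (tendsto_const_nhds (x := ZU 1 s)).sub (h1.add (h2.const_mul (s * (s + 1))))
  rw [zero_add] at h3
  refine h3.congr' ?_
  filter_upwards [eventually_ge_atTop 1] with n hn
  rw [ZU_formula (U := (n : ℝ)) (by exact_mod_cast hn) hs1]

lemma zeta_cont {s : ℂ} (hs : -1 < s.re) (hs1 : s ≠ 1) : riemannZeta s = ZU 1 s - s * (s + 1) * Mf s := by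
  have hop : IsOpen {s : ℂ | -1 < s.re} := isOpen_lt continuous_const Complex.continuous_re
  have h : EqOn riemannZeta₀ (fun s => 1 / 2 - s * (s + 1) * Mf s) {s : ℂ | -1 < s.re} := by
    refine AnalyticOnNhd.eqOn_of_preconnected_of_eventuallyEq (𝕜 := ℂ) (z₀ := 2) ?_ ?_ ?_ ?_ ?_
    · exact differentiable_riemannZeta₀.differentiableOn.analyticOnNhd hop
    · refine DifferentiableOn.analyticOnNhd (fun s hs => ?_) hop
      have := Mf_diff hs
      apply DifferentiableAt.differentiableWithinAt
      fun_prop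
    · exact (convex_halfSpace_re_gt (-1)).isPreconnected
    · simp; norm_num
    · have : {s : ℂ | 1 < s.re} ∈ 𝓝 (2 : ℂ) := (isOpen_lt continuous_const Complex.continuous_re).mem_nhds (by simp)
      filter_upwards [this] with s hs
      have hs1 : s ≠ 1 := by rintro rfl; simp at hs
      have h := zeta_gt hs
      rw [riemannZeta_eq_inv_sub_add hs1, ZU_one] at h
      rw [one_div (s - 1)] at h
      linear_combination h
  rw [riemannZeta_eq_inv_sub_add hs1, h hs, ZU_one, one_div (s - 1)]; ring

lemma zeta_ZU {U : ℝ} (hU : 1 ≤ U) {s : ℂ} (hs : 0 ≤ s.re) (hs1 : s ≠ 1) :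
    ‖riemannZeta s - ZU U s‖ ≤ ‖s‖ * (1 + ‖s + 1‖) * U ^ (-s.re - 1) := by
  have hU0 : 0 < U := by linarith
  rw [zeta_cont (by linarith) hs1, ZU_formula hU hs1]
  have h : Mf s - ∫ u in (1:ℝ)..U, (u : ℂ) ^ (-s - 2) * (Bt u : ℂ) = ∫ u in Ioi U, (u : ℂ) ^ (-s - 2) * (Bt u : ℂ) := by
    rw [Mf, ← intervalIntegral.integral_interval_add_Ioi (B_int le_rfl (by linarith)) (B_int hU (by linarith))]
    ring
  have e : ZU 1 s - s * (s + 1) * Mf s - (ZU 1 s - (s * (U : ℂ) ^ (-s - 1) * (Bt U : ℂ) + s * (s + 1) * ∫ u in (1:ℝ)..U, (u : ℂ) ^ (-s - 2) * (Bt u : ℂ)))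
    = s * (U : ℂ) ^ (-s - 1) * (Bt U : ℂ) - s * (s + 1) * ∫ u in Ioi U, (u : ℂ) ^ (-s - 2) * (Bt u : ℂ) := by
    rw [← h]; ring
  rw [e]
  refine (norm_sub_le _ _).trans ?_
  have hb := B_bound hU (s := s) (by linarith)
  rw [norm_mul, norm_mul, norm_mul, norm_mul, Complex.norm_cpow_eq_rpow_re_of_pos hU0, Complex.norm_real]
  have e2 : (-s - 1).re = -s.re - 1 := by simp
  rw [e2]
  have hp : 0 ≤ U ^ (-s.re - 1) := by positivity
  have h1 : ‖s‖ * U ^ (-s.re - 1) * ‖Bt U‖ ≤ ‖s‖ * U ^ (-s.re - 1) :=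
    mul_le_of_le_one_right (by positivity) (Bt_abs U)
  have h2 : ‖∫ u in Ioi U, (u : ℂ) ^ (-s - 2) * (Bt u : ℂ)‖ ≤ U ^ (-s.re - 1) := 
    hb.trans (div_le_self hp (by linarith))
  have h3 := mul_le_mul_of_nonneg_left h2 (by positivity : 0 ≤ ‖s‖ * ‖s + 1‖)
  linarith
end S3

namespace S3
open MeasureTheory Set Filter Topology

lemma zeta_one_line {t : ℝ} (ht : 1 ≤ |t|) : ‖riemannZeta (1 - Complex.I * t)‖ ≤ 11 + Real.log |t| := by
  set s : ℂ := 1 - Complex.I * t with hs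
  have hre : s.re = 1 := by simp [hs]
  have ht0 : t ≠ 0 := by rintro rfl; norm_num at ht
  have hs1 : s ≠ 1 := by
    intro h; apply ht0
    have := congrArg Complex.im h
    simpa [hs] using this
  have h := zeta_ZU (U := |t|) ht (s := s) (by rw [hre]; norm_num) hs1
  have htp : 0 < |t| := by linarith
  have hn : ‖s‖ ≤ 1 + |t| := by
    refine (norm_sub_le _ _).trans ?_; simp
  have hn' : ‖s + 1‖ ≤ 2 + |t| := by
    refine (norm_add_le _ _).trans ?_; rw [norm_one]; linarith
  rw [hre] at h
  have e1 : ‖s‖ * (1 + ‖s + 1‖) * |t| ^ (-1 - 1 : ℝ) ≤ 8 := by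
    rw [show (-1 - 1 : ℝ) = -(2:ℕ) by norm_num, Real.rpow_neg htp.le, Real.rpow_natCast]
    rw [mul_inv_le_iff₀ (by positivity)]
    calc _ ≤ (1 + |t|) * (1 + (2 + |t|)) := by gcongr
      _ ≤ _ := by nlinarith
  have e2 : ‖ZU |t| s‖ ≤ 3 + Real.log |t| := by
    rw [ZU]
    refine (norm_add₃_le).trans ?_
    have a1 : ‖∑ k ∈ Finset.Ioc 0 ⌊|t|⌋₊, (k : ℂ) ^ (-s)‖ ≤ 1 + Real.log |t| := by
      refine (norm_sum_le _ _).trans ?_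
      refine le_trans (le_of_eq ?_) (harmonic_floor_le_one_add_log |t| ht)
      rw [harmonic_eq_sum_Icc]
      push_cast
      refine Finset.sum_congr rfl fun k hk => ?_
      have hk0 : 0 < k := (Finset.mem_Ioc.1 hk).1
      have : ((k : ℕ) : ℂ) = ((k : ℝ) : ℂ) := by simp
      rw [this, Complex.norm_cpow_eq_rpow_re_of_pos (by exact_mod_cast hk0), Complex.neg_re, hre, Real.rpow_neg_one]
    have a2 : ‖((|t| : ℝ) : ℂ) ^ (-s) * (saw |t| : ℂ)‖ ≤ 1 := by
      rw [norm_mul, Complex.norm_cpow_eq_rpow_re_of_pos htp, Complex.neg_re, hre, Real.rpow_neg_one, Complex.norm_real]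
      have := saw_abs |t|
      have h2 : |t|⁻¹ ≤ 1 := inv_le_one_of_one_le₀ ht
      rw [Real.norm_eq_abs]
      have h3 : 0 ≤ |t|⁻¹ := by positivity
      nlinarith [abs_nonneg (saw |t|)]
    have a3 : ‖((|t| : ℝ) : ℂ) ^ (1 - s) / (s - 1)‖ ≤ 1 := by
      rw [norm_div, Complex.norm_cpow_eq_rpow_re_of_pos htp]
      have : s - 1 = -(Complex.I * t) := by rw [hs]; ring
      rw [this]
      simp [hre]
      exact inv_le_one_of_one_le₀ ht
    linarith
  have : ‖riemannZeta s‖ ≤ ‖riemannZeta s - ZU |t| s‖ + ‖ZU |t| s‖ := by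
    simpa using norm_add_le (riemannZeta s - ZU |t| s) (ZU |t| s)
  linarith

lemma gamma_cos {t : ℝ} (ht : t ≠ 0) :
    ‖Complex.Gamma (1 - Complex.I * t) * Complex.cos (Real.pi * (1 - Complex.I * t) / 2)‖ ^ 2 ≤ Real.pi * |t| / 2 := by
  set w : ℂ := ((Real.pi * t / 2 : ℝ) : ℂ) * Complex.I with hw
  have hcos : Complex.cos (Real.pi * (1 - Complex.I * t) / 2) = Complex.sin w := by
    rw [← Complex.cos_pi_div_two_sub]; congr 1; rw [hw]; push_cast; ring
  have hz : (Complex.I * t) ≠ 0 := mul_ne_zero Complex.I_ne_zero (by exact_mod_cast ht)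
  have hrefl := Complex.Gamma_mul_Gamma_one_sub (Complex.I * t)
  have hadd := Complex.Gamma_add_one (Complex.I * t) hz
  have hconj : Complex.Gamma (Complex.I * t + 1) = (starRingEnd ℂ) (Complex.Gamma (1 - Complex.I * t)) := by
    rw [← Complex.Gamma_conj]; congr 1; simp; ring
  have hs2 : Complex.sin (Real.pi * (Complex.I * t)) = 2 * Complex.sin w * Complex.cos w := by
    rw [← Complex.sin_two_mul]; congr 1; rw [hw]; push_cast; ring
  have hn : ‖Complex.Gamma (1 - Complex.I * t)‖ ^ 2 = |t| * (Real.pi / ‖2 * Complex.sin w * Complex.cos w‖) := by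
    have : ‖Complex.Gamma (1 - Complex.I * t)‖ ^ 2 = ‖Complex.Gamma (Complex.I * t + 1) * Complex.Gamma (1 - Complex.I * t)‖ := by
      rw [norm_mul, hconj, Complex.norm_conj]; ring
    rw [this, hadd, mul_assoc, hrefl, hs2, norm_mul, norm_div]
    simp [abs_of_pos Real.pi_pos]
  rw [norm_mul, mul_pow, hn, hcos]
  have hsin : ‖Complex.sin w‖ = |Real.sinh (Real.pi * t / 2)| := by
    rw [hw, Complex.sin_mul_I, norm_mul, Complex.norm_I, mul_one, ← Complex.ofReal_sinh, Complex.norm_real, Real.norm_eq_abs]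
  have hcw : ‖Complex.cos w‖ = Real.cosh (Real.pi * t / 2) := by
    rw [hw, Complex.cos_mul_I, ← Complex.ofReal_cosh, Complex.norm_real, Real.norm_eq_abs, abs_of_pos (Real.cosh_pos _)]
  have hle : ‖Complex.sin w‖ ≤ ‖Complex.cos w‖ := by
    rw [hsin, hcw]
    apply abs_le_of_sq_le_sq _ (Real.cosh_pos _).le
    have := Real.cosh_sq (Real.pi * t / 2); linarith
  have hs0 : 0 < ‖Complex.sin w‖ := by
    rw [hsin, abs_pos]
    rw [Real.sinh_ne_zero]; 
    have := Real.pi_pos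
    positivity
  have hc0 : 0 < ‖Complex.cos w‖ := by linarith
  rw [norm_mul, norm_mul, Complex.norm_ofNat]
  have : |t| * (Real.pi / (2 * ‖Complex.sin w‖ * ‖Complex.cos w‖)) * ‖Complex.sin w‖ ^ 2 = (Real.pi * |t| / 2) * (‖Complex.sin w‖ / ‖Complex.cos w‖) := by
    field_simp
  rw [this]
  have hpi := Real.pi_pos
  exact mul_le_of_le_one_right (by positivity) ((div_le_one hc0).2 hle)

lemma zeta_zero_line {t : ℝ} (ht : 1 ≤ |t|) : ‖riemannZeta (Complex.I * t)‖ ≤ Real.sqrt |t| * (11 + Real.log |t|) := by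
  have ht0 : t ≠ 0 := by rintro rfl; norm_num at ht
  have h := riemannZeta_one_sub (s := 1 - Complex.I * t) (by
    intro n h
    have := congrArg Complex.im h
    simp at this; exact ht0 this) (by
    intro h
    have := congrArg Complex.im h
    simp at this; exact ht0 this)
  rw [sub_sub_cancel] at h
  rw [h]
  have e : (2 * (2 * (Real.pi : ℂ)) ^ (-(1 - Complex.I * t)) * Complex.Gamma (1 - Complex.I * t) * Complex.cos (Real.pi * (1 - Complex.I * t) / 2) * riemannZeta (1 - Complex.I * t))
    = (2 * (2 * (Real.pi : ℂ)) ^ (-(1 - Complex.I * t))) * (Complex.Gamma (1 - Complex.I * t) * Complex.cos (Real.pi * (1 - Complex.I * t) / 2)) * riemannZeta (1 - Complex.I * t) := by ring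
  rw [e, norm_mul, norm_mul, norm_mul]
  have hpi := Real.pi_gt_three
  have h1 : ‖(2 * (Real.pi : ℂ)) ^ (-(1 - Complex.I * t))‖ = (2 * Real.pi)⁻¹ := by
    have : (2 * (Real.pi : ℂ)) = ((2 * Real.pi : ℝ) : ℂ) := by push_cast; ring
    rw [this, Complex.norm_cpow_eq_rpow_re_of_pos (by positivity)]
    simp [Real.rpow_neg_one]
  have h2 : ‖Complex.Gamma (1 - Complex.I * t) * Complex.cos (Real.pi * (1 - Complex.I * t) / 2)‖ ≤ Real.sqrt (Real.pi * |t| / 2) :=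
    Real.le_sqrt_of_sq_le (gamma_cos ht0)
  have h3 : Real.sqrt (Real.pi * |t| / 2) ≤ Real.pi * Real.sqrt |t| := by
    rw [Real.sqrt_le_left (by positivity), mul_pow, Real.sq_sqrt (abs_nonneg _)]
    nlinarith [abs_nonneg t, mul_nonneg (mul_nonneg Real.pi_pos.le (abs_nonneg t)) (sub_nonneg.2 hpi.le)]
  have h4 := zeta_one_line ht
  rw [h1, Complex.norm_ofNat]
  have h5 : 2 * (2 * Real.pi)⁻¹ * ‖Complex.Gamma (1 - Complex.I * t) * Complex.cos (Real.pi * (1 - Complex.I * t) / 2)‖ ≤ Real.sqrt |t| := by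
    have := h2.trans h3
    calc _ ≤ 2 * (2 * Real.pi)⁻¹ * (Real.pi * Real.sqrt |t|) := by gcongr
      _ = _ := by field_simp
  exact mul_le_mul h5 h4 (norm_nonneg _) (Real.sqrt_nonneg _)
end S3

namespace S3
open MeasureTheory Set Filter Topology Real

noncomputable def Dir (N : ℕ) (v : ℝ) : ℝ := 1 + 2 * ∑ n ∈ Finset.range N, cos (2 * π * (n + 1) * v)
noncomputable def DirD (N : ℕ) (v : ℝ) : ℝ := -(∑ n ∈ Finset.range N, 4 * π * (n + 1) * sin (2 * π * (n + 1) * v))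
noncomputable def Ds (N : ℕ) (v : ℝ) : ℝ := ∑ n ∈ Finset.range N, sin (2 * π * (n + 1) * v) / (π * (n + 1))
noncomputable def Pf (N : ℕ) (v : ℝ) : ℝ := v + Ds N v

lemma Ds_deriv (N : ℕ) (v : ℝ) : HasDerivAt (Ds N) (Dir N v - 1) v := by
  have : HasDerivAt (fun v => ∑ n ∈ Finset.range N, sin (2 * π * ((n : ℝ) + 1) * v) / (π * ((n : ℝ) + 1)))
      (∑ n ∈ Finset.range N, cos (2 * π * ((n : ℝ) + 1) * v) * (2 * π * ((n : ℝ) + 1) * 1) / (π * ((n : ℝ) + 1))) v := by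
    apply HasDerivAt.fun_sum
    intro n _
    exact (((hasDerivAt_id v).const_mul (2 * π * ((n : ℝ) + 1))).sin).div_const _
  refine this.congr_deriv ?_
  rw [Dir, add_sub_cancel_left, Finset.mul_sum]
  refine Finset.sum_congr rfl fun n _ => ?_
  have : (n : ℝ) + 1 ≠ 0 := by positivity
  field_simp

lemma Pf_deriv (N : ℕ) (v : ℝ) : HasDerivAt (Pf N) (Dir N v) v := by
  have := (hasDerivAt_id v).add (Ds_deriv N v)
  refine this.congr_deriv ?_
  ring

lemma Dir_deriv (N : ℕ) (v : ℝ) : HasDerivAt (Dir N) (DirD N v) v := by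
  have : HasDerivAt (fun v => ∑ n ∈ Finset.range N, cos (2 * π * ((n : ℝ) + 1) * v))
      (∑ n ∈ Finset.range N, -sin (2 * π * ((n : ℝ) + 1) * v) * (2 * π * ((n : ℝ) + 1) * 1)) v := by
    apply HasDerivAt.fun_sum
    intro n _
    exact (((hasDerivAt_id v).const_mul (2 * π * ((n : ℝ) + 1))).cos)
  refine ((this.const_mul 2).const_add 1).congr_deriv ?_
  rw [DirD, Finset.mul_sum, ← Finset.sum_neg_distrib]
  refine Finset.sum_congr rfl fun n _ => ?_
  ring

lemma Dir_cont (N : ℕ) : Continuous (Dir N) :=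
  continuous_iff_continuousAt.2 fun v => (Dir_deriv N v).continuousAt

lemma Pf_cont (N : ℕ) : Continuous (Pf N) :=
  continuous_iff_continuousAt.2 fun v => (Pf_deriv N v).continuousAt

lemma DirD_cont (N : ℕ) : Continuous (DirD N) := by
  unfold DirD; fun_prop

lemma Dir_sin (N : ℕ) (v : ℝ) : Dir N v * sin (π * v) = sin ((2 * N + 1) * π * v) := by
  induction N with
  | zero => simp [Dir]
  | succ N ih =>
    have h : Dir (N + 1) v = Dir N v + 2 * cos (2 * π * (N + 1) * v) := by
      simp only [Dir, Finset.sum_range_succ]; ring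
    rw [h, add_mul, ih]
    push_cast
    have e1 : (2 * (N : ℝ) + 1) * π * v = 2 * π * (N + 1) * v - π * v := by ring
    have e2 : (2 * ((N : ℝ) + 1) + 1) * π * v = 2 * π * (N + 1) * v + π * v := by ring
    rw [e1, e2, sin_sub, sin_add]; ring

lemma Dir_abs (N : ℕ) (v : ℝ) : |Dir N v| ≤ 2 * N + 1 := by
  rw [Dir]
  refine (abs_add_le _ _).trans ?_
  rw [abs_one, abs_mul, abs_two]
  have : |∑ n ∈ Finset.range N, cos (2 * π * ((n : ℝ) + 1) * v)| ≤ N := by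
    refine (Finset.abs_sum_le_sum_abs _ _).trans ?_
    calc _ ≤ ∑ n ∈ Finset.range N, (1 : ℝ) := Finset.sum_le_sum fun n _ => abs_cos_le_one _
      _ = N := by simp
  linarith

lemma DirD_abs (N : ℕ) (v : ℝ) : |DirD N v| ≤ 4 * π * (2 * N + 1) ^ 2 := by
  rw [DirD, abs_neg]
  have hpi := pi_pos
  have : |∑ n ∈ Finset.range N, 4 * π * ((n : ℝ) + 1) * sin (2 * π * ((n : ℝ) + 1) * v)| ≤ N * (4 * π * N) := by
    refine (Finset.abs_sum_le_sum_abs _ _).trans ?_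
    calc _ ≤ ∑ n ∈ Finset.range N, (4 * π * N) := Finset.sum_le_sum fun n hn => by
            rw [abs_mul, abs_of_nonneg (by positivity : 0 ≤ 4 * π * ((n : ℝ) + 1))]
            have : (n : ℝ) + 1 ≤ N := by exact_mod_cast Finset.mem_range.1 hn
            calc _ ≤ 4 * π * ((n : ℝ) + 1) * 1 := by gcongr; exact abs_sin_le_one _
              _ ≤ _ := by rw [mul_one]; gcongr
      _ = _ := by simp
  refine this.trans ?_
  have hN : (0:ℝ) ≤ N := by positivity
  nlinarith [mul_nonneg hpi.le hN, mul_nonneg hpi.le (mul_nonneg hN hN)]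

lemma DirD_sin (N : ℕ) (v : ℝ) : |DirD N v| * |sin (π * v)| ≤ 2 * π * (2 * N + 1) := by
  have h1 : HasDerivAt (fun v => Dir N v * sin (π * v)) (DirD N v * sin (π * v) + Dir N v * (cos (π * v) * (π * 1))) v :=
    (Dir_deriv N v).mul ((hasDerivAt_id v).const_mul π).sin
  have h2 : HasDerivAt (fun v => Dir N v * sin (π * v)) (cos ((2 * N + 1) * π * v) * ((2 * N + 1) * π * 1)) v := by
    have := ((hasDerivAt_id v).const_mul ((2 * (N:ℝ) + 1) * π)).sin
    refine this.congr_of_eventuallyEq (Eventually.of_forall fun w => Dir_sin N w)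
  have h := h1.unique h2
  rw [← abs_mul]
  have e : DirD N v * sin (π * v) = cos ((2 * N + 1) * π * v) * ((2 * N + 1) * π) - Dir N v * cos (π * v) * π := by
    linear_combination h
  have hpi := pi_pos
  have a1 : |cos ((2 * N + 1) * π * v) * ((2 * N + 1) * π)| ≤ (2 * N + 1) * π := by
    rw [abs_mul, abs_of_nonneg (by positivity : 0 ≤ (2 * (N:ℝ) + 1) * π)]
    exact mul_le_of_le_one_left (by positivity) (abs_cos_le_one _)
  have a2 : |Dir N v * cos (π * v) * π| ≤ (2 * N + 1) * π := by
    rw [abs_mul, abs_mul, abs_of_pos hpi]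
    have := mul_le_mul (Dir_abs N v) (abs_cos_le_one (π * v)) (abs_nonneg _) (by positivity)
    gcongr; linarith
  rw [e]
  refine (abs_sub _ _).trans ?_
  linarith

lemma Ds_neg (N : ℕ) (v : ℝ) : Ds N (-v) = - Ds N v := by
  rw [Ds, Ds, ← Finset.sum_neg_distrib]
  refine Finset.sum_congr rfl fun n _ => ?_
  rw [mul_neg, sin_neg]; ring

lemma Pf_neg (N : ℕ) (v : ℝ) : Pf N (-v) = - Pf N v := by
  rw [Pf, Pf, Ds_neg]; ring

lemma Ds_add_int (N : ℕ) (v : ℝ) (k : ℤ) : Ds N (v + k) = Ds N v := by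
  rw [Ds, Ds]
  refine Finset.sum_congr rfl fun n _ => ?_
  congr 1
  rw [show 2 * π * ((n : ℝ) + 1) * (v + k) = 2 * π * ((n : ℝ) + 1) * v + (((n + 1) * k : ℤ) : ℝ) * (2 * π) by push_cast; ring]
  exact sin_add_int_mul_two_pi _ _

lemma Dir_add_int (N : ℕ) (v : ℝ) (k : ℤ) : Dir N (v + k) = Dir N v := by
  rw [Dir, Dir]
  congr 2
  refine Finset.sum_congr rfl fun n _ => ?_
  rw [show 2 * π * ((n : ℝ) + 1) * (v + k) = 2 * π * ((n : ℝ) + 1) * v + (((n + 1) * k : ℤ) : ℝ) * (2 * π) by push_cast; ring]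
  exact cos_add_int_mul_two_pi _ _

lemma DirD_add_int (N : ℕ) (v : ℝ) (k : ℤ) : DirD N (v + k) = DirD N v := by
  rw [DirD, DirD]
  congr 1
  refine Finset.sum_congr rfl fun n _ => ?_
  congr 1
  rw [show 2 * π * ((n : ℝ) + 1) * (v + k) = 2 * π * ((n : ℝ) + 1) * v + (((n + 1) * k : ℤ) : ℝ) * (2 * π) by push_cast; ring]
  exact sin_add_int_mul_two_pi _ _

lemma Ds_half (N : ℕ) : Ds N (1 / 2) = 0 := by
  rw [Ds]
  refine Finset.sum_eq_zero fun n _ => ?_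
  rw [show 2 * π * ((n : ℝ) + 1) * (1 / 2) = ((n + 1 : ℕ) : ℝ) * π by push_cast; ring, sin_nat_mul_pi]; simp

lemma Pf_half (N : ℕ) : Pf N (1 / 2) = 1 / 2 := by rw [Pf, Ds_half, add_zero]
lemma Pf_zero (N : ℕ) : Pf N 0 = 0 := by simp [Pf, Ds]

section
variable {v : ℝ}

lemma arg_one_sub (hv : 0 < v) (hv1 : v < 1) :
    (Complex.log (1 - Complex.exp (2 * π * v * Complex.I))).im = π * v - π / 2 := by
  have hs : 0 < sin (π * v) := sin_pos_of_pos_of_lt_pi (by positivity) (by nlinarith [pi_pos])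
  have e : 1 - Complex.exp (2 * π * v * Complex.I) = ((2 * sin (π * v) : ℝ) : ℂ) * Complex.exp ((π * v - π / 2 : ℝ) * Complex.I) := by
    have : (2 * π * v * Complex.I : ℂ) = ((2 * (π * v) : ℝ) : ℂ) * Complex.I := by push_cast; ring
    rw [this]
    have h := sin_sq_add_cos_sq (π * v)
    apply Complex.ext
    · rw [Complex.sub_re, Complex.one_re, Complex.exp_ofReal_mul_I_re, Complex.re_ofReal_mul, Complex.exp_ofReal_mul_I_re,
        cos_sub_pi_div_two, cos_two_mul]
      nlinarith
    · rw [Complex.sub_im, Complex.one_im, Complex.exp_ofReal_mul_I_im, Complex.im_ofReal_mul, Complex.exp_ofReal_mul_I_im,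
        sin_sub_pi_div_two, sin_two_mul]
      ring
  rw [Complex.log_im, e, Complex.arg_real_mul _ (by positivity), Complex.arg_exp_mul_I, toIocMod_eq_self]
  constructor <;> nlinarith [pi_pos]

lemma one_sub_norm (r : ℝ) : ‖1 - (r : ℂ) * Complex.exp (2 * π * v * Complex.I)‖ ^ 2 = (1 - r) ^ 2 + 4 * r * sin (π * v) ^ 2 := by
  have : (2 * π * v * Complex.I : ℂ) = ((2 * (π * v) : ℝ) : ℂ) * Complex.I := by push_cast; ring
  rw [this, ← Complex.normSq_eq_norm_sq, Complex.normSq_apply, Complex.sub_re, Complex.sub_im, Complex.one_re, Complex.one_im,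
    Complex.re_ofReal_mul, Complex.im_ofReal_mul, Complex.exp_ofReal_mul_I_re, Complex.exp_ofReal_mul_I_im]
  have h := sin_sq_add_cos_sq (2 * (π * v))
  have h2 := cos_two_mul (π * v)
  have h3 := sin_sq_add_cos_sq (π * v)
  have : cos (2 * (π * v)) = 1 - 2 * sin (π * v) ^ 2 := by linarith
  rw [this] at h ⊢
  linear_combination r ^ 2 * h

lemma Pf_bound (N : ℕ) (hv : 0 < v) (hv1 : v < 1) : |Pf N v - 1 / 2| ≤ 1 / (π * (2 * N + 1) * sin (π * v)) := by
  have hs : 0 < sin (π * v) := sin_pos_of_pos_of_lt_pi (by positivity) (by nlinarith [pi_pos])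
  set z : ℂ := Complex.exp (2 * π * v * Complex.I) with hz
  have hzn : ‖z‖ = 1 := by
    rw [hz, show (2 * π * v * Complex.I : ℂ) = ((2 * π * v : ℝ) : ℂ) * Complex.I by push_cast; ring, Complex.norm_exp_ofReal_mul_I]
  have hlow : ∀ r : ℝ, 0 ≤ r → 2 * √r * sin (π * v) ≤ ‖1 - (r : ℂ) * z‖ := by
    intro r hr
    apply le_of_sq_le_sq _ (norm_nonneg _)
    rw [one_sub_norm, mul_pow, mul_pow, sq_sqrt hr]
    nlinarith [sq_nonneg (1 - r)]
  have hne : ∀ r : ℝ, 0 ≤ r → 1 - (r : ℂ) * z ≠ 0 := by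
    intro r hr
    rcases hr.eq_or_lt with rfl | hr'
    · simp
    · rw [← norm_pos_iff]; refine lt_of_lt_of_le ?_ (hlow r hr); positivity
  have hslit : ∀ r : ℝ, r ∈ Icc (0:ℝ) 1 → 1 - (r : ℂ) * z ∈ Complex.slitPlane := by
    intro r hr
    by_contra hcon
    rw [Complex.mem_slitPlane_iff] at hcon
    push Not at hcon
    have h1 : ((r : ℂ) * z).re ≤ ‖(r : ℂ) * z‖ := Complex.re_le_norm _
    rw [norm_mul, hzn, Complex.norm_real, Real.norm_eq_abs, abs_of_nonneg hr.1, mul_one] at h1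
    have h2 : (1 - (r : ℂ) * z).re = 1 - ((r : ℂ) * z).re := by simp
    have h3 : (1 - (r : ℂ) * z).re = 0 := by linarith [hcon.1, hr.2]
    exact hne r hr.1 (Complex.ext h3 hcon.2)
  -- main integral
  have hcont : ContinuousOn (fun r : ℝ => z / (1 - (r : ℂ) * z)) (Icc 0 1) := by
    apply ContinuousOn.div (by fun_prop) (by fun_prop)
    exact fun r hr => hne r hr.1
  have hcont2 : ContinuousOn (fun r : ℝ => (r : ℂ) ^ N * z ^ (N + 1) / (1 - (r : ℂ) * z)) (Icc 0 1) := by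
    apply ContinuousOn.div (by fun_prop) (by fun_prop)
    exact fun r hr => hne r hr.1
  have hI1 : ∫ r in (0:ℝ)..1, z / (1 - (r : ℂ) * z) = - Complex.log (1 - z) := by
    have := intervalIntegral.integral_eq_sub_of_hasDerivAt (a := 0) (b := 1) (f := fun r : ℝ => - Complex.log (1 - (r : ℂ) * z))
      (f' := fun r : ℝ => z / (1 - (r : ℂ) * z)) ?_ ?_
    · rw [this]; simp
    · intro r hr
      rw [uIcc_of_le zero_le_one] at hr
      have h1 : HasDerivAt (fun r : ℝ => 1 - (r : ℂ) * z) (-(1 * z)) r :=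
        (((hasDerivAt_id r).ofReal_comp).mul_const z).const_sub 1
      have h2 := (h1.clog_real (hslit r hr)).neg
      refine h2.congr_deriv ?_
      rw [one_mul, neg_div, neg_neg]
    · apply ContinuousOn.intervalIntegrable; rwa [uIcc_of_le zero_le_one]
  have hI2 : ∫ r in (0:ℝ)..1, (∑ n ∈ Finset.range N, (r : ℂ) ^ n * z ^ (n + 1)) = ∑ n ∈ Finset.range N, z ^ (n + 1) / (n + 1) := by
    rw [intervalIntegral.integral_finsetSum]
    · refine Finset.sum_congr rfl fun n _ => ?_
      rw [intervalIntegral.integral_mul_const]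
      have : ∫ r in (0:ℝ)..1, (r : ℂ) ^ n = 1 / (n + 1) := by
        have h := integral_pow (a := 0) (b := 1) n
        have h2 : ∫ r in (0:ℝ)..1, (r : ℂ) ^ n = ((∫ r in (0:ℝ)..1, r ^ n : ℝ) : ℂ) := by
          rw [← intervalIntegral.integral_ofReal]; push_cast; rfl
        rw [h2, h]; simp
      rw [this]; ring
    · intro n _
      apply Continuous.intervalIntegrable; fun_prop
  have hI3 : ∫ r in (0:ℝ)..1, (∑ n ∈ Finset.range N, (r : ℂ) ^ n * z ^ (n + 1)) =
      - Complex.log (1 - z) - ∫ r in (0:ℝ)..1, (r : ℂ) ^ N * z ^ (N + 1) / (1 - (r : ℂ) * z) := by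
    rw [← hI1, ← intervalIntegral.integral_sub]
    · apply intervalIntegral.integral_congr
      intro r hr
      rw [uIcc_of_le zero_le_one] at hr
      simp only
      rw [← sub_div, eq_div_iff (hne r hr.1)]
      have h := geom_sum_mul ((r : ℂ) * z) N
      have : ∑ n ∈ Finset.range N, (r : ℂ) ^ n * z ^ (n + 1) = z * ∑ n ∈ Finset.range N, ((r : ℂ) * z) ^ n := by
        rw [Finset.mul_sum]; refine Finset.sum_congr rfl fun n _ => ?_
        ring
      rw [this]
      linear_combination (-z) * h
    · apply ContinuousOn.intervalIntegrable; rwa [uIcc_of_le zero_le_one]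
    · apply ContinuousOn.intervalIntegrable; rwa [uIcc_of_le zero_le_one]
  have hDs : (∑ n ∈ Finset.range N, z ^ (n + 1) / ((n : ℂ) + 1)).im = π * Ds N v := by
    rw [Complex.im_sum, Ds, Finset.mul_sum]
    refine Finset.sum_congr rfl fun n _ => ?_
    rw [hz, ← Complex.exp_nat_mul, show ((n + 1 : ℕ) : ℂ) * (2 * π * v * Complex.I) = ((2 * π * (n + 1) * v : ℝ) : ℂ) * Complex.I by push_cast; ring]
    rw [show ((n : ℂ) + 1) = ((n + 1 : ℝ) : ℂ) by push_cast; ring, Complex.div_ofReal_im, Complex.exp_ofReal_mul_I_im]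
    have := pi_ne_zero
    have : (n : ℝ) + 1 ≠ 0 := by positivity
    field_simp
  have hrem : ‖∫ r in (0:ℝ)..1, (r : ℂ) ^ N * z ^ (N + 1) / (1 - (r : ℂ) * z)‖ ≤ 1 / ((2 * N + 1) * sin (π * v)) := by
    have hint : ∫ r in (0:ℝ)..1, r ^ ((N : ℝ) - 1 / 2) / (2 * sin (π * v)) = 1 / ((2 * N + 1) * sin (π * v)) := by
      rw [intervalIntegral.integral_div, integral_rpow (Or.inl (by linarith [(Nat.cast_nonneg N : (0:ℝ) ≤ N)]))]
      have hN : (0:ℝ) ≤ N := Nat.cast_nonneg N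
      rw [one_rpow, zero_rpow (by linarith)]
      have h1 : (N : ℝ) - 1 / 2 + 1 ≠ 0 := by linarith
      have h2 : 2 * (N : ℝ) + 1 ≠ 0 := by linarith
      have h3 : (N : ℝ) - 1 / 2 + 1 = (2 * N + 1) / 2 := by ring
      rw [h3]
      field_simp
      norm_num
    rw [← hint]
    apply intervalIntegral.norm_integral_le_of_norm_le zero_le_one
    · filter_upwards with r hr
      rw [norm_div, norm_mul, norm_pow, norm_pow, hzn, one_pow, mul_one, Complex.norm_real, Real.norm_eq_abs, abs_of_pos hr.1]
      have h := hlow r hr.1.le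
      have hsr : 0 < √r := sqrt_pos.2 hr.1
      have hrN : 0 ≤ r ^ N := pow_nonneg hr.1.le N
      calc _ ≤ r ^ N / (2 * √r * sin (π * v)) := by gcongr
        _ = _ := by
          rw [rpow_sub hr.1, rpow_natCast, ← sqrt_eq_rpow]; field_simp
    · apply IntervalIntegrable.div_const
      apply intervalIntegral.intervalIntegrable_rpow'
      linarith [(Nat.cast_nonneg N : (0:ℝ) ≤ N)]
  have key : π * (Pf N v - 1 / 2) = - (∫ r in (0:ℝ)..1, (r : ℂ) ^ N * z ^ (N + 1) / (1 - (r : ℂ) * z)).im := by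
    have := congrArg Complex.im (hI2.symm.trans hI3)
    rw [hDs, Complex.sub_im, Complex.neg_im, hz, arg_one_sub hv hv1] at this
    rw [Pf]; linarith
  have h1 : π * |Pf N v - 1 / 2| ≤ 1 / ((2 * N + 1) * sin (π * v)) := by
    rw [← abs_of_pos pi_pos, ← abs_mul, key, abs_neg, abs_of_pos pi_pos]
    exact (Complex.abs_im_le_norm _).trans hrem
  rw [show 1 / (π * (2 * N + 1) * sin (π * v)) = (1 / ((2 * N + 1) * sin (π * v))) / π by field_simp, le_div_iff₀ pi_pos]
  linarith

lemma sin_ge (hv : 0 ≤ v) (hv1 : v ≤ 1 / 2) : 2 * v ≤ sin (π * v) := by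
  have := mul_le_sin (x := π * v) (by positivity) (by nlinarith [pi_pos])
  have h2 : 2 / π * (π * v) = 2 * v := by field_simp
  linarith

lemma Pf_bound2 (N : ℕ) (hv : 0 < v) (hv1 : v ≤ 1 / 2) : |Pf N v - 1 / 2| ≤ 1 / (2 * (2 * N + 1) * v) := by
  refine (Pf_bound N hv (by linarith)).trans ?_
  have := sin_ge hv.le hv1
  have hpi := pi_gt_three
  apply one_div_le_one_div_of_le (by positivity)
  have hN : (0:ℝ) < 2 * N + 1 := by positivity
  have h1 : 1 * (2 * N + 1) * (2 * v) ≤ π * (2 * N + 1) * sin (π * v) := by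
    gcongr; linarith
  linarith

lemma Pf_half_bound (N : ℕ) (hv : 0 < v) (hv1 : v ≤ 1 / 2) : |Pf N v - 1 / 2| ≤ 1 / 2 := by
  have hm : (0:ℝ) < 2 * N + 1 := by positivity
  have hbig : ∀ w : ℝ, 1 ≤ (2 * N + 1) * w → w ≤ 1 / 2 → |Pf N w - 1 / 2| ≤ 1 / 2 := by
    intro w h1 h2
    have hw : 0 < w := by by_contra h; push Not at h; nlinarith
    refine (Pf_bound2 N hw h2).trans ?_
    apply one_div_le_one_div_of_le (by norm_num); linarith
  by_cases h : 1 ≤ (2 * N + 1) * v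
  · exact hbig v h hv1
  push Not at h
  set w : ℝ := min (1 / (2 * N + 1)) (1 / 2) with hw
  have hvw : v ≤ w := le_min (by rw [le_div_iff₀ hm]; linarith) hv1
  have hmono : MonotoneOn (Pf N) (Icc 0 w) := by
    apply monotoneOn_of_deriv_nonneg (convex_Icc 0 w) (Pf_cont N).continuousOn
    · intro x _; exact (Pf_deriv N x).differentiableAt.differentiableWithinAt
    · intro x hx
      rw [interior_Icc] at hx
      rw [(Pf_deriv N x).deriv]
      have hx2 : x < 1 / 2 := hx.2.trans_le (min_le_right _ _)
      have hx3 : x < 1 / (2 * N + 1) := hx.2.trans_le (min_le_left _ _)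
      rw [lt_div_iff₀ hm] at hx3
      have hs := sin_ge hx.1.le hx2.le
      have hs0 : 0 < sin (π * x) := by linarith [hx.1]
      have h1 := Dir_sin N x
      have h2 : 0 ≤ sin ((2 * N + 1) * π * x) := by
        apply sin_nonneg_of_nonneg_of_le_pi
        · have := hx.1; have := pi_pos; positivity
        · have := pi_pos; nlinarith
      rw [← h1] at h2
      exact nonneg_of_mul_nonneg_left h2 hs0
  have hw0 : 0 ≤ w := hv.le.trans hvw
  have h1 : 0 ≤ Pf N v := by
    rw [← Pf_zero N]; exact hmono ⟨le_rfl, hw0⟩ ⟨hv.le, hvw⟩ hv.le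
  have h2 : Pf N v ≤ Pf N w := hmono ⟨hv.le, hvw⟩ ⟨hw0, le_rfl⟩ hvw
  have h3 : |Pf N w - 1 / 2| ≤ 1 / 2 := by
    rcases min_choice (1 / (2 * (N:ℝ) + 1)) (1 / 2) with h | h
    · apply hbig w _ (min_le_right _ _)
      rw [hw, h]; field_simp; rfl
    · rw [hw, h, Pf_half]; norm_num
  rw [abs_le] at h3 ⊢
  constructor <;> linarith [h3.1, h3.2]
end

noncomputable def Ef (N : ℕ) (v : ℝ) : ℝ := Pf N v - Real.sign v / 2

lemma Ef_neg (N : ℕ) (v : ℝ) : Ef N (-v) = - Ef N v := by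
  rw [Ef, Ef, Pf_neg, Real.sign_neg]; ring

lemma Ef_zero (N : ℕ) : Ef N 0 = 0 := by simp [Ef, Pf_zero]

lemma Ef_abs (N : ℕ) (v : ℝ) : |Ef N v| = |Ef N (|v|)| := by
  rcases abs_cases v with ⟨h, _⟩ | ⟨h, _⟩
  · rw [h]
  · rw [h, Ef_neg, abs_neg]

lemma Ef_pos (N : ℕ) {v : ℝ} (hv : 0 < v) : Ef N v = Pf N v - 1 / 2 := by
  rw [Ef, Real.sign_of_pos hv]

lemma Ef_bound (N : ℕ) {v : ℝ} (hv : v ≠ 0) (hv1 : |v| ≤ 1 / 2) :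
    |Ef N v| ≤ 1 / (π * (2 * N + 1) * sin (π * |v|)) := by
  have := abs_pos.2 hv
  rw [Ef_abs, Ef_pos N this]; exact Pf_bound N this (by linarith)

lemma Ef_bound2 (N : ℕ) {v : ℝ} (hv : v ≠ 0) (hv1 : |v| ≤ 1 / 2) :
    |Ef N v| ≤ 1 / (2 * (2 * N + 1) * |v|) := by
  have := abs_pos.2 hv
  rw [Ef_abs, Ef_pos N this]; exact Pf_bound2 N this hv1

lemma Ef_half_bound (N : ℕ) {v : ℝ} (hv1 : |v| ≤ 1 / 2) : |Ef N v| ≤ 1 / 2 := by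
  by_cases h : v = 0
  · rw [h, Ef_zero]; norm_num
  have := abs_pos.2 h
  rw [Ef_abs, Ef_pos N this]; exact Pf_half_bound N this hv1

lemma Ds_abs (N : ℕ) (v : ℝ) : |Ds N v| ≤ 3 / 2 := by
  have h : Ds N v = Ds N (v - round v) := by
    have := Ds_add_int N v (-round v)
    push_cast at this
    rw [← this]; rfl
  have h2 := abs_sub_round v
  rw [h]
  set w := v - round v
  have h3 := Ef_half_bound N h2
  have h4 : Ds N w = Ef N w - w + Real.sign w / 2 := by rw [Ef, Pf]; ring
  have h5 : |Real.sign w / 2| ≤ 1 / 2 := by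
    rcases Real.sign_apply_eq w with h | h | h <;> rw [h] <;> norm_num
  rw [h4]
  have h6 := abs_add_le (Ef N w - w) (Real.sign w / 2)
  have h7 := abs_sub (Ef N w) w
  linarith

end S3

namespace S3
open MeasureTheory Set Filter Topology Real

noncomputable def vv (d x u : ℝ) : ℝ := d * (log u - log x)

noncomputable def II (d : ℝ) (N : ℕ) (x : ℝ) : ℝ :=
  ∫ u in (x / exp (1 / (2 * d)))..(x * exp (1 / (2 * d))), Dir N (vv d x u) * (d / u) * saw u

lemma vv_deriv (d x : ℝ) {u : ℝ} (hu : 0 < u) : HasDerivAt (vv d x) (d / u) u := by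
  have := ((hasDerivAt_log hu.ne').sub_const (log x)).const_mul d
  exact this.congr_deriv (by ring)

lemma vv_cont (d x : ℝ) {s : Set ℝ} (hs : ∀ u ∈ s, 0 < u) : ContinuousOn (vv d x) s := fun _ hu =>
  (vv_deriv d x (hs _ hu)).continuousAt.continuousWithinAt

lemma vv_self (d x : ℝ) : vv d x x = 0 := by simp [vv]

lemma vv_b {d x : ℝ} (hd : 0 < d) (hx : 0 < x) : vv d x (x * exp (1 / (2 * d))) = 1 / 2 := by
  rw [vv, log_mul hx.ne' (exp_pos _).ne', log_exp]; field_simp; ring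

lemma vv_a {d x : ℝ} (hd : 0 < d) (hx : 0 < x) : vv d x (x / exp (1 / (2 * d))) = -(1 / 2) := by
  rw [vv, log_div hx.ne' (exp_pos _).ne', log_exp]; field_simp; ring

lemma vv_mono {d x : ℝ} (hd : 0 < d) {u w : ℝ} (hu : 0 < u) (h : u ≤ w) : vv d x u ≤ vv d x w := by
  unfold vv
  have := log_le_log hu h
  gcongr

lemma vv_abs_le {d x : ℝ} (hd : 0 < d) (hx : 0 < x) {u : ℝ} (h1 : x / exp (1 / (2 * d)) ≤ u) (h2 : u ≤ x * exp (1 / (2 * d))) :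
    |vv d x u| ≤ 1 / 2 := by
  have ha : 0 < x / exp (1 / (2 * d)) := by positivity
  rw [abs_le, ← vv_a hd hx, ← vv_b hd hx]
  exact ⟨vv_mono hd ha h1, vv_mono hd (ha.trans_le h1) h2⟩

/-- lower bound on `|v|`. -/
lemma vv_lower {d x : ℝ} (hd : 0 < d) (hx : 0 < x) {u B : ℝ} (hu : 0 < u) (huB : u ≤ B) (hxB : x ≤ B) :
    d * |u - x| / B ≤ |vv d x u| := by
  have hB : 0 < B := hx.trans_le hxB
  rw [vv, abs_mul, abs_of_pos hd, mul_div_assoc]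
  refine mul_le_mul_of_nonneg_left ?_ hd.le
  rcases le_total x u with h | h
  · have h1 := one_sub_inv_le_log_of_pos (x := u / x) (by positivity)
    rw [log_div hu.ne' hx.ne'] at h1
    rw [abs_of_nonneg (by linarith)]
    refine le_trans ?_ (h1.trans (le_abs_self _))
    calc (u - x) / B ≤ (u - x) / u := by gcongr
      _ = _ := by field_simp
  · have h1 := one_sub_inv_le_log_of_pos (x := x / u) (by positivity)
    rw [log_div hx.ne' hu.ne'] at h1
    rw [abs_of_nonpos (by linarith)]
    refine le_trans ?_ (h1.trans ((le_abs_self _).trans_eq (abs_sub_comm _ _)))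
    calc -(u - x) / B ≤ -(u - x) / x := by gcongr; linarith
      _ = _ := by field_simp; ring

lemma vv_upper {d x : ℝ} (hd : 0 < d) {u A : ℝ} (hA : 0 < A) (hu : A ≤ u) (hx : A ≤ x) :
    |vv d x u| ≤ d * |u - x| / A := by
  have hu0 := hA.trans_le hu
  have hx0 := hA.trans_le hx
  rw [vv, abs_mul, abs_of_pos hd, mul_div_assoc]
  refine mul_le_mul_of_nonneg_left ?_ hd.le
  rcases le_total x u with h | h
  · have h1 := log_le_sub_one_of_pos (x := u / x) (by positivity)
    have h0 := log_le_log hx0 h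
    rw [log_div hu0.ne' hx0.ne'] at h1
    rw [abs_of_nonneg (by linarith), abs_of_nonneg (by linarith)]
    refine h1.trans ?_
    calc u / x - 1 = (u - x) / x := by field_simp
      _ ≤ _ := by gcongr
  · have h1 := log_le_sub_one_of_pos (x := x / u) (by positivity)
    have h0 := log_le_log hu0 h
    rw [log_div hx0.ne' hu0.ne'] at h1
    rw [abs_of_nonpos (by linarith), abs_of_nonpos (by linarith)]
    refine (show _ ≤ x / u - 1 by linarith).trans ?_
    calc x / u - 1 = -(u - x) / u := by rw [neg_sub, sub_div, div_self hu0.ne']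
      _ ≤ _ := by gcongr; linarith

lemma kappa_ii (d : ℝ) (N : ℕ) (x : ℝ) {p q : ℝ} (hp : 0 < p) (hpq : p ≤ q) :
    ContinuousOn (fun u => Dir N (vv d x u) * (d / u)) (Icc p q) := by
  apply ContinuousOn.mul
  · exact (Dir_cont N).comp_continuousOn (vv_cont d x fun u hu => hp.trans_le hu.1)
  · apply ContinuousOn.div continuousOn_const continuousOn_id
    intro u hu; exact (hp.trans_le hu.1).ne'

lemma kappa_saw_ii (d : ℝ) (N : ℕ) (x : ℝ) {p q : ℝ} (hp : 0 < p) (hpq : p ≤ q) :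
    IntervalIntegrable (fun u => Dir N (vv d x u) * (d / u) * saw u) volume p q := by
  have h := kappa_ii d N x hp hpq
  exact (saw_ii p q).continuousOn_mul (by rwa [uIcc_of_le hpq])

/-- half-EM -/
lemma half_EM (d : ℝ) (N : ℕ) (x c : ℝ) {p q : ℝ} (hp : 0 < p) (hpq : p ≤ q) :
    ∫ u in p..q, Dir N (vv d x u) * (d / u) * saw u =
      (Pf N (vv d x q) - c) * saw q - (Pf N (vv d x p) - c) * saw p - (∫ u in p..q, (Pf N (vv d x u) - c))
       + ∑ k ∈ Finset.Ioc ⌊p⌋₊ ⌊q⌋₊, (Pf N (vv d x k) - c) := by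
  have := EM (𝕜 := ℝ) hp.le hpq (fun u => Pf N (vv d x u) - c) (fun u => Dir N (vv d x u) * (d / u))
    (fun u hu => ((Pf_deriv N _).comp u (vv_deriv d x (hp.trans_le hu.1))).sub_const c) (kappa_ii d N x hp hpq)
  exact this

lemma Ef_int {d : ℝ} (hd : 0 < d) (N : ℕ) {x : ℝ} (hx : 0 < x) :
    II d N x = psiOne x + ∑ k ∈ Finset.Ioc ⌊x / exp (1 / (2 * d))⌋₊ ⌊x * exp (1 / (2 * d))⌋₊, Ef N (vv d x k)
      - (∫ u in (x / exp (1 / (2 * d)))..x, (Pf N (vv d x u) - (-(1/2))))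
      - (∫ u in x..(x * exp (1 / (2 * d))), (Pf N (vv d x u) - 1 / 2)) := by
  have hE : 1 ≤ exp (1 / (2 * d)) := one_le_exp (by positivity)
  set a := x / exp (1 / (2 * d)) with ha
  set b := x * exp (1 / (2 * d)) with hb
  have ha0 : 0 < a := by positivity
  have hax : a ≤ x := div_le_self hx.le hE
  have hxb : x ≤ b := le_mul_of_one_le_right hx.le hE
  have h1 := half_EM d N x (-(1/2)) ha0 hax
  have h2 := half_EM d N x (1/2) hx hxb
  rw [vv_self, Pf_zero] at h1 h2
  rw [vv_a hd hx, Pf_neg, Pf_half] at h1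
  rw [vv_b hd hx, Pf_half] at h2
  have hII : II d N x = (∫ u in a..x, Dir N (vv d x u) * (d / u) * saw u) + ∫ u in x..b, Dir N (vv d x u) * (d / u) * saw u :=
    (intervalIntegral.integral_add_adjacent_intervals (kappa_saw_ii d N x ha0 hax) (kappa_saw_ii d N x hx hxb)).symm
  rw [hII, h1, h2]
  have hs : Finset.Ioc ⌊a⌋₊ ⌊b⌋₊ = Finset.Ioc ⌊a⌋₊ ⌊x⌋₊ ∪ Finset.Ioc ⌊x⌋₊ ⌊b⌋₊ :=
    (Finset.Ioc_union_Ioc_eq_Ioc (Nat.floor_mono hax) (Nat.floor_mono hxb)).symm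
  have hdis : Disjoint (Finset.Ioc ⌊a⌋₊ ⌊x⌋₊) (Finset.Ioc ⌊x⌋₊ ⌊b⌋₊) := by
    rw [Finset.disjoint_left]; intro k hk hk'
    rw [Finset.mem_Ioc] at hk hk'; omega
  rw [hs, Finset.sum_union hdis]
  have e2 : ∑ k ∈ Finset.Ioc ⌊x⌋₊ ⌊b⌋₊, (Pf N (vv d x k) - 1 / 2) = ∑ k ∈ Finset.Ioc ⌊x⌋₊ ⌊b⌋₊, Ef N (vv d x k) := by
    refine Finset.sum_congr rfl fun k hk => ?_
    rw [Finset.mem_Ioc] at hk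
    have : x < k := (Nat.floor_lt hx.le).1 hk.1
    rw [Ef_pos]
    rw [vv]; exact mul_pos hd (sub_pos.2 (log_lt_log hx this))
  have e1 : ∑ k ∈ Finset.Ioc ⌊a⌋₊ ⌊x⌋₊, (Pf N (vv d x k) - (-(1 / 2))) = ∑ k ∈ Finset.Ioc ⌊a⌋₊ ⌊x⌋₊, Ef N (vv d x k) + (psiOne x - saw x) := by
    have hterm : ∀ k ∈ Finset.Ioc ⌊a⌋₊ ⌊x⌋₊, (k : ℝ) ≠ x → (Pf N (vv d x k) - (-(1 / 2))) = Ef N (vv d x k) := by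
      intro k hk hne
      rw [Finset.mem_Ioc] at hk
      have h1 : (k : ℝ) ≤ x := (Nat.le_floor_iff hx.le).1 hk.2
      have h2 : a < k := (Nat.floor_lt ha0.le).1 hk.1
      have : vv d x k < 0 := by
        rw [vv]; exact mul_neg_of_pos_of_neg hd (sub_neg.2 (log_lt_log (ha0.trans h2) (lt_of_le_of_ne h1 hne)))
      rw [Ef, Real.sign_of_neg this]; ring
    by_cases hfr : Int.fract x = 0
    · have hxf : (⌊x⌋₊ : ℝ) = x := by
        rw [natCast_floor_eq_intCast_floor hx.le]; have := Int.floor_add_fract x; linarith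
      have hmem : ⌊x⌋₊ ∈ Finset.Ioc ⌊a⌋₊ ⌊x⌋₊ := by
        rw [Finset.mem_Ioc]; refine ⟨?_, le_rfl⟩
        rw [Nat.floor_lt ha0.le, hxf, ha]
        exact div_lt_self hx (one_lt_exp_iff.2 (by positivity))
      rw [← Finset.add_sum_erase _ _ hmem, ← Finset.add_sum_erase _ _ hmem, hxf, vv_self, Pf_zero, Ef_zero, psiOne, if_pos hfr, saw, hfr]
      rw [Finset.sum_congr rfl fun k hk => hterm k (Finset.mem_of_mem_erase hk) ?_]
      · ring
      · intro h
        rw [Finset.mem_erase] at hk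
        apply hk.1
        rw [← hxf] at h; exact_mod_cast h
    · rw [psiOne, if_neg hfr, saw, sub_self, add_zero]
      refine Finset.sum_congr rfl fun k hk => hterm k hk ?_
      intro h; apply hfr; rw [← h]; simp
  rw [e1, e2]
  ring

/-- Simple uniform bound. -/
lemma Ef_uni (N : ℕ) {v : ℝ} (hv1 : |v| ≤ 1 / 2) {c w : ℝ} (hc : 0 < c) (hw : 0 ≤ w)
    (h : w ≤ 2 * (2 * N + 1) * c * |v|) : |Ef N v| ≤ 2 * c / (2 * c + w) := by
  have h1 := Ef_half_bound N hv1
  rcases le_total w (2 * c) with h2 | h2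
  · refine h1.trans ?_
    rw [div_le_div_iff₀ (by norm_num) (by positivity)]; linarith
  · have hv : v ≠ 0 := by rintro rfl; simp at h; linarith
    refine (Ef_bound2 N hv hv1).trans ?_
    have := abs_pos.2 hv
    rw [div_le_div_iff₀ (by positivity) (by positivity)]
    nlinarith

lemma log_int {c W : ℝ} (hc : 0 < c) (hW : 0 ≤ W) : ∫ w in (0:ℝ)..W, 2 * c / (2 * c + w) = 2 * c * log (1 + W / (2 * c)) := by
  have h := intervalIntegral.integral_eq_sub_of_hasDerivAt (a := 0) (b := W) (f := fun w => 2 * c * log (2 * c + w)) (f' := fun w => 2 * c / (2 * c + w)) ?_ ?_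
  · rw [h, ← mul_sub, ← log_div (by positivity) (by positivity)]
    congr 2; field_simp; ring
  · intro w hw
    rw [uIcc_of_le hW] at hw
    have hp : 2 * c + w ≠ 0 := by have := hw.1; positivity
    have := (((hasDerivAt_id w).const_add (2 * c)).log hp).const_mul (2 * c)
    exact this.congr_deriv (by simp [div_eq_mul_inv])
  · apply ContinuousOn.intervalIntegrable
    rw [uIcc_of_le hW]
    apply ContinuousOn.div (by fun_prop) (by fun_prop)
    intro w hw; have := hw.1; positivity

lemma Ef_int_bound {d : ℝ} (hd : 0 < d) (N : ℕ) {x : ℝ} (hx : 0 < x) :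
    |∫ u in (x / exp (1 / (2 * d)))..x, (Pf N (vv d x u) - (-(1/2)))| ≤
      x * exp (1 / (2 * d)) / ((2 * N + 1) * d) * log (1 + (2 * N + 1) * d) ∧
    |∫ u in x..(x * exp (1 / (2 * d))), (Pf N (vv d x u) - 1 / 2)| ≤
      x * exp (1 / (2 * d)) / ((2 * N + 1) * d) * log (1 + (2 * N + 1) * d) := by
  have hE : 1 ≤ exp (1 / (2 * d)) := one_le_exp (by positivity)
  set a := x / exp (1 / (2 * d)) with ha
  set b := x * exp (1 / (2 * d)) with hb
  have ha0 : 0 < a := by positivity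
  have hax : a ≤ x := div_le_self hx.le hE
  have hxb : x ≤ b := le_mul_of_one_le_right hx.le hE
  have hb0 : 0 < b := by positivity
  set c := b / (2 * (2 * N + 1) * d) with hc
  have hc0 : 0 < c := by positivity
  have hlow : ∀ u, a ≤ u → u ≤ b → |u - x| ≤ 2 * (2 * N + 1) * c * |vv d x u| := by
    intro u h1 h2
    have := vv_lower hd hx (ha0.trans_le h1) h2 hxb
    rw [hc]
    rw [div_le_iff₀ hb0] at this
    have e : 2 * (2 * N + 1) * (b / (2 * (2 * N + 1) * d)) * |vv d x u| = (|vv d x u| * b) / d := by field_simp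
    rw [e, le_div_iff₀ hd]; linarith
  have hfin : ∀ W, 0 ≤ W → W ≤ b → 2 * c * log (1 + W / (2 * c)) ≤ b / ((2 * N + 1) * d) * log (1 + (2 * N + 1) * d) := by
    intro W h1 h2
    have e : 2 * c = b / ((2 * N + 1) * d) := by rw [hc]; field_simp
    rw [e]
    gcongr
    rw [div_div_eq_mul_div, div_le_iff₀ hb0]
    rw [mul_comm]; gcongr
  constructor
  · have : ∫ w in (0:ℝ)..(x - a), 2 * c / (2 * c + w) = ∫ u in a..x, 2 * c / (2 * c + (x - u)) := by
      rw [intervalIntegral.integral_comp_sub_left (fun w => 2 * c / (2 * c + w)) x]; simp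
    refine le_trans ?_ (hfin (x - a) (by linarith) (by linarith))
    rw [← log_int hc0 (by linarith), this, ← Real.norm_eq_abs]
    apply intervalIntegral.norm_integral_le_of_norm_le hax
    · have hnx : ∀ᵐ u : ℝ, u ≠ x := by simp [ae_iff]
      filter_upwards [hnx] with u hux hu
      have hneg : vv d x u < 0 := by
        rw [vv]; exact mul_neg_of_pos_of_neg hd (sub_neg.2 (log_lt_log (ha0.trans hu.1) (lt_of_le_of_ne hu.2 hux)))
      have e : Pf N (vv d x u) - (-(1/2)) = Ef N (vv d x u) := by rw [Ef, Real.sign_of_neg hneg]; ring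
      rw [e, Real.norm_eq_abs]
      apply Ef_uni N (vv_abs_le hd hx hu.1.le (hu.2.trans hxb)) hc0 (by linarith [hu.2])
      have := hlow u hu.1.le (hu.2.trans hxb)
      rw [abs_sub_comm, abs_of_nonneg (by linarith [hu.2])] at this; exact this
    · apply ContinuousOn.intervalIntegrable
      rw [uIcc_of_le hax]
      apply ContinuousOn.div (by fun_prop) (by fun_prop)
      intro w hw; have := hw.2; apply ne_of_gt; linarith
  · have : ∫ w in (0:ℝ)..(b - x), 2 * c / (2 * c + w) = ∫ u in x..b, 2 * c / (2 * c + (u - x)) := by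
      rw [intervalIntegral.integral_comp_sub_right (fun w => 2 * c / (2 * c + w)) x]; simp
    refine le_trans ?_ (hfin (b - x) (by linarith) (by linarith))
    rw [← log_int hc0 (by linarith), this, ← Real.norm_eq_abs]
    apply intervalIntegral.norm_integral_le_of_norm_le hxb
    · filter_upwards with u hu
      have hpos : 0 < vv d x u := by
        rw [vv]; exact mul_pos hd (sub_pos.2 (log_lt_log hx hu.1))
      rw [← Ef_pos N hpos, Real.norm_eq_abs]
      apply Ef_uni N (vv_abs_le hd hx (hax.trans hu.1.le) hu.2) hc0 (by linarith [hu.1])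
      have := hlow u (hax.trans hu.1.le) hu.2
      rw [abs_of_nonneg (by linarith [hu.1])] at this; exact this
    · apply ContinuousOn.intervalIntegrable
      rw [uIcc_of_le hxb]
      apply ContinuousOn.div (by fun_prop) (by fun_prop)
      intro w hw; have := hw.1; apply ne_of_gt; linarith

lemma harm_sum (A B k0 : ℕ) (h : k0 ≤ B) :
    ∑ k ∈ (Finset.Ioc A B).erase k0, 1 / |(k : ℝ) - k0| ≤ 2 * (1 + log B) := by
  have hH : ∀ n : ℕ, n ≤ B → ∑ i ∈ Finset.range n, 1 / ((i : ℝ) + 1) ≤ 1 + log B := by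
    intro n hn
    have h1 := harmonic_le_one_add_log n
    have h2 : ((harmonic n : ℚ) : ℝ) = ∑ i ∈ Finset.range n, 1 / ((i : ℝ) + 1) := by
      rw [harmonic]; push_cast; simp
    rw [← h2]
    rcases Nat.eq_zero_or_pos n with rfl | hn0
    · simp; exact add_nonneg zero_le_one (log_natCast_nonneg _)
    · refine h1.trans ?_
      have : log (n:ℝ) ≤ log B := log_le_log (by exact_mod_cast hn0) (by exact_mod_cast hn)
      linarith
  have hsub : (Finset.Ioc A B).erase k0 ⊆ Finset.range k0 ∪ Finset.Ioc k0 B := by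
    intro k hk
    simp only [Finset.mem_erase, Finset.mem_Ioc, Finset.mem_union, Finset.mem_range] at hk ⊢
    omega
  refine (Finset.sum_le_sum_of_subset_of_nonneg hsub fun _ _ _ => by positivity).trans ?_
  have hdis : Disjoint (Finset.range k0) (Finset.Ioc k0 B) := by
    rw [Finset.disjoint_left]; intro k hk hk'
    rw [Finset.mem_Ioc] at hk'; rw [Finset.mem_range] at hk; omega
  rw [Finset.sum_union hdis]
  have e1 : ∑ k ∈ Finset.range k0, 1 / |(k : ℝ) - k0| = ∑ i ∈ Finset.range k0, 1 / ((i : ℝ) + 1) := by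
    rw [← Finset.sum_range_reflect]
    refine Finset.sum_congr rfl fun k hk => ?_
    rw [Finset.mem_range] at hk
    rw [abs_sub_comm]
    have : ((k0 - 1 - k : ℕ) : ℝ) = k0 - 1 - k := by
      rw [Nat.cast_sub (by omega), Nat.cast_sub (by omega)]; simp
    rw [this]
    rw [show (k0 : ℝ) - (k0 - 1 - k) = k + 1 by ring, abs_of_nonneg (by positivity)]
  have e2 : ∑ k ∈ Finset.Ioc k0 B, 1 / |(k : ℝ) - k0| = ∑ i ∈ Finset.range (B - k0), 1 / ((i : ℝ) + 1) := by
    rw [← Finset.Ico_add_one_add_one_eq_Ioc, Finset.sum_Ico_eq_sum_range]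
    rw [show B + 1 - (k0 + 1) = B - k0 by omega]
    refine Finset.sum_congr rfl fun k hk => ?_
    push_cast
    rw [show (k0 : ℝ) + 1 + k - k0 = k + 1 by ring, abs_of_nonneg (by positivity)]
  rw [e1, e2]
  have := hH k0 h
  have := hH (B - k0) (by omega)
  linarith

end S3

namespace S3
open MeasureTheory Set Filter Topology Real

noncomputable def MB (d : ℝ) (N : ℕ) (x : ℝ) : ℝ :=
  min (1 / 2) (1 / (2 * π * nearestIntDist x * (2 * d * N * x⁻¹ + 1)))

lemma MB_nonneg {d : ℝ} (hd : 0 < d) (N : ℕ) {x : ℝ} (hx : 0 < x) : 0 ≤ MB d N x := by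
  unfold MB nearestIntDist
  have := pi_pos
  positivity

lemma main_term {d : ℝ} (hd : 0 < d) {N N' : ℕ} (hN : N ≤ N') {x : ℝ} (hx : 10 ≤ x) (hxd : 10 * d + 1 ≤ x)
    (hK : 2 * x ≤ d * N) : |Ef N' (vv d x (round x : ℤ))| ≤ MB d N x := by
  have hx0 : 0 < x := by linarith
  have hr := abs_sub_round x
  set k : ℝ := ((round x : ℤ) : ℝ) with hk
  have hr' := abs_le.1 hr
  have hkp : x - 1 / 2 ≤ k := by linarith [hr'.2]
  have hkq : k ≤ x + 1 / 2 := by linarith [hr'.1]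
  have hdel : nearestIntDist x = |k - x| := abs_sub_comm _ _
  have hup : |vv d x k| ≤ d * |k - x| / (x - 1/2) := vv_upper hd (by linarith) hkp (by linarith)
  have hlow : d * |k - x| / (x + 1/2) ≤ |vv d x k| := vv_lower hd hx0 (by linarith) hkq (by linarith)
  have hd2 : |k - x| ≤ 1 / 2 := by rw [abs_sub_comm]; exact hr
  have hv : |vv d x k| ≤ 1 / 10 := by
    refine hup.trans ?_
    rw [div_le_iff₀ (by linarith)]
    nlinarith
  refine le_min (Ef_half_bound N' (by linarith)) ?_
  rw [hdel]
  by_cases h0 : k - x = 0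
  · rw [show k = x by linarith, vv_self, Ef_zero]; simp
  have hδ : 0 < |k - x| := abs_pos.2 h0
  have hvpos : 0 < |vv d x k| := lt_of_lt_of_le (by positivity) hlow
  have hpi := pi_gt_three
  have hpi4 := pi_lt_d2
  refine (Ef_bound N' (abs_pos.1 hvpos) (by linarith)).trans ?_
  set v := |vv d x k| with hvdef
  have hsin : 3 * v ≤ sin (π * v) := by
    have hy0 : 0 < π * v := by positivity
    have hy1 : π * v ≤ 0.4 := by nlinarith
    have := sin_gt_sub_cube hy0
    have h2 : (π * v) ^ 3 / 6 ≤ (π * v) * 0.04 := by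
      have : (π * v) ^ 2 ≤ 0.16 := by nlinarith
      nlinarith
    have hpi5 := pi_gt_d2
    nlinarith
  apply one_div_le_one_div_of_le
  · have : (0:ℝ) < 2 * d * N * x⁻¹ + 1 := by positivity
    positivity
  have hNN : (N : ℝ) ≤ N' := by exact_mod_cast hN
  have h1 : π * (2 * N) * (3 * (d * |k - x| / (x + 1 / 2))) ≤ π * (2 * N' + 1) * sin (π * v) := by
    have : 3 * (d * |k - x| / (x + 1 / 2)) ≤ sin (π * v) := by linarith
    gcongr
    linarith
  refine le_trans ?_ h1
  have e : π * (2 * N) * (3 * (d * |k - x| / (x + 1 / 2))) = 2 * π * |k - x| * (3 * d * N / (x + 1 / 2)) := by ring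
  rw [e]
  gcongr
  rw [le_div_iff₀ (by linarith)]
  have e2 : 2 * d * N * x⁻¹ * x = 2 * d * N := by field_simp
  have hKx : 2 * d * N * x⁻¹ ≤ 2 * d * N / 10 := by
    rw [← div_eq_mul_inv]; gcongr
  nlinarith

set_option maxHeartbeats 2000000 in
lemma range1 {d : ℝ} (hd : 0 < d) : ∃ C > 0, ∃ X0 ≥ 1, ∀ N N' : ℕ, 2 ≤ N → N ≤ N' → N' ≤ 2 * N → ∀ x : ℝ, X0 ≤ x → 2 * x ≤ d * N →
    |II d N' x - psiOne x - Ef N' (vv d x (round x : ℤ))| ≤ C * (x / N) * log N ∧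
    |Ef N' (vv d x (round x : ℤ))| ≤ MB d N x := by
  set E := exp (1 / (2 * d)) with hE
  have hE1 : 1 < E := one_lt_exp_iff.2 (by positivity)
  have hl2 : 0 < log 2 := log_pos (by norm_num)
  refine ⟨2 * (E / d * (1 + log (1 + 5 * d) / log 2)) + E / d * 4 * (1 / log 2 + 1 + log (1 + E * d) / log 2), ?_,
    max 10 (max (10 * d + 1) (max (1 / (E - 1)) (1 / (1 - 1 / E)))), ?_, ?_⟩
  · have : 0 < log (1 + 5 * d) := log_pos (by linarith)
    have : 0 < log (1 + E * d) := log_pos (by linarith [show 0 < E * d by positivity])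
    positivity
  · exact le_trans (by norm_num) (le_max_left _ _)
  intro N N' hN hNN hN2 x hx hK
  simp only [max_le_iff] at hx
  obtain ⟨hx10, hxd, hxE1, hxE2⟩ := hx
  have hx0 : 0 < x := by linarith
  refine ⟨?_, main_term hd hNN hx10 hxd hK⟩
  rw [Ef_int hd N' hx0, ← hE]
  obtain ⟨hi1, hi2⟩ := Ef_int_bound hd N' hx0
  rw [← hE] at hi1 hi2
  set i1 := ∫ u in (x / E)..x, (Pf N' (vv d x u) - (-(1/2)))
  set i2 := ∫ u in x..(x * E), (Pf N' (vv d x u) - 1 / 2)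
  have hax : x / E < x := div_lt_self hx0 hE1
  -- k0
  have hr := abs_le.1 (abs_sub_round x)
  have hrpos : 0 ≤ round x := by
    have : (0:ℝ) < (round x : ℤ) := by linarith [hr.2]
    exact_mod_cast this.le
  obtain ⟨k0, hk0⟩ := Int.eq_ofNat_of_zero_le hrpos
  have hk0' : ((round x : ℤ) : ℝ) = (k0 : ℝ) := by rw [hk0]; simp
  rw [hk0'] at hr ⊢
  have hE1' : 1 ≤ x * (E - 1) := by rw [div_le_iff₀ (by linarith)] at hxE1; exact hxE1
  have hE2' : 1 ≤ x * (1 - 1 / E) := by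
    rw [div_le_iff₀ (by rw [sub_pos, div_lt_one (by linarith)]; exact hE1)] at hxE2; exact hxE2
  have hmem : k0 ∈ Finset.Ioc ⌊x / E⌋₊ ⌊x * E⌋₊ := by
    rw [Finset.mem_Ioc, Nat.floor_lt (by positivity), Nat.le_floor_iff (by positivity)]
    have : x * (1 - 1 / E) = x - x / E := by ring
    constructor
    · linarith [hr.2]
    · linarith [hr.1]
  rw [← Finset.add_sum_erase _ _ hmem]
  have hsum : |∑ k ∈ (Finset.Ioc ⌊x / E⌋₊ ⌊x * E⌋₊).erase k0, Ef N' (vv d x k)| ≤ x * E / ((2 * N' + 1) * d) * (2 * (1 + log (⌊x * E⌋₊ : ℕ))) := by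
    rw [Finset.mem_Ioc] at hmem
    refine (Finset.abs_sum_le_sum_abs _ _).trans ?_
    refine le_trans ?_ (mul_le_mul_of_nonneg_left (harm_sum ⌊x / E⌋₊ _ k0 hmem.2) (by positivity))
    rw [Finset.mul_sum]
    refine Finset.sum_le_sum fun k hk => ?_
    rw [Finset.mem_erase, Finset.mem_Ioc, Nat.floor_lt (by positivity), Nat.le_floor_iff (by positivity)] at hk
    obtain ⟨hkne, hk1, hk2⟩ := hk
    have hkpos : (0:ℝ) < k := lt_trans (by positivity) hk1
    have h1 : 1 ≤ |(k : ℝ) - k0| := by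
      have : (1:ℤ) ≤ |(k : ℤ) - k0| := Int.one_le_abs (by omega)
      exact_mod_cast this
    have h2 : |(k : ℝ) - k0| / 2 ≤ |(k:ℝ) - x| := by
      have h3 : |(k : ℝ) - k0| ≤ |(k:ℝ) - x| + |x - k0| := abs_sub_le _ _ _
      have h4 : |x - k0| ≤ 1 / 2 := abs_le.2 hr
      linarith
    have hlow := vv_lower hd hx0 hkpos hk2 (le_mul_of_one_le_right hx0.le hE1.le)
    have hkx : 0 < |(k:ℝ) - x| := by linarith
    have hv : 0 < |vv d x k| := lt_of_lt_of_le (by positivity) hlow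
    refine (Ef_bound2 N' (abs_pos.1 hv) (vv_abs_le hd hx0 hk1.le hk2)).trans ?_
    have h5 : d * (|(k : ℝ) - k0| / 2) / (x * E) ≤ |vv d x k| := le_trans (by gcongr) hlow
    calc 1 / (2 * (2 * N' + 1) * |vv d x k|) ≤ 1 / (2 * (2 * N' + 1) * (d * (|(k : ℝ) - k0| / 2) / (x * E))) := by
          gcongr
      _ = _ := by field_simp
  -- collecting
  have hN0 : (0:ℝ) < N := by positivity
  have hN2' : (2:ℝ) ≤ N := by exact_mod_cast hN
  have hNN' : (N : ℝ) ≤ N' := by exact_mod_cast hNN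
  have hN2N : (N' : ℝ) ≤ 2 * N := by exact_mod_cast hN2
  have hlN : log 2 ≤ log N := log_le_log (by norm_num) hN2'
  have hlN0 : 0 < log N := hl2.trans_le hlN
  have hlogc : ∀ c : ℝ, 0 < c → ∀ y : ℝ, 1 ≤ y → y ≤ (1 + c) * N → log y ≤ (1 + log (1 + c) / log 2) * log N := by
    intro c hc y hy hyc
    have h1 : log y ≤ log ((1 + c) * N) := log_le_log (by linarith) hyc
    rw [log_mul (by positivity) (by positivity)] at h1
    have h2 : 0 ≤ log (1 + c) := log_nonneg (by linarith)
    have h3 : log (1 + c) ≤ log (1 + c) / log 2 * log N := by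
      rw [div_mul_eq_mul_div, le_div_iff₀ hl2]; gcongr
    linarith
  have hpre : x * E / ((2 * N' + 1) * d) ≤ E / d * (x / N) := by
    rw [show E / d * (x / N) = x * E / (N * d) by field_simp]
    gcongr
    linarith
  have hl1 : log (1 + (2 * N' + 1) * d) ≤ (1 + log (1 + 5 * d) / log 2) * log N := by
    apply hlogc (5 * d) (by positivity)
    · have : 0 < (2 * (N':ℝ) + 1) * d := by positivity
      linarith
    · nlinarith
  have hl3 : 2 * (1 + log (⌊x * E⌋₊ : ℕ)) ≤ 2 * (1 / log 2 + 1 + log (1 + E * d) / log 2) * log N := by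
    have h1 : log (⌊x * E⌋₊ : ℕ) ≤ (1 + log (1 + E * d) / log 2) * log N := by
      apply hlogc (E * d) (by positivity)
      · rw [Nat.one_le_cast, Nat.one_le_floor_iff]; nlinarith
      · refine (Nat.floor_le (by positivity)).trans ?_
        nlinarith
    have h2 : 1 ≤ 1 / log 2 * log N := by rw [one_div_mul_eq_div, le_div_iff₀ hl2]; linarith
    nlinarith
  have hpre0 : 0 ≤ x * E / ((2 * N' + 1) * d) := by positivity
  have hl1' : 0 ≤ log (1 + (2 * N' + 1) * d) := log_nonneg (by have : 0 < (2 * (N':ℝ) + 1) * d := by positivity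
                                                               linarith)
  have b1 : x * E / ((2 * N' + 1) * d) * log (1 + (2 * N' + 1) * d) ≤ E / d * (x / N) * ((1 + log (1 + 5 * d) / log 2) * log N) := by
    gcongr
  have b2 : x * E / ((2 * N' + 1) * d) * (2 * (1 + log (⌊x * E⌋₊ : ℕ))) ≤ E / d * (x / N) * (2 * (1 / log 2 + 1 + log (1 + E * d) / log 2) * log N) := by
    refine mul_le_mul hpre hl3 ?_ (by positivity)
    have := log_natCast_nonneg ⌊x * E⌋₊
    positivity
  set sm := ∑ k ∈ (Finset.Ioc ⌊x / E⌋₊ ⌊x * E⌋₊).erase k0, Ef N' (vv d x k)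
  have e : psiOne x + (Ef N' (vv d x k0) + sm) - i1 - i2 - psiOne x - Ef N' (vv d x k0) = sm - i1 - i2 := by ring
  rw [e]
  have t1 := abs_sub (sm - i1) i2
  have t2 := abs_sub sm i1
  have hx' : 0 ≤ x / N := by positivity
  have hfin : 0 ≤ E / d * (x / N) * (2 * (1 / log 2 + 1 + log (1 + E * d) / log 2) * log N) := by
    have : 0 < log (1 + E * d) := log_pos (by linarith [show 0 < E * d by positivity])
    positivity
  calc _ ≤ E / d * (x / N) * (2 * (1 / log 2 + 1 + log (1 + E * d) / log 2) * log N) + 2 * (E / d * (x / N) * ((1 + log (1 + 5 * d) / log 2) * log N)) := by linarith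
    _ ≤ _ := by nlinarith

end S3

namespace S3
open MeasureTheory Set Filter Topology Real

lemma log_int2 {c a x b : ℝ} (hc : 0 < c) (ha : 0 ≤ a) (hax : a ≤ x) (hxb : x ≤ b) :
    ∫ u in a..b, 2 * c / (2 * c + |u - x|) ≤ 2 * (2 * c * log (1 + b / (2 * c))) := by
  have hcont : Continuous (fun u => 2 * c / (2 * c + |u - x|)) := by
    apply Continuous.div (by fun_prop) (by fun_prop)
    intro u; positivity
  rw [← intervalIntegral.integral_add_adjacent_intervals (b := x) (hcont.intervalIntegrable _ _) (hcont.intervalIntegrable _ _)]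
  have e1 : ∫ u in a..x, 2 * c / (2 * c + |u - x|) = 2 * c * log (1 + (x - a) / (2 * c)) := by
    rw [← log_int hc (by linarith)]
    have : ∫ w in (0:ℝ)..(x - a), 2 * c / (2 * c + w) = ∫ u in a..x, 2 * c / (2 * c + (x - u)) := by
      rw [intervalIntegral.integral_comp_sub_left (fun w => 2 * c / (2 * c + w)) x]; simp
    rw [this]
    apply intervalIntegral.integral_congr
    intro u hu
    rw [uIcc_of_le hax] at hu
    simp only
    rw [abs_sub_comm, abs_of_nonneg (by linarith [hu.2])]
  have e2 : ∫ u in x..b, 2 * c / (2 * c + |u - x|) = 2 * c * log (1 + (b - x) / (2 * c)) := by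
    rw [← log_int hc (by linarith)]
    have : ∫ w in (0:ℝ)..(b - x), 2 * c / (2 * c + w) = ∫ u in x..b, 2 * c / (2 * c + (u - x)) := by
      rw [intervalIntegral.integral_comp_sub_right (fun w => 2 * c / (2 * c + w)) x]; simp
    rw [this]
    apply intervalIntegral.integral_congr
    intro u hu
    rw [uIcc_of_le hxb] at hu
    simp only
    rw [abs_of_nonneg (by linarith [hu.1])]
  rw [e1, e2]
  have h1 : log (1 + (x - a) / (2 * c)) ≤ log (1 + b / (2 * c)) := by
    apply log_le_log
    · have : 0 ≤ x - a := by linarith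
      positivity
    · gcongr; linarith
  have h2 : log (1 + (b - x) / (2 * c)) ≤ log (1 + b / (2 * c)) := by
    apply log_le_log
    · have : 0 ≤ b - x := by linarith
      positivity
    · gcongr; linarith
  nlinarith

lemma DirD_bound (N : ℕ) {v : ℝ} (hv : |v| ≤ 1 / 2) : |DirD N v| * (1 + (2 * N + 1) * |v|) ≤ 5 * π * (2 * N + 1) ^ 2 := by
  have h1 := DirD_abs N v
  have h2 := DirD_sin N v
  have h3 : 2 * |v| ≤ |sin (π * v)| := by
    rcases abs_cases v with ⟨h, h0⟩ | ⟨h, h0⟩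
    · rw [h] at hv ⊢; exact (sin_ge h0 hv).trans (le_abs_self _)
    · rw [h] at hv ⊢
      have := sin_ge (v := -v) (by linarith) hv
      rw [show π * -v = -(π * v) by ring, sin_neg] at this
      exact this.trans (neg_le_abs _)
  have h4 : |DirD N v| * (2 * |v|) ≤ 2 * π * (2 * N + 1) := (mul_le_mul_of_nonneg_left h3 (abs_nonneg _)).trans h2
  have hm : (0:ℝ) ≤ 2 * N + 1 := by positivity
  nlinarith [mul_le_mul_of_nonneg_left h4 hm]

lemma range3a {d : ℝ} (hd : 0 < d) (N : ℕ) {x : ℝ} (hx : 0 < x) :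
    |II d N x| ≤ (2 * N + 1) / x * (3 * d * exp (1 / (2 * d)) ^ 3 + 10 * π * d * exp (1 / (2 * d)) ^ 3 * log (1 + (2 * N + 1) * d)) := by
  set E := exp (1 / (2 * d)) with hE
  have hE1 : 1 < E := one_lt_exp_iff.2 (by positivity)
  set a := x / E with ha
  set b := x * E with hb
  have ha0 : 0 < a := by positivity
  have hax : a ≤ x := div_le_self hx.le hE1.le
  have hxb : x ≤ b := le_mul_of_one_le_right hx.le hE1.le
  have hb0 : 0 < b := by positivity
  set m : ℝ := 2 * N + 1 with hm
  have hm0 : 0 < m := by positivity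
  set c := b / (2 * m * d) with hc
  have hc0 : 0 < c := by positivity
  set g' : ℝ → ℝ := fun u => DirD N (vv d x u) * (d / u) * (d / u) + Dir N (vv d x u) * (- d / u ^ 2) with hg'
  have hder : ∀ u ∈ Icc a b, HasDerivAt (fun u => Dir N (vv d x u) * (d / u)) (g' u) u := by
    intro u hu
    have hu0 := ha0.trans_le hu.1
    have h1 := (Dir_deriv N _).comp u (vv_deriv d x hu0)
    have h2 : HasDerivAt (fun u => d / u) (-d / u ^ 2) u := by
      have := (hasDerivAt_inv hu0.ne').const_mul d
      refine this.congr_deriv ?_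
      ring
    exact h1.mul h2
  have hcont : ContinuousOn g' (Icc a b) := by
    have hv := vv_cont d x (s := Icc a b) fun u hu => ha0.trans_le hu.1
    have h1 : ContinuousOn (fun u : ℝ => d / u) (Icc a b) := ContinuousOn.div continuousOn_const continuousOn_id fun u hu => (ha0.trans_le hu.1).ne'
    have h2 : ContinuousOn (fun u : ℝ => -d / u ^ 2) (Icc a b) := ContinuousOn.div continuousOn_const (by fun_prop) fun u hu => by
      have := (ha0.trans_le hu.1); positivity
    exact ((((DirD_cont N).comp_continuousOn hv).mul h1).mul h1).add (((Dir_cont N).comp_continuousOn hv).mul h2)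
  have hp := parts (𝕜 := ℝ) (hax.trans hxb) _ g' hder hcont
  have hII : II d N x = ∫ t in a..b, (Dir N (vv d x t) * (d / t)) * saw t := rfl
  have hp' : II d N x = Dir N (vv d x b) * (d / b) * Bt b - Dir N (vv d x a) * (d / a) * Bt a - ∫ t in a..b, g' t * Bt t := hII.trans hp
  have hend : ∀ u, a ≤ u → |Dir N (vv d x u) * (d / u) * Bt u| ≤ m * (d / a) := by
    intro u hu
    have hu0 := ha0.trans_le hu
    rw [abs_mul, abs_mul, abs_of_nonneg (by positivity : 0 ≤ d / u)]
    have h1 := Dir_abs N (vv d x u)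
    have h2 := Bt_abs u
    calc _ ≤ m * (d / a) * 1 := by gcongr
      _ = _ := mul_one _
  have hint : |∫ t in a..b, g' t * Bt t| ≤ ∫ t in a..b, (5 * π * m ^ 2 * (d / a) ^ 2 * (2 * c / (2 * c + |t - x|)) + m * (d / a ^ 2)) := by
    rw [← Real.norm_eq_abs]
    apply intervalIntegral.norm_integral_le_of_norm_le (hax.trans hxb)
    · filter_upwards with u hu
      have hu0 := ha0.trans hu.1
      rw [Real.norm_eq_abs, abs_mul]
      have h2 := Bt_abs u
      refine (mul_le_of_le_one_right (abs_nonneg _) h2).trans ?_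
      refine (abs_add_le _ _).trans ?_
      rw [abs_mul, abs_mul, abs_mul, neg_div, abs_neg, abs_of_nonneg (by positivity : 0 ≤ d / u), abs_of_nonneg (by positivity : 0 ≤ d / u ^ 2)]
      have h1 := Dir_abs N (vv d x u)
      have hau := hu.1.le
      have hk : |DirD N (vv d x u)| ≤ 5 * π * m ^ 2 * (2 * c / (2 * c + |u - x|)) := by
        have h3 := DirD_bound N (vv_abs_le hd hx hu.1.le hu.2)
        have h4 := vv_lower hd hx hu0 hu.2 hxb
        have h5 : (2 * c + |u - x|) / (2 * c) ≤ 1 + m * |vv d x u| := by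
          have : (2 * c + |u - x|) / (2 * c) = 1 + m * (d * |u - x| / b) := by rw [hc]; field_simp
          rw [this]; gcongr
        rw [mul_div_assoc', le_div_iff₀ (by positivity)]
        rw [div_le_iff₀ (by positivity)] at h5
        calc _ ≤ |DirD N (vv d x u)| * ((1 + m * |vv d x u|) * (2 * c)) := by gcongr
          _ = (|DirD N (vv d x u)| * (1 + m * |vv d x u|)) * (2 * c) := by ring
          _ ≤ _ := by gcongr
      have hda : d / u ≤ d / a := by gcongr
      calc _ ≤ 5 * π * m ^ 2 * (2 * c / (2 * c + |u - x|)) * (d / a) * (d / a) + m * (d / a ^ 2) := by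
              gcongr
        _ = _ := by ring
    · apply Continuous.intervalIntegrable
      have : Continuous (fun u => 2 * c / (2 * c + |u - x|)) := by
        apply Continuous.div (by fun_prop) (by fun_prop)
        intro u; positivity
      fun_prop
  have hci : Continuous (fun u => 2 * c / (2 * c + |u - x|)) := by
    apply Continuous.div (by fun_prop) (by fun_prop)
    intro u; positivity
  rw [intervalIntegral.integral_add ((hci.const_mul _).intervalIntegrable _ _) (by simp), intervalIntegral.integral_const_mul, intervalIntegral.integral_const, smul_eq_mul] at hint
  have hl := log_int2 hc0 ha0.le hax hxb
  have e1 := hend b (hax.trans hxb)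
  have e2 := hend a le_rfl
  have hl' : 5 * π * m ^ 2 * (d / a) ^ 2 * (∫ u in a..b, 2 * c / (2 * c + |u - x|)) ≤ m / x * (10 * π * d * E ^ 3 * log (1 + m * d)) := by
    calc _ ≤ 5 * π * m ^ 2 * (d / a) ^ 2 * (2 * (2 * c * log (1 + b / (2 * c)))) := by gcongr
      _ = _ := by
        have : b / (2 * c) = m * d := by rw [hc]; field_simp
        rw [this, hc, ha, hb]; field_simp; ring
  have e3 : m * (d / a) ≤ m / x * (d * E ^ 3) := by
    rw [ha, show m * (d / (x / E)) = m / x * (d * E) by field_simp]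
    gcongr
    nlinarith [mul_pos (show 0 < E by linarith) (show 0 < E by linarith), mul_self_nonneg (E-1)]
  have e4 : (b - a) * (m * (d / a ^ 2)) ≤ m / x * (d * E ^ 3) := by
    calc _ ≤ b * (m * (d / a ^ 2)) := by gcongr; linarith
      _ = _ := by rw [ha, hb]; field_simp
  rw [hp']
  have t1 := abs_sub (Dir N (vv d x b) * (d / b) * Bt b - Dir N (vv d x a) * (d / a) * Bt a) (∫ t in a..b, g' t * Bt t)
  have t2 := abs_sub (Dir N (vv d x b) * (d / b) * Bt b) (Dir N (vv d x a) * (d / a) * Bt a)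
  rw [mul_add]
  have : m / x * (3 * d * E ^ 3) = 3 * (m / x * (d * E ^ 3)) := by ring
  linarith

lemma range3 {d : ℝ} (hd : 0 < d) : ∃ C > 0, ∀ N N' : ℕ, 2 ≤ N → N' ≤ 2 * N → ∀ x : ℝ, 0 < x →
    |II d N' x| ≤ C * (N / x) * log N := by
  set E := exp (1 / (2 * d)) with hE
  have hl2 : 0 < log 2 := log_pos (by norm_num)
  have hl5 : 0 < log (1 + 5 * d) := log_pos (by linarith)
  refine ⟨5 * (3 * d * E ^ 3 / log 2 + 10 * π * d * E ^ 3 * (1 + log (1 + 5 * d) / log 2)), by positivity, ?_⟩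
  intro N N' hN hN2 x hx
  refine (range3a hd N' hx).trans ?_
  rw [← hE]
  have hN2' : (2:ℝ) ≤ N := by exact_mod_cast hN
  have hN2N : (N' : ℝ) ≤ 2 * N := by exact_mod_cast hN2
  have hlN : log 2 ≤ log N := log_le_log (by norm_num) hN2'
  have hlN0 : 0 < log N := hl2.trans_le hlN
  have h1 : log (1 + (2 * N' + 1) * d) ≤ (1 + log (1 + 5 * d) / log 2) * log N := by
    have h1 : log (1 + (2 * N' + 1) * d) ≤ log ((1 + 5 * d) * N) := log_le_log (by positivity) (by nlinarith)
    rw [log_mul (by positivity) (by positivity)] at h1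
    have h3 : log (1 + 5 * d) ≤ log (1 + 5 * d) / log 2 * log N := by
      rw [div_mul_eq_mul_div, le_div_iff₀ hl2]; gcongr
    linarith
  have h2 : 3 * d * E ^ 3 ≤ 3 * d * E ^ 3 / log 2 * log N := by
    rw [div_mul_eq_mul_div, le_div_iff₀ hl2]; gcongr
  have h3 : 0 ≤ log (1 + (2 * N' + 1) * d) := log_nonneg (by have : 0 < (2 * (N':ℝ) + 1) * d := by positivity
                                                             linarith)
  calc _ ≤ (5 * N) / x * (3 * d * E ^ 3 / log 2 * log N + 10 * π * d * E ^ 3 * ((1 + log (1 + 5 * d) / log 2) * log N)) := by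
        gcongr
        linarith
    _ = _ := by ring

end S3

namespace S3
open MeasureTheory Set Filter Topology Real

lemma sum_inv_sq (J : ℕ) : ∑ n ∈ Finset.range J, 1 / ((n : ℝ) + 1) ^ 2 ≤ 2 := by
  have h : ∀ J : ℕ, ∑ n ∈ Finset.range (J + 1), 1 / ((n : ℝ) + 1) ^ 2 ≤ 2 - 1 / ((J : ℝ) + 1) := by
    intro J
    induction J with
    | zero => norm_num
    | succ J ih =>
      rw [Finset.sum_range_succ]
      push_cast
      have : 1 / ((J : ℝ) + 1 + 1) ^ 2 ≤ 1 / ((J : ℝ) + 1) - 1 / ((J : ℝ) + 1 + 1) := by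
        rw [div_sub_div _ _ (by positivity) (by positivity), div_le_div_iff₀ (by positivity) (by positivity)]
        have : (0:ℝ) ≤ J := by positivity
        nlinarith
      linarith
  cases J with
  | zero => simp
  | succ J => refine (h J).trans ?_; have : 0 ≤ 1 / ((J : ℝ) + 1) := by positivity
              linarith

noncomputable def sk (β w : ℝ) : ℝ := β * sinc (β * w)

lemma sk_cont (β : ℝ) : Continuous (sk β) := by
  unfold sk
  exact continuous_const.mul (continuous_sinc.comp (by fun_prop))

lemma sk_ne (β : ℝ) {w : ℝ} (hw : w ≠ 0) : sk β w = sin (β * w) / w := by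
  unfold sk
  by_cases hb : β = 0
  · simp [hb]
  · rw [sinc_of_ne_zero (mul_ne_zero hb hw)]; field_simp

lemma sk_abs {β : ℝ} (hβ : 0 ≤ β) (w : ℝ) : |sk β w| ≤ β := by
  unfold sk
  rw [abs_mul, abs_of_nonneg hβ]
  exact mul_le_of_le_one_right hβ (abs_sinc_le_one _)

lemma saw_add_int (t : ℝ) (k : ℕ) : saw (t + k) = saw t := by
  unfold saw; rw [Int.fract_add_natCast]

lemma saw_sub_int (t : ℝ) (k : ℕ) : saw (t - k) = saw t := by
  unfold saw; rw [Int.fract_sub_natCast]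

lemma sk_pair {β : ℝ} (j : ℝ) (hj : 1 ≤ j) {r : ℝ} (hr : |r| ≤ 1 / 2) :
    |sk β (r + j) + sk β (r - j) - 2 * cos (β * r) * (sin (β * j) / j)| ≤ 2 / j ^ 2 := by
  have hr' := abs_le.1 hr
  have h1 : r + j ≠ 0 := by apply ne_of_gt; linarith
  have h2 : r - j ≠ 0 := by apply ne_of_lt; linarith
  rw [sk_ne _ h1, sk_ne _ h2]
  have e : sin (β * (r + j)) / (r + j) + sin (β * (r - j)) / (r - j) - 2 * cos (β * r) * (sin (β * j) / j)
     = sin (β * (r + j)) * (1 / (r + j) - 1 / j) + sin (β * (r - j)) * (1 / (r - j) + 1 / j) := by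
    have : sin (β * (r + j)) - sin (β * (r - j)) = 2 * cos (β * r) * sin (β * j) := by
      rw [mul_add, mul_sub, sin_add, sin_sub]; ring
    rw [← mul_div_assoc, ← this]; ring
  rw [e]
  have b1 : |1 / (r + j) - 1 / j| ≤ 1 / j ^ 2 := by
    have : 1 / (r + j) - 1 / j = (-r) / ((r + j) * j) := by field_simp; ring
    rw [this, abs_div, abs_neg, abs_of_pos (show 0 < (r + j) * j by nlinarith), div_le_div_iff₀ (by nlinarith) (by positivity)]
    nlinarith
  have b2 : |1 / (r - j) + 1 / j| ≤ 1 / j ^ 2 := by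
    have : 1 / (r - j) + 1 / j = (-r) / ((j - r) * j) := by
      have h3 : j - r ≠ 0 := by intro h; apply h2; linarith
      rw [show r - j = -(j - r) by ring]
      field_simp; ring
    rw [this, abs_div, abs_neg, abs_of_pos (show 0 < (j - r) * j by nlinarith), div_le_div_iff₀ (by nlinarith) (by positivity)]
    nlinarith
  refine (abs_add_le _ _).trans ?_
  rw [abs_mul, abs_mul]
  have c1 := mul_le_mul (abs_sin_le_one (β * (r + j))) b1 (abs_nonneg _) zero_le_one
  have c2 := mul_le_mul (abs_sin_le_one (β * (r - j))) b2 (abs_nonneg _) zero_le_one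
  have : 2 / j ^ 2 = 1 / j ^ 2 + 1 / j ^ 2 := by ring
  linarith

lemma fold_int (x β : ℝ) (J : ℕ) :
    ∫ w in (-((J : ℝ) + 1 / 2))..((J : ℝ) + 1 / 2), saw (x + w) * sk β w =
      ∫ r in (-(1 / 2) : ℝ)..(1 / 2), saw (x + r) * (sk β r + ∑ n ∈ Finset.range J, (sk β (r + (n + 1)) + sk β (r - (n + 1)))) := by
  have hii : ∀ (f : ℝ → ℝ), Continuous f → ∀ p q, IntervalIntegrable (fun w => saw (x + w) * f w) volume p q := by
    intro f hf p q
    have : IntervalIntegrable (fun w => saw (x + w)) volume p q := by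
      have := (saw_ii (p + x) (q + x)).comp_add_left x
      simpa using this
    exact this.mul_continuousOn hf.continuousOn
  induction J with
  | zero => simp
  | succ J ih =>
    have hs := hii (sk β) (sk_cont β)
    push_cast
    rw [← intervalIntegral.integral_add_adjacent_intervals (b := -((J : ℝ) + 1 / 2)) (hs _ _) (hs _ _),
      ← intervalIntegral.integral_add_adjacent_intervals (a := -((J : ℝ) + 1 / 2)) (b := ((J : ℝ) + 1 / 2)) (hs _ _) (hs _ _), ih]
    have e1 : ∫ w in (-((J : ℝ) + 1 + 1 / 2))..(-((J : ℝ) + 1 / 2)), saw (x + w) * sk β w = ∫ r in (-(1 / 2) : ℝ)..(1 / 2), saw (x + r) * sk β (r - (J + 1)) := by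
      have := intervalIntegral.integral_comp_sub_right (a := -(1/2)) (b := 1/2) (fun w => saw (x + w) * sk β w) ((J : ℝ) + 1)
      rw [show -((J : ℝ) + 1 + 1 / 2) = -(1/2) - (J + 1) by ring, show -((J : ℝ) + 1 / 2) = 1 / 2 - (J + 1) by ring, ← this]
      apply intervalIntegral.integral_congr
      intro r _
      simp only
      rw [show x + (r - ((J : ℝ) + 1)) = (x + r) - ((J + 1 : ℕ) : ℝ) by push_cast; ring, saw_sub_int]
    have e2 : ∫ w in ((J : ℝ) + 1 / 2)..((J : ℝ) + 1 + 1 / 2), saw (x + w) * sk β w = ∫ r in (-(1 / 2) : ℝ)..(1 / 2), saw (x + r) * sk β (r + (J + 1)) := by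
      have := intervalIntegral.integral_comp_add_right (a := -(1/2)) (b := 1/2) (fun w => saw (x + w) * sk β w) ((J : ℝ) + 1)
      rw [show ((J : ℝ) + 1 + 1 / 2) = (1/2) + (J + 1) by ring, show ((J : ℝ) + 1 / 2) = -(1 / 2) + (J + 1) by ring, ← this]
      apply intervalIntegral.integral_congr
      intro r _
      simp only
      rw [show x + (r + ((J : ℝ) + 1)) = (x + r) + ((J + 1 : ℕ) : ℝ) by push_cast; ring, saw_add_int]
    have hc := sk_cont β
    rw [e1, e2, ← intervalIntegral.integral_add, ← intervalIntegral.integral_add]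
    · apply intervalIntegral.integral_congr
      intro r _
      simp only
      rw [Finset.sum_range_succ]; ring
    · apply hii; fun_prop
    · apply IntervalIntegrable.add
      · apply hii; fun_prop
      · apply hii; fun_prop
    · apply hii; fun_prop
    · apply hii; fun_prop

lemma inner_main (x : ℝ) {β : ℝ} (hβ : 0 ≤ β) (J : ℕ) :
    |∫ w in (-((J : ℝ) + 1 / 2))..((J : ℝ) + 1 / 2), saw (x + w) * sk β w| ≤ β + 14 := by
  rw [fold_int, ← Real.norm_eq_abs]
  have hb : ∀ r ∈ uIoc (-(1 / 2) : ℝ) (1 / 2), ‖saw (x + r) * (sk β r + ∑ n ∈ Finset.range J, (sk β (r + (n + 1)) + sk β (r - (n + 1))))‖ ≤ 1 * (β + 14) := by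
    intro r hr
    rw [uIoc_of_le (by norm_num)] at hr
    have hr' : |r| ≤ 1 / 2 := abs_le.2 ⟨hr.1.le, hr.2⟩
    rw [norm_mul, Real.norm_eq_abs, Real.norm_eq_abs]
    refine mul_le_mul ((saw_abs _).trans (by norm_num)) ?_ (abs_nonneg _) zero_le_one
    refine (abs_add_le _ _).trans (add_le_add (sk_abs hβ r) ?_)
    have h1 : |∑ n ∈ Finset.range J, (sk β (r + (n + 1)) + sk β (r - (n + 1))) - ∑ n ∈ Finset.range J, 2 * cos (β * r) * (sin (β * (n + 1)) / (n + 1))| ≤ 4 := by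
      rw [← Finset.sum_sub_distrib]
      refine (Finset.abs_sum_le_sum_abs _ _).trans ?_
      calc _ ≤ ∑ n ∈ Finset.range J, 2 * (1 / ((n : ℝ) + 1) ^ 2) := Finset.sum_le_sum fun n _ => by
              refine (sk_pair ((n : ℝ) + 1) (by linarith [(Nat.cast_nonneg n : (0:ℝ) ≤ n)]) hr').trans_eq (by ring)
        _ ≤ 4 := by rw [← Finset.mul_sum]; linarith [sum_inv_sq J]
    have h2 : |∑ n ∈ Finset.range J, 2 * cos (β * r) * (sin (β * ((n : ℝ) + 1)) / ((n : ℝ) + 1))| ≤ (10 : ℝ) := by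
      have e : ∑ n ∈ Finset.range J, 2 * cos (β * r) * (sin (β * (n + 1)) / (n + 1)) = 2 * cos (β * r) * (π * Ds J (β / (2 * π))) := by
        rw [← Finset.mul_sum]
        congr 1
        rw [Ds, Finset.mul_sum]
        refine Finset.sum_congr rfl fun n _ => ?_
        have hpi := pi_ne_zero
        rw [show 2 * π * ((n : ℝ) + 1) * (β / (2 * π)) = β * (n + 1) by field_simp]
        field_simp
      rw [e]
      simp only [abs_mul, abs_two, abs_of_pos pi_pos]
      have a1 := abs_cos_le_one (β * r)
      have a2 := Ds_abs J (β / (2 * π))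
      have a3 := pi_lt_d2
      calc 2 * |cos (β * r)| * (π * |Ds J (β / (2 * π))|) ≤ 2 * 1 * (3.15 * (3 / 2)) := by gcongr
        _ ≤ _ := by norm_num
    have h3 := abs_sub_abs_le_abs_sub (∑ n ∈ Finset.range J, (sk β (r + (n + 1)) + sk β (r - (n + 1)))) (∑ n ∈ Finset.range J, 2 * cos (β * r) * (sin (β * (n + 1)) / (n + 1)))
    linarith
  have := intervalIntegral.norm_integral_le_of_norm_le_const hb
  refine this.trans_eq ?_
  norm_num

/-- Kernel comparison. -/
lemma dir_sinc (N : ℕ) {v : ℝ} (hv0 : v ≠ 0) (hv : |v| ≤ 1 / 2) : |Dir N v - sin ((2 * N + 1) * π * v) / (π * v)| ≤ 1 := by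
  have key : ∀ v : ℝ, 0 < v → v ≤ 1 / 2 → |Dir N v - sin ((2 * N + 1) * π * v) / (π * v)| ≤ 1 := by
    intro v hv0 hv
    have hs := sin_ge hv0.le hv
    have hs0 : 0 < sin (π * v) := by linarith
    have hz : 0 < π * v := by positivity
    have e : Dir N v = sin ((2 * N + 1) * π * v) / sin (π * v) := by rw [← Dir_sin]; field_simp
    rw [e]
    have e2 : sin ((2 * N + 1) * π * v) / sin (π * v) - sin ((2 * N + 1) * π * v) / (π * v) =
       sin ((2 * N + 1) * π * v) * ((π * v - sin (π * v)) / (sin (π * v) * (π * v))) := by field_simp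
    rw [e2, abs_mul]
    have h1 := abs_sin_le_one ((2 * N + 1) * π * v)
    have h2 : |(π * v - sin (π * v)) / (sin (π * v) * (π * v))| ≤ 1 := by
      have h3 := sin_gt_sub_cube hz
      have h4 := sin_lt hz
      rw [abs_of_nonneg (div_nonneg (by linarith) (by positivity)), div_le_one (by positivity)]
      have h5 := pi_lt_d2
      have h7 : π ^ 2 ≤ 12 := by nlinarith [pi_gt_three]
      have h6 : (π * v) ^ 2 ≤ 12 * v := by
        rw [mul_pow]
        have : π ^ 2 * v ^ 2 ≤ 12 * v ^ 2 := by gcongr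
        nlinarith
      have h8 := mul_le_mul_of_nonneg_right h6 hz.le
      have h9 := mul_le_mul_of_nonneg_right hs hz.le
      nlinarith
    calc _ ≤ 1 * 1 := mul_le_mul h1 h2 (abs_nonneg _) zero_le_one
      _ = 1 := one_mul _
  rcases lt_or_gt_of_ne hv0 with h | h
  · have := key (-v) (by linarith) (by rw [abs_of_neg h] at hv; exact hv)
    have e : Dir N (-v) = Dir N v := by
      unfold Dir; congr 2; refine Finset.sum_congr rfl fun n _ => ?_
      rw [mul_neg, cos_neg]
    rw [e, mul_neg, sin_neg, mul_neg, neg_div_neg_eq] at this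
    exact this
  · exact key v h (by rw [abs_of_pos h] at hv; exact hv)

lemma log_est {y : ℝ} (hy : |y| ≤ 1 / 2) : |log (1 + y) - y| ≤ 2 * y ^ 2 ∧ |(1 + y) * log (1 + y) - y| ≤ y ^ 2 ∧ |y| / 2 ≤ |(1 + y) * log (1 + y)| := by
  have hy' := abs_le.1 hy
  have hp : 0 < 1 + y := by linarith
  have h1 := one_sub_inv_le_log_of_pos hp
  have h2 := log_le_sub_one_of_pos hp
  have h3 : y ≤ (1 + y) * log (1 + y) := by
    have := mul_le_mul_of_nonneg_left h1 hp.le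
    rw [mul_sub, mul_inv_cancel₀ hp.ne'] at this; linarith
  have h4 : (1 + y) * log (1 + y) ≤ y + y ^ 2 := by nlinarith
  refine ⟨?_, ?_, ?_⟩
  · rw [abs_le]; constructor
    · nlinarith
    · nlinarith
  · rw [abs_le]; constructor <;> nlinarith
  · rcases abs_cases y with ⟨h, h0⟩ | ⟨h, h0⟩
    · rw [h]; refine le_trans ?_ (le_abs_self _); linarith
    · rw [h]; refine le_trans ?_ (neg_le_abs _); nlinarith

lemma ker {d : ℝ} (hd : 0 < d) (N : ℕ) {x u : ℝ} (hx : 0 < x) (hne : u ≠ x) (hu : |u - x| ≤ x / 2) (hv : |vv d x u| ≤ 1 / 2) :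
    |Dir N (vv d x u) * (d / u) - 1 / π * sk ((2 * N + 1) * π * d / x) (u - x)| ≤ (2 * d + 2 + 2 * (2 * N + 1) * d * (|u - x| / x)) / x := by
  set y := (u - x) / x with hy
  have hyx : u - x = x * y := by rw [hy]; field_simp
  have hux : u = x * (1 + y) := by linarith
  have hy2 : |y| ≤ 1 / 2 := by
    rw [hy, abs_div, abs_of_pos hx, div_le_iff₀ hx]; linarith
  have hy' := abs_le.1 hy2
  have hp : 0 < 1 + y := by linarith
  have hy0 : y ≠ 0 := by intro h; apply hne; rw [hux, h]; ring
  have hu0 : 0 < u := by rw [hux]; positivity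
  obtain ⟨l1, l2, l3⟩ := log_est hy2
  have hvv : vv d x u = d * log (1 + y) := by
    rw [vv, hux, log_mul hx.ne' hp.ne']; ring
  set l := log (1 + y) with hl
  have hl0 : l ≠ 0 := by
    intro h; rw [h, mul_zero, abs_zero] at l3; have := abs_pos.2 hy0; linarith
  have hv0 : vv d x u ≠ 0 := by rw [hvv]; exact mul_ne_zero hd.ne' hl0
  have A := dir_sinc N hv0 hv
  set m : ℝ := 2 * N + 1 with hm
  have hm0 : 0 < m := by positivity
  rw [sk_ne _ (sub_ne_zero.2 hne)]
  rw [show m * π * d / x * (u - x) = m * π * (d * y) by rw [hyx]; field_simp]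
  rw [hvv] at A ⊢
  have hay : |u - x| / x = |y| := by rw [hy, abs_div, abs_of_pos hx]
  rw [hay, hyx, hux]
  have hpi := pi_gt_three
  set S := sin (m * π * (d * l)) with hS
  set T := sin (m * π * (d * y)) with hT
  have hST : |S - T| ≤ m * π * d * (2 * y ^ 2) := by
    have : |S - T| ≤ |m * π * (d * l) - m * π * (d * y)| := by
      exact abs_sin_sub_sin_le _ _
    refine this.trans ?_
    rw [show m * π * (d * l) - m * π * (d * y) = m * π * d * (l - y) by ring, abs_mul, abs_of_pos (show 0 < m * π * d by positivity)]
    gcongr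
  have e : Dir N (d * l) * (d / (x * (1 + y))) - 1 / π * (T / (x * y)) =
      (Dir N (d * l) - S / (π * (d * l))) * (d / (x * (1 + y))) + S / (π * x) * (1 / ((1 + y) * l) - 1 / y) + (S - T) / (π * x * y) := by
    field_simp; ring
  rw [e]
  have t1 : |(Dir N (d * l) - S / (π * (d * l))) * (d / (x * (1 + y)))| ≤ 2 * d / x := by
    rw [abs_mul, abs_of_pos (show 0 < d / (x * (1 + y)) by positivity)]
    calc _ ≤ 1 * (d / (x * (1 / 2))) := by gcongr; linarith
      _ = _ := by field_simp
  have t2 : |S / (π * x) * (1 / ((1 + y) * l) - 1 / y)| ≤ 2 / x := by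
    rw [abs_mul, abs_div, abs_of_pos (show 0 < π * x by positivity)]
    have : |1 / ((1 + y) * l) - 1 / y| ≤ 2 := by
      rw [div_sub_div _ _ (mul_ne_zero hp.ne' hl0) hy0, abs_div, div_le_iff₀ (abs_pos.2 (mul_ne_zero (mul_ne_zero hp.ne' hl0) hy0)), one_mul, mul_one, abs_sub_comm, abs_mul _ y]
      refine l2.trans ?_
      have := abs_pos.2 hy0
      rw [← sq_abs]; nlinarith
    calc _ ≤ 1 / (1 * x) * 2 := by
            gcongr
            · exact abs_sin_le_one _
            · linarith
      _ = _ := by field_simp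
  have t3 : |(S - T) / (π * x * y)| ≤ 2 * m * d * |y| / x := by
    have hay0 := abs_pos.2 hy0
    rw [abs_div, abs_mul, abs_of_pos (show 0 < π * x by positivity), div_le_iff₀ (by positivity)]
    refine hST.trans_eq ?_
    rw [← sq_abs y]; field_simp
  refine (abs_add_le _ _).trans ((add_le_add (abs_add_le _ _) le_rfl).trans ?_)
  rw [add_div, add_div]
  linarith

end S3

namespace S3
open MeasureTheory Set Filter Topology Real

lemma sin_ge_abs {v : ℝ} (hv : |v| ≤ 1 / 2) : 2 * |v| ≤ |sin (π * v)| := by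
  rcases abs_cases v with ⟨h, h0⟩ | ⟨h, h0⟩
  · rw [h] at hv ⊢; exact (sin_ge h0 hv).trans (le_abs_self _)
  · rw [h] at hv ⊢
    have := sin_ge (v := -v) (by linarith) hv
    rw [show π * -v = -(π * v) by ring, sin_neg] at this
    exact this.trans (neg_le_abs _)

lemma dirsum (N L : ℕ) {v : ℝ} (hv : |v| ≤ 1 / 2) : |∑ i ∈ Finset.range L, Dir (N + i) v| * (4 * v ^ 2) ≤ 1 := by
  have key : (∑ i ∈ Finset.range L, Dir (N + i) v) * sin (π * v) ^ 2 = (cos (2 * N * π * v) - cos (2 * (N + L) * π * v)) / 2 := by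
    induction L with
    | zero => simp
    | succ L ih =>
      rw [Finset.sum_range_succ, add_mul, ih]
      have h := Dir_sin (N + L) v
      have e : Dir (N + L) v * sin (π * v) ^ 2 = (Dir (N + L) v * sin (π * v)) * sin (π * v) := by ring
      rw [e, h]
      push_cast
      have c1 : cos (2 * (N + L) * π * v) = cos ((2 * (N + L) + 1) * π * v - π * v) := by congr 1; ring
      have c2 : cos (2 * (N + (L + 1)) * π * v) = cos ((2 * (N + L) + 1) * π * v + π * v) := by congr 1; ring
      rw [c1, c2, cos_sub, cos_add]; ring
  have h1 := sin_ge_abs hv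
  have h2 : 4 * v ^ 2 ≤ sin (π * v) ^ 2 := by
    rw [← sq_abs v, ← sq_abs (sin _)]
    nlinarith [abs_nonneg v]
  calc _ ≤ |∑ i ∈ Finset.range L, Dir (N + i) v| * sin (π * v) ^ 2 := by gcongr
    _ = |(∑ i ∈ Finset.range L, Dir (N + i) v) * sin (π * v) ^ 2| := by rw [abs_mul, abs_of_nonneg (sq_nonneg (sin _))]
    _ ≤ 1 := by
      rw [key, abs_le]
      have a := neg_one_le_cos (2 * N * π * v)
      have b := cos_le_one (2 * N * π * v)
      have a' := neg_one_le_cos (2 * (N + L) * π * v)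
      have b' := cos_le_one (2 * (N + L) * π * v)
      constructor <;> linarith

lemma inv_sq_int {x p q : ℝ} (h : x ∉ Icc p q) (hpq : p ≤ q) : ∫ u in p..q, 1 / (u - x) ^ 2 = 1 / (p - x) - 1 / (q - x) := by
  have hne : ∀ u ∈ Icc p q, u - x ≠ 0 := fun u hu h0 => h (by rwa [← sub_eq_zero.1 h0])
  have := intervalIntegral.integral_eq_sub_of_hasDerivAt (a := p) (b := q) (f := fun u => -(u - x)⁻¹) (f' := fun u => 1 / (u - x) ^ 2) ?_ ?_
  · rw [this]; ring
  · intro u hu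
    rw [uIcc_of_le hpq] at hu
    have := (((hasDerivAt_id u).sub_const x).inv (hne u hu)).neg
    exact this.congr_deriv (by simp [neg_div])
  · apply ContinuousOn.intervalIntegrable
    rw [uIcc_of_le hpq]
    apply ContinuousOn.div (by fun_prop) (by fun_prop)
    intro u hu; exact pow_ne_zero _ (hne u hu)

lemma outer {d : ℝ} (hd : 0 < d) (N L : ℕ) {x p q : ℝ} (hx : 0 < x) (hpq : p ≤ q) (hap : x / exp (1 / (2 * d)) ≤ p) (hqb : q ≤ x * exp (1 / (2 * d)))
    (hni : x ∉ Icc p q) :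
    |∑ i ∈ Finset.range L, ∫ u in p..q, Dir (N + i) (vv d x u) * (d / u) * saw u| ≤ x * exp (1 / (2 * d)) ^ 3 / (8 * d) * (1 / (p - x) - 1 / (q - x)) := by
  set E := exp (1 / (2 * d)) with hE
  have hE1 : 1 < E := one_lt_exp_iff.2 (by positivity)
  have ha0 : 0 < x / E := by positivity
  have hp0 := ha0.trans_le hap
  rw [← intervalIntegral.integral_finsetSum fun i _ => kappa_saw_ii d (N + i) x hp0 hpq, ← inv_sq_int hni hpq, ← intervalIntegral.integral_const_mul, ← Real.norm_eq_abs]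
  apply intervalIntegral.norm_integral_le_of_norm_le hpq
  · filter_upwards with u hu
    have hu0 := hp0.trans hu.1
    have hux : u - x ≠ 0 := fun h0 => hni (by rw [← sub_eq_zero.1 h0]; exact ⟨hu.1.le, hu.2⟩)
    have hv := vv_abs_le hd hx (hap.trans hu.1.le) (hu.2.trans hqb)
    have hds := dirsum N L hv
    have hlow := vv_lower hd hx hu0 (hu.2.trans hqb) (le_mul_of_one_le_right hx.le hE1.le)
    rw [← Finset.sum_mul, ← Finset.sum_mul, norm_mul, norm_mul, Real.norm_eq_abs, Real.norm_eq_abs, Real.norm_eq_abs, abs_of_pos (show 0 < d / u by positivity)]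
    set D := ∑ i ∈ Finset.range L, Dir (N + i) (vv d x u)
    have h1 : |D| ≤ (x * E) ^ 2 / (4 * d ^ 2) * (1 / (u - x) ^ 2) := by
      have hax : 0 < |u - x| := abs_pos.2 hux
      have h2 : (d * |u - x| / (x * E)) ^ 2 ≤ vv d x u ^ 2 := by
        rw [← sq_abs (vv d x u)]; gcongr
      have h3 : |D| * (4 * (d * |u - x| / (x * E)) ^ 2) ≤ 1 := le_trans (by gcongr) hds
      rw [show (x * E) ^ 2 / (4 * d ^ 2) * (1 / (u - x) ^ 2) = 1 / (4 * (d * |u - x| / (x * E)) ^ 2) by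
        rw [← sq_abs (u - x)]; field_simp]
      rw [le_div_iff₀ (by positivity)]; exact h3
    have h4 : d / u ≤ d / (x / E) := by gcongr; linarith [hu.1]
    calc _ ≤ ((x * E) ^ 2 / (4 * d ^ 2) * (1 / (u - x) ^ 2)) * (d / (x / E)) * (1 / 2) := by
          gcongr; exact saw_abs u
      _ = _ := by field_simp; ring
  · apply ContinuousOn.intervalIntegrable
    rw [uIcc_of_le hpq]
    apply ContinuousOn.mul continuousOn_const
    apply ContinuousOn.div (by fun_prop) (by fun_prop)
    intro u hu; exact pow_ne_zero _ fun h0 => hni (by rwa [← sub_eq_zero.1 h0])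

lemma inner_bound {d : ℝ} (hd : 0 < d) (N J : ℕ) {x : ℝ} (hx : 0 < x) (hJ : (J : ℝ) + 1 / 2 ≤ x / 2)
    (hap : x / exp (1 / (2 * d)) ≤ x - (J + 1 / 2)) (hqb : x + (J + 1 / 2) ≤ x * exp (1 / (2 * d))) :
    |∫ u in (x - (J + 1 / 2))..(x + (J + 1 / 2)), Dir N (vv d x u) * (d / u) * saw u| ≤
      (2 * N + 1) * π * d / x + 14 + (2 * d + 2 + 2 * (2 * N + 1) * d * (((J : ℝ) + 1 / 2) / x)) * (((J : ℝ) + 1 / 2) / x) := by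
  set W : ℝ := (J : ℝ) + 1 / 2 with hW
  have hW0 : 0 < W := by positivity
  have hp0 : 0 < x - W := by linarith
  set β := (2 * N + 1) * π * d / x with hβ
  have hβ0 : 0 ≤ β := by positivity
  have hi1 := kappa_saw_ii d N x hp0 (by linarith : x - W ≤ x + W)
  have hi2 : IntervalIntegrable (fun u => 1 / π * sk β (u - x) * saw u) volume (x - W) (x + W) := by
    apply (saw_ii _ _).continuousOn_mul
    apply Continuous.continuousOn
    exact continuous_const.mul ((sk_cont β).comp (by fun_prop))
  have e1 : ∫ u in (x - W)..(x + W), 1 / π * sk β (u - x) * saw u = 1 / π * ∫ w in (-W)..W, saw (x + w) * sk β w := by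
    rw [← intervalIntegral.integral_const_mul]
    have := intervalIntegral.integral_comp_sub_right (a := x - W) (b := x + W) (fun w => 1 / π * (saw (x + w) * sk β w)) x
    rw [show x - W - x = -W by ring, show x + W - x = W by ring] at this
    rw [← this]
    apply intervalIntegral.integral_congr
    intro u _
    simp only
    rw [show x + (u - x) = u by ring]; ring
  have hm := inner_main x hβ0 J
  rw [← hW] at hm
  have hdiff : |∫ u in (x - W)..(x + W), (Dir N (vv d x u) * (d / u) * saw u - 1 / π * sk β (u - x) * saw u)| ≤
     ((2 * d + 2 + 2 * (2 * N + 1) * d * (W / x)) / x * (1 / 2)) * |x + W - (x - W)| := by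
    rw [← Real.norm_eq_abs]
    apply intervalIntegral.norm_integral_le_of_norm_le_const_ae
    have hnx : ∀ᵐ u : ℝ, u ≠ x := by simp [ae_iff]
    filter_upwards [hnx] with u hux hu
    rw [uIoc_of_le (by linarith)] at hu
    have hau : |u - x| ≤ W := abs_le.2 ⟨by linarith [hu.1], by linarith [hu.2]⟩
    have hk := ker hd N hx hux (hau.trans hJ) (vv_abs_le hd hx (hap.trans hu.1.le) (hu.2.trans hqb))
    rw [← sub_mul, norm_mul, Real.norm_eq_abs, Real.norm_eq_abs]
    refine mul_le_mul (hk.trans ?_) (saw_abs u) (abs_nonneg _) (by positivity)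
    gcongr
  rw [intervalIntegral.integral_sub hi1 hi2, e1] at hdiff
  rw [show x + W - (x - W) = 2 * W by ring, abs_of_pos (by positivity : 0 < 2 * W)] at hdiff
  have h3 : |1 / π * ∫ w in (-W)..W, saw (x + w) * sk β w| ≤ β + 14 := by
    rw [abs_mul, abs_of_pos (by positivity : 0 < 1 / π)]
    refine (mul_le_of_le_one_left (abs_nonneg _) ?_).trans hm
    rw [div_le_one pi_pos]; linarith [pi_gt_three]
  have h4 := abs_sub_abs_le_abs_sub (∫ u in (x - W)..(x + W), Dir N (vv d x u) * (d / u) * saw u) (1 / π * ∫ w in (-W)..W, saw (x + w) * sk β w)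
  have h5 : ((2 * d + 2 + 2 * (2 * N + 1) * d * (W / x)) / x * (1 / 2)) * (2 * W) = (2 * d + 2 + 2 * (2 * N + 1) * d * (W / x)) * (W / x) := by
    field_simp
  linarith

set_option maxHeartbeats 1000000 in
lemma range2 {d : ℝ} (hd : 0 < d) : ∃ C > 0, ∃ N1 : ℕ, ∃ X1 ≥ (1 : ℝ), ∀ N L : ℕ, N1 ≤ N → 1 ≤ N → L ≤ N → ∀ lam x : ℝ, 1 ≤ lam → X1 ≤ x → N ≤ lam * x →
    |∑ i ∈ Finset.range L, II d (N + i) x| ≤ C * (L * lam + √N) := by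
  set E := exp (1 / (2 * d)) with hE
  have hE1 : 1 < E := one_lt_exp_iff.2 (by positivity)
  set ρ := min (1 / 2) (1 - 1 / E) with hρ
  have hρ0 : 0 < ρ := by
    rw [hρ, lt_min_iff]; refine ⟨by norm_num, ?_⟩
    rw [sub_pos, div_lt_one (by linarith)]; exact hE1
  have hρ1 : ρ ≤ 1 / 2 := min_le_left _ _
  have hρ2 : ρ ≤ 1 - 1 / E := min_le_right _ _
  have hρ3 : ρ ≤ E - 1 := by
    refine hρ2.trans ?_
    have : 1 - 1 / E = (E - 1) / E := by field_simp
    rw [this]; exact div_le_self (by linarith) hE1.le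
  refine ⟨5 * π * d + 14 + (d + 1) + 2 * d * 40 + E ^ 3 / (4 * d), by positivity, ⌈(2 / ρ) ^ 2⌉₊, max 1 (3 / ρ), le_max_left _ _, ?_⟩
  intro N L hN1 hN hL lam x hlam hx hNx
  rw [max_le_iff] at hx
  have hx0 : 0 < x := by linarith
  have hN0 : (1:ℝ) ≤ N := by exact_mod_cast hN
  have hsN : 2 / ρ ≤ √N := by
    apply le_sqrt_of_sq_le
    exact Nat.ceil_le.1 hN1
  have hsN0 : 0 < √N := sqrt_pos.2 (by linarith)
  have hsq : √N * √N = N := mul_self_sqrt (by linarith)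
  set J : ℕ := ⌈x / √N⌉₊ with hJ
  have hJ1 : x / √N ≤ J := Nat.le_ceil _
  have hJ2 : (J : ℝ) < x / √N + 1 := Nat.ceil_lt_add_one (by positivity)
  set W : ℝ := (J : ℝ) + 1 / 2 with hW
  have hW0 : 0 < W := by positivity
  have hWρ : W ≤ ρ * x := by
    have h1 : x / √N ≤ ρ * x / 2 := by
      rw [div_le_iff₀ hsN0]
      rw [div_le_iff₀ hρ0] at hsN
      have h9 := mul_le_mul_of_nonneg_left hsN hx0.le
      linarith
    have h2 : 3 ≤ ρ * x := by have := hx.2; rw [div_le_iff₀ hρ0] at this; linarith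
    linarith
  have hap : x / E ≤ x - W := by
    have : ρ * x ≤ (1 - 1 / E) * x := by gcongr
    have e : (1 - 1 / E) * x = x - x / E := by ring
    linarith
  have hqb : x + W ≤ x * E := by
    have : ρ * x ≤ (E - 1) * x := by gcongr
    linarith
  have hWx : W ≤ x / 2 := by have h9 := mul_le_mul_of_nonneg_right hρ1 hx0.le
                             linarith
  have ha0 : 0 < x / E := by positivity
  have hsplit : ∀ i, II d (N + i) x = (∫ u in (x / E)..(x - W), Dir (N + i) (vv d x u) * (d / u) * saw u) +
      (∫ u in (x - W)..(x + W), Dir (N + i) (vv d x u) * (d / u) * saw u) + ∫ u in (x + W)..(x * E), Dir (N + i) (vv d x u) * (d / u) * saw u := by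
    intro i
    have i1 := kappa_saw_ii d (N + i) x ha0 hap
    have i2 := kappa_saw_ii d (N + i) x (ha0.trans_le hap) (by linarith : x - W ≤ x + W)
    have i3 := kappa_saw_ii d (N + i) x (by linarith : 0 < x + W) hqb
    rw [intervalIntegral.integral_add_adjacent_intervals i1 i2, intervalIntegral.integral_add_adjacent_intervals (i1.trans i2) i3]
    rfl
  rw [Finset.sum_congr rfl fun i _ => hsplit i, Finset.sum_add_distrib, Finset.sum_add_distrib]
  have o1 := outer hd N L hx0 hap le_rfl (by linarith) (fun h => by linarith [h.2])
  have o2 := outer hd N L hx0 hqb (by linarith : x / E ≤ x + W) le_rfl (fun h => by linarith [h.1])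
  rw [← hE] at o1 o2
  have hWs : x / W ≤ √N := by
    rw [div_le_iff₀ hW0]
    have : x ≤ J * √N := by rwa [div_le_iff₀ hsN0] at hJ1
    have h9 : W * √N = J * √N + 1 / 2 * √N := by rw [hW]; ring
    linarith
  have b1 : x * E ^ 3 / (8 * d) * (1 / (x / E - x) - 1 / (x - W - x)) ≤ E ^ 3 / (8 * d) * √N := by
    have h1 : 1 / (x / E - x) ≤ 0 := by
      apply one_div_nonpos.2; linarith
    have h2 : 1 / (x - W - x) = - (1 / W) := by rw [show x - W - x = -W by ring, one_div_neg_eq_neg_one_div]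
    calc _ ≤ x * E ^ 3 / (8 * d) * (1 / W) := by gcongr; linarith
      _ = E ^ 3 / (8 * d) * (x / W) := by ring
      _ ≤ _ := by gcongr
  have b2 : x * E ^ 3 / (8 * d) * (1 / (x + W - x) - 1 / (x * E - x)) ≤ E ^ 3 / (8 * d) * √N := by
    have h1 : 0 ≤ 1 / (x * E - x) := by
      apply one_div_nonneg.2; have h9 := mul_le_mul_of_nonneg_left hE1.le hx0.le
      linarith
    have h2 : 1 / (x + W - x) = 1 / W := by rw [show x + W - x = W by ring]
    calc _ ≤ x * E ^ 3 / (8 * d) * (1 / W) := by gcongr; linarith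
      _ = E ^ 3 / (8 * d) * (x / W) := by ring
      _ ≤ _ := by gcongr
  have hin : |∑ i ∈ Finset.range L, ∫ u in (x - W)..(x + W), Dir (N + i) (vv d x u) * (d / u) * saw u| ≤ L * ((5 * π * d + 14 + (d + 1) + 2 * d * 40) * lam) := by
    refine (Finset.abs_sum_le_sum_abs _ _).trans ?_
    have hc : ∀ i ∈ Finset.range L, |∫ u in (x - W)..(x + W), Dir (N + i) (vv d x u) * (d / u) * saw u| ≤ (5 * π * d + 14 + (d + 1) + 2 * d * 40) * lam := by
      intro i hi
      rw [Finset.mem_range] at hi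
      have hiN : (i : ℝ) + 1 ≤ N := by exact_mod_cast (by omega : i + 1 ≤ N)
      refine (inner_bound hd (N + i) J hx0 hWx hap hqb).trans ?_
      rw [← hW]
      set m : ℝ := 2 * ((N + i : ℕ) : ℝ) + 1 with hm
      have hm5 : m ≤ 5 * N := by rw [hm]; push_cast; linarith
      have hm0 : 0 < m := by positivity
      have hmx : m / x ≤ 5 * lam := by rw [div_le_iff₀ hx0]; linarith
      have hy : W / x ≤ 1 / 2 := by rw [div_le_iff₀ hx0]; linarith
      have hy0 : 0 ≤ W / x := by positivity
      have hmy : m * (W / x) ^ 2 ≤ 40 * lam := by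
        have h1 : W / x ≤ 1 / √N + 3 / 2 / x := by
          rw [div_le_iff₀ hx0, add_mul]
          have : 1 / √N * x = x / √N := by ring
          have : 3 / 2 / x * x = 3 / 2 := by field_simp
          linarith
        have h2 : (W / x) ^ 2 ≤ 2 * (1 / √N) ^ 2 + 2 * (3 / 2 / x) ^ 2 := by
          have : (W / x) ^ 2 ≤ (1 / √N + 3 / 2 / x) ^ 2 := by gcongr
          linarith [sq_nonneg (1 / √N - 3 / 2 / x), (by ring : (1 / √N + 3 / 2 / x) ^ 2 + (1 / √N - 3 / 2 / x) ^ 2 = 2 * (1 / √N) ^ 2 + 2 * (3 / 2 / x) ^ 2)]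
        have h3 : (1 / √N) ^ 2 = 1 / N := by rw [div_pow, sq_sqrt (by linarith), one_pow]
        have h4 : m * (1 / N) ≤ 5 := by
          rw [mul_one_div, div_le_iff₀ (by linarith)]; exact hm5
        have h5 : m * (2 * (3 / 2 / x) ^ 2) ≤ 22.5 * lam := by
          have : m * (2 * (3 / 2 / x) ^ 2) = 4.5 * (m / x) * (1 / x) := by field_simp; norm_num
          rw [this]
          have h6 : 1 / x ≤ 1 := by rw [div_le_one hx0]; exact hx.1
          calc _ ≤ 4.5 * (5 * lam) * 1 := by gcongr
            _ = _ := by ring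
        calc _ ≤ m * (2 * (1 / √N) ^ 2 + 2 * (3 / 2 / x) ^ 2) := by gcongr
          _ = 2 * (m * (1 / N)) + m * (2 * (3 / 2 / x) ^ 2) := by rw [h3]; ring
          _ ≤ 40 * lam := by linarith
      have t1 : m * π * d / x ≤ 5 * π * d * lam := by
        rw [show m * π * d / x = π * d * (m / x) by ring]
        calc _ ≤ π * d * (5 * lam) := by gcongr
          _ = _ := by ring
      have t2 : (2 * d + 2 + 2 * m * d * (W / x)) * (W / x) = (2 * d + 2) * (W / x) + 2 * d * (m * (W / x) ^ 2) := by ring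
      have t3 : (2 * d + 2) * (W / x) ≤ (2 * d + 2) * (1 / 2) := by gcongr
      have t4 : 2 * d * (m * (W / x) ^ 2) ≤ 2 * d * (40 * lam) := by gcongr
      rw [t2]
      have h9 : d + 1 + 14 ≤ (d + 1 + 14) * lam := le_mul_of_one_le_right (by linarith) hlam
      linarith
    calc _ ≤ ∑ i ∈ Finset.range L, (5 * π * d + 14 + (d + 1) + 2 * d * 40) * lam := Finset.sum_le_sum hc
      _ = _ := by simp
  refine (abs_add_le _ _).trans ((add_le_add (abs_add_le _ _) le_rfl).trans ?_)
  have o1' := o1.trans (le_trans (le_of_eq (by rfl)) b1)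
  have o2' := o2.trans b2
  have hLl : 0 ≤ (L:ℝ) * lam := by positivity
  have e8 : E ^ 3 / (4 * d) = 2 * (E ^ 3 / (8 * d)) := by field_simp; norm_num
  have e80 : 0 ≤ E ^ 3 / (8 * d) := by positivity
  have q1 : 0 ≤ (5 * π * d + 14 + (d + 1) + 2 * d * 40) * √N := by positivity
  have q2 : 0 ≤ E ^ 3 / (8 * d) * (L * lam) := by positivity
  rw [e8]
  linarith

end S3

namespace S3
open MeasureTheory Set Filter Topology Real

noncomputable def sn (d y : ℝ) : ℂ := 2 * (π : ℂ) * Complex.I * (d : ℂ) * (y : ℂ)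

noncomputable def tm (θ : ℝ) (f : ℝ → ℂ) (y : ℝ) : ℂ :=
  1 / (2 * (π : ℂ) * Complex.I) * (f y * Complex.exp (2 * (π : ℂ) * Complex.I * (θ : ℂ) * (y : ℂ)) / (y : ℂ)
    + f (-y) * Complex.exp (2 * (π : ℂ) * Complex.I * (θ : ℂ) * ((-y : ℝ) : ℂ)) / ((-y : ℝ) : ℂ))

noncomputable def TT (θ : ℝ) (N : ℕ) (f : ℝ → ℂ) : ℂ := ∑ n ∈ Finset.range N, tm θ f ((n : ℝ) + 1)

lemma TT_add (θ : ℝ) (N : ℕ) (f g : ℝ → ℂ) : TT θ N (fun y => f y + g y) = TT θ N f + TT θ N g := by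
  rw [TT, TT, TT, ← Finset.sum_add_distrib]
  refine Finset.sum_congr rfl fun n _ => ?_
  simp only [tm]; ring

lemma TT_sub (θ : ℝ) (N : ℕ) (f g : ℝ → ℂ) : TT θ N (fun y => f y - g y) = TT θ N f - TT θ N g := by
  rw [TT, TT, TT, ← Finset.sum_sub_distrib]
  refine Finset.sum_congr rfl fun n _ => ?_
  simp only [tm]; ring

lemma TT_mul (θ : ℝ) (N : ℕ) (f : ℝ → ℂ) (c : ℂ) : TT θ N (fun y => f y * c) = TT θ N f * c := by
  rw [TT, TT, Finset.sum_mul]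
  refine Finset.sum_congr rfl fun n _ => ?_
  simp only [tm]; ring

lemma TT_sum {ι : Type*} (θ : ℝ) (N : ℕ) (S : Finset ι) (f : ι → ℝ → ℂ) :
    TT θ N (fun y => ∑ k ∈ S, f k y) = ∑ k ∈ S, TT θ N (f k) := by
  classical
  induction S using Finset.induction_on with
  | empty => simp [TT, tm]
  | insert a S ha ih =>
    simp only [Finset.sum_insert ha]
    rw [TT_add, ih]

lemma tm_norm (θ : ℝ) (f : ℝ → ℂ) {y : ℝ} (hy : 0 < y) : ‖tm θ f y‖ ≤ (‖f y‖ + ‖f (-y)‖) / (2 * π * y) := by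
  have hpi := pi_pos
  have h1 : ∀ z : ℝ, ‖Complex.exp (2 * (π : ℂ) * Complex.I * (θ : ℂ) * (z : ℂ))‖ = 1 := by
    intro z
    rw [show 2 * (π : ℂ) * Complex.I * (θ : ℂ) * (z : ℂ) = ((2 * π * θ * z : ℝ) : ℂ) * Complex.I by push_cast; ring]
    exact Complex.norm_exp_ofReal_mul_I _
  rw [tm, norm_mul]
  have h2 : ‖1 / (2 * (π : ℂ) * Complex.I)‖ = 1 / (2 * π) := by
    simp [abs_of_pos hpi]
  rw [h2]
  refine (mul_le_mul_of_nonneg_left (norm_add_le _ _) (by positivity)).trans (le_of_eq ?_)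
  rw [norm_div, norm_div, norm_mul, norm_mul, h1, h1, Complex.norm_real, Complex.norm_real, norm_neg, norm_of_nonneg hy.le]
  field_simp

lemma cpow_sn {u : ℝ} (hu : 0 < u) (d y : ℝ) : (u : ℂ) ^ (-(sn d y)) = Complex.exp ((-(2 * π * d * y * log u) : ℝ) * Complex.I) := by
  rw [Complex.cpow_def_of_ne_zero (by exact_mod_cast hu.ne'), ← Complex.ofReal_log hu.le, sn]
  congr 1; push_cast; ring

lemma tm_cpow (d θ : ℝ) {u y : ℝ} (hu : 0 < u) (hy : 0 < y) :
    tm θ (fun y => (u : ℂ) ^ (-(sn d y))) y = ((-(sin (2 * π * y * (d * log u - θ)) / (π * y)) : ℝ) : ℂ) := by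
  have hpi := pi_pos
  rw [tm]
  simp only [cpow_sn hu]
  rw [← Complex.exp_add, ← Complex.exp_add]
  set a : ℝ := 2 * π * y * (d * log u - θ) with ha
  rw [show ((-(2 * π * d * y * log u) : ℝ) : ℂ) * Complex.I + 2 * (π : ℂ) * Complex.I * (θ : ℂ) * (y : ℂ) = -(a : ℂ) * Complex.I by
    rw [ha]; push_cast; ring]
  rw [show ((-(2 * π * d * -y * log u) : ℝ) : ℂ) * Complex.I + 2 * (π : ℂ) * Complex.I * (θ : ℂ) * ((-y : ℝ) : ℂ) = (a : ℂ) * Complex.I by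
    rw [ha]; push_cast; ring]
  have hy' : (y : ℂ) ≠ 0 := by exact_mod_cast hy.ne'
  have hp' : (π : ℂ) ≠ 0 := by exact_mod_cast hpi.ne'
  push_cast
  rw [Complex.sin]
  field_simp
  rw [Complex.I_sq]; ring

lemma TT_cpow (d θ : ℝ) (N : ℕ) {u : ℝ} (hu : 0 < u) :
    TT θ N (fun y => (u : ℂ) ^ (-(sn d y))) = ((-(Ds N (d * log u - θ)) : ℝ) : ℂ) := by
  rw [TT, Ds, ← Finset.sum_neg_distrib, Complex.ofReal_sum]
  refine Finset.sum_congr rfl fun n _ => ?_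
  rw [tm_cpow d θ hu (by positivity)]

lemma tm_int (d θ : ℝ) {A U y : ℝ} (hA : 1 ≤ A) (hAU : A ≤ U) (hy : 0 < y) :
    tm θ (fun y => ∫ u in A..U, sn d y * (u : ℂ) ^ (-(sn d y) - 1) * (saw u : ℂ)) y =
      ((∫ u in A..U, 2 * cos (2 * π * y * (d * log u - θ)) * (d / u) * saw u : ℝ) : ℂ) := by
  have hpi := pi_pos
  have hii : ∀ z : ℝ, IntervalIntegrable (fun u : ℝ => sn d z * (u : ℂ) ^ (-(sn d z) - 1) * (saw u : ℂ)) volume A U := by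
    intro z
    refine (sawK_ii (𝕜 := ℂ) A U).continuousOn_mul ?_
    rw [uIcc_of_le hAU]
    exact (cpow_contOn (by linarith) _).const_smul (sn d z)
  rw [tm]
  simp only [mul_div_assoc]
  rw [← intervalIntegral.integral_mul_const, ← intervalIntegral.integral_mul_const,
    ← intervalIntegral.integral_add ((hii _).mul_const _) ((hii _).mul_const _), ← intervalIntegral.integral_const_mul,
    ← intervalIntegral.integral_ofReal]
  refine intervalIntegral.integral_congr fun u hu => ?_
  rw [uIcc_of_le hAU] at hu
  have hu0 : 0 < u := by linarith [hu.1]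
  have hu' : (u : ℂ) ≠ 0 := by exact_mod_cast hu0.ne'
  have hy' : (y : ℂ) ≠ 0 := by exact_mod_cast hy.ne'
  have hp' : (π : ℂ) ≠ 0 := by exact_mod_cast hpi.ne'
  simp only [Complex.cpow_sub _ _ hu', Complex.cpow_one, cpow_sn hu0]
  set a : ℝ := 2 * π * y * (d * log u - θ) with ha
  have e1 : Complex.exp ((-(2 * π * d * y * log u) : ℝ) * Complex.I) * Complex.exp (2 * (π : ℂ) * Complex.I * (θ : ℂ) * (y : ℂ)) = Complex.exp (-(a : ℂ) * Complex.I) := by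
    rw [← Complex.exp_add]; congr 1; rw [ha]; push_cast; ring
  have e2 : Complex.exp ((-(2 * π * d * -y * log u) : ℝ) * Complex.I) * Complex.exp (2 * (π : ℂ) * Complex.I * (θ : ℂ) * ((-y : ℝ) : ℂ)) = Complex.exp ((a : ℂ) * Complex.I) := by
    rw [← Complex.exp_add]; congr 1; rw [ha]; push_cast; ring
  have e3 : (2 * cos a : ℝ) = Complex.exp ((a : ℂ) * Complex.I) + Complex.exp (-(a : ℂ) * Complex.I) := by
    push_cast; rw [Complex.cos]; ring
  rw [Complex.ofReal_mul, Complex.ofReal_mul, e3, ← e1, ← e2]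
  simp only [sn]
  push_cast
  field_simp
  ring

lemma TT_int (d θ : ℝ) (N : ℕ) {A U : ℝ} (hA : 1 ≤ A) (hAU : A ≤ U) :
    TT θ N (fun y => ∫ u in A..U, sn d y * (u : ℂ) ^ (-(sn d y) - 1) * (saw u : ℂ)) =
      ((∫ u in A..U, (Dir N (d * log u - θ) - 1) * (d / u) * saw u : ℝ) : ℂ) := by
  have hco : ∀ c : ℝ, ContinuousOn (fun u : ℝ => 2 * cos (c * (d * log u - θ)) * (d / u)) (uIcc A U) := by
    intro c
    rw [uIcc_of_le hAU]
    intro u hu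
    have hu0 : u ≠ 0 := by linarith [hu.1]
    apply ContinuousAt.continuousWithinAt
    have := continuousAt_log hu0
    have h2 : ContinuousAt (fun u : ℝ => d / u) u := continuousAt_const.div continuousAt_id hu0
    fun_prop
  have : ∀ u : ℝ, (Dir N (d * log u - θ) - 1) * (d / u) * saw u =
      ∑ n ∈ Finset.range N, 2 * cos (2 * π * ((n : ℝ) + 1) * (d * log u - θ)) * (d / u) * saw u := by
    intro u
    rw [Dir, add_sub_cancel_left, Finset.mul_sum, Finset.sum_mul, Finset.sum_mul]
  simp only [this]
  rw [intervalIntegral.integral_finsetSum, TT, Complex.ofReal_sum]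
  · exact Finset.sum_congr rfl fun n _ => tm_int d θ hA hAU (by positivity)
  · intro n _
    exact (saw_ii A U).continuousOn_mul (hco _)

end S3

namespace S3
open MeasureTheory Set Filter Topology Real

lemma sn_ne (d : ℝ) (y : ℝ) : sn d y ≠ 1 := by
  intro h
  have := congrArg Complex.re h
  simp [sn] at this

lemma sn_re (d y : ℝ) : (sn d y).re = 0 := by simp [sn]

lemma sn_norm {d : ℝ} (hd : 0 < d) (y : ℝ) : ‖sn d y‖ = 2 * π * d * |y| := by
  simp [sn, abs_of_pos hd, abs_of_pos pi_pos]

lemma TT_bound (θ : ℝ) (N : ℕ) (f : ℝ → ℂ) (b : ℝ → ℝ) (h : ∀ y : ℝ, 1 ≤ |y| → |y| ≤ (N : ℝ) → ‖f y‖ ≤ b |y|) :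
    ‖TT θ N f‖ ≤ ∑ n ∈ Finset.range N, b ((n : ℝ) + 1) / (π * ((n : ℝ) + 1)) := by
  rw [TT]
  refine (norm_sum_le _ _).trans (Finset.sum_le_sum fun n hn => ?_)
  have hpi := pi_pos
  have hn' : (n : ℝ) + 1 ≤ N := by exact_mod_cast Finset.mem_range.1 hn
  have hn0 : (0 : ℝ) ≤ n := by positivity
  have ha : |(n : ℝ) + 1| = n + 1 := abs_of_pos (by positivity)
  refine (tm_norm θ f (by positivity)).trans ?_
  have h1 := h ((n : ℝ) + 1) (by rw [ha]; linarith) (by rw [ha]; exact hn')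
  have h2 := h (-((n : ℝ) + 1)) (by rw [abs_neg, ha]; linarith) (by rw [abs_neg, ha]; exact hn')
  rw [abs_neg] at h2
  rw [ha] at h1 h2
  calc _ ≤ (b (n + 1) + b (n + 1)) / (2 * π * (n + 1)) := by gcongr
    _ = _ := by field_simp; ring

lemma TT_ZU {d : ℝ} (hd : 0 < d) (θ : ℝ) (N : ℕ) {A : ℝ} (hA : 1 ≤ A) :
    ‖TT θ N (fun y => ZU A (sn d y))‖ ≤ 2 * A + 1 + A / (d * π ^ 2) := by
  have hpi := pi_pos
  have hA0 : 0 < A := by linarith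
  have e : (fun y => ZU A (sn d y)) = fun y => (∑ k ∈ Finset.Ioc 0 ⌊A⌋₊, ((k : ℝ) : ℂ) ^ (-(sn d y)) + (A : ℂ) ^ (-(sn d y)) * (saw A : ℂ))
      + (A : ℂ) ^ (1 - (sn d y)) / ((sn d y) - 1) := by
    ext y; simp [ZU]
  rw [e, TT_add, TT_add, TT_mul, TT_sum, TT_cpow d θ N hA0]
  have h1 : ‖∑ k ∈ Finset.Ioc 0 ⌊A⌋₊, TT θ N (fun y => ((k : ℝ) : ℂ) ^ (-(sn d y)))‖ ≤ (3 / 2) * A := by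
    refine (norm_sum_le_of_le _ (f := fun k : ℕ => TT θ N (fun y => ((k : ℝ) : ℂ) ^ (-(sn d y)))) (n := fun _ => (3 / 2 : ℝ)) ?_).trans ?_
    · intro k hk
      have : (0 : ℝ) < k := by exact_mod_cast (Finset.mem_Ioc.1 hk).1
      rw [TT_cpow d θ N this, Complex.norm_real, norm_neg]
      exact Ds_abs _ _
    · simp
      have := Nat.floor_le hA0.le
      linarith
  have h2 : ‖((-(Ds N (d * log A - θ)) : ℝ) : ℂ) * (saw A : ℂ)‖ ≤ (3 / 2) * (1 / 2) := by
    rw [norm_mul, Complex.norm_real, Complex.norm_real, norm_neg]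
    exact mul_le_mul (Ds_abs _ _) (saw_abs _) (norm_nonneg _) (by norm_num)
  have h3 : ‖TT θ N (fun y => (A : ℂ) ^ (1 - (sn d y)) / ((sn d y) - 1))‖ ≤ A / (d * π ^ 2) := by
    refine (TT_bound θ N _ (fun y => A / (2 * π * d * y)) ?_).trans ?_
    · intro y hy _
      have hyp : 0 < |y| := by linarith
      rw [norm_div, Complex.norm_cpow_eq_rpow_re_of_pos hA0]
      have : (1 - sn d y).re = 1 := by simp [sn_re]
      rw [this, rpow_one]
      gcongr
      have h4 := Complex.abs_im_le_norm (sn d y - 1)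
      have h5 : (sn d y - 1).im = 2 * π * d * y := by simp [sn]
      rw [h5, abs_mul, abs_of_pos (by positivity : 0 < 2 * π * d)] at h4
      exact h4
    · have : ∀ n : ℕ, A / (2 * π * d * ((n : ℝ) + 1)) / (π * ((n : ℝ) + 1)) = A / (2 * d * π ^ 2) * (1 / ((n : ℝ) + 1) ^ 2) := by
        intro n; field_simp
      simp only [this]
      rw [← Finset.mul_sum]
      refine (mul_le_mul_of_nonneg_left (sum_inv_sq N) (by positivity)).trans (le_of_eq ?_)
      field_simp
  refine (norm_add_le _ _).trans ?_
  have := norm_add_le (∑ k ∈ Finset.Ioc 0 ⌊A⌋₊, TT θ N (fun y => ((k : ℝ) : ℂ) ^ (-(sn d y)))) (((-(Ds N (d * log A - θ)) : ℝ) : ℂ) * (saw A : ℂ))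
  linarith

lemma TT_rem {d : ℝ} (hd : 0 < d) (θ : ℝ) (N : ℕ) {U : ℝ} (hU : 1 ≤ U) (hN : (N : ℝ) ^ 2 ≤ U) :
    ‖TT θ N (fun y => riemannZeta (sn d y) - ZU U (sn d y))‖ ≤ 2 * d * (2 + 2 * π * d) := by
  have hpi := pi_pos
  have hU0 : 0 < U := by linarith
  refine (TT_bound θ N _ (fun y => 2 * π * d * y * ((2 + 2 * π * d) * N) / U) ?_).trans ?_
  · intro y hy hyN
    refine (zeta_ZU hU (by rw [sn_re]) (sn_ne d y)).trans ?_
    rw [sn_re, sn_norm hd]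
    simp only [neg_zero, zero_sub, rpow_neg_one]
    rw [← div_eq_mul_inv]
    gcongr
    have h := norm_add_le (sn d y) 1
    rw [sn_norm hd, norm_one] at h
    have : 2 * π * d * |y| ≤ 2 * π * d * N := by gcongr
    have hN1 : (1:ℝ) ≤ N := hy.trans hyN
    linarith
  · have : ∀ n : ℕ, 2 * π * d * ((n : ℝ) + 1) * ((2 + 2 * π * d) * N) / U / (π * ((n : ℝ) + 1)) = 2 * d * (2 + 2 * π * d) * N / U := by
      intro n; field_simp
    simp only [this]
    rw [Finset.sum_const, Finset.card_range, nsmul_eq_mul]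
    rw [show (N : ℝ) * (2 * d * (2 + 2 * π * d) * N / U) = 2 * d * (2 + 2 * π * d) * (N ^ 2 / U) by ring]
    refine mul_le_of_le_one_right (by positivity) ?_
    rw [div_le_one hU0]; exact hN

lemma saw_int_bound {d : ℝ} (hd : 0 < d) {A U : ℝ} (hA : 1 ≤ A) (hAU : A ≤ U) :
    |∫ u in A..U, d / u * saw u| ≤ 3 * d := by
  have hA0 : 0 < A := by linarith
  have hU0 : 0 < U := by linarith
  have h := parts (𝕜 := ℝ) hAU (fun u => d / u) (fun u => -d / u ^ 2) (fun t ht => by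
      have ht0 : t ≠ 0 := by linarith [ht.1]
      have := (hasDerivAt_inv ht0).const_mul d
      simp only [div_eq_mul_inv]
      refine this.congr_deriv ?_
      ring) (by
      intro t ht
      have ht0 : t ≠ 0 := by linarith [ht.1]
      exact (continuousAt_const.div (continuousAt_id.pow 2) (pow_ne_zero 2 ht0)).continuousWithinAt)
  simp only [RCLike.ofReal_real_eq_id, id] at h
  rw [h]
  have hb : ∀ t, 1 ≤ t → |d / t * Bt t| ≤ d := by
    intro t ht
    rw [abs_mul]
    have : |d / t| ≤ d := by
      rw [abs_of_pos (by positivity)]; exact div_le_self hd.le ht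
    calc _ ≤ d * 1 := mul_le_mul this (Bt_abs t) (abs_nonneg _) hd.le
      _ = d := mul_one d
  have hi : |∫ t in A..U, -d / t ^ 2 * Bt t| ≤ d := by
    have h1 : ∫ t in A..U, d * t ^ (-2 : ℤ) = d * ((U ^ (-1 : ℤ) - A ^ (-1 : ℤ)) / (-1)) := by
      rw [intervalIntegral.integral_const_mul, integral_zpow]
      · norm_num
      · right; refine ⟨by norm_num, ?_⟩
        rw [uIcc_of_le hAU]; intro h; linarith [h.1]
    have h2 : ‖∫ t in A..U, -d / t ^ 2 * Bt t‖ ≤ ∫ t in A..U, d * t ^ (-2 : ℤ) := by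
      apply intervalIntegral.norm_integral_le_of_norm_le hAU
      · filter_upwards with t ht
        rw [norm_mul, norm_eq_abs, norm_eq_abs, abs_div, abs_neg, abs_of_pos hd, abs_of_nonneg (by positivity : 0 ≤ t ^ 2)]
        calc _ ≤ d / t ^ 2 * 1 := by
              gcongr; exact Bt_abs t
          _ = _ := by rw [mul_one, zpow_neg, div_eq_mul_inv]; norm_cast
      · apply ContinuousOn.intervalIntegrable
        rw [uIcc_of_le hAU]
        intro t ht
        have ht0 : t ≠ 0 := by linarith [ht.1]
        exact (continuousAt_const.mul (continuousAt_zpow₀ t _ (Or.inl ht0))).continuousWithinAt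
    rw [h1] at h2
    refine h2.trans ?_
    rw [zpow_neg_one, zpow_neg_one]
    have : A⁻¹ ≤ 1 := inv_le_one_of_one_le₀ hA
    have : 0 < U⁻¹ := by positivity
    nlinarith
  have b1 := abs_le.1 (hb U (by linarith))
  have b2 := abs_le.1 (hb A hA)
  have b3 := abs_le.1 hi
  rw [abs_le]; constructor <;> linarith

noncomputable def xx (d θ : ℝ) (h : ℝ) : ℝ := exp ((h + θ) / d)

lemma II_xx {d : ℝ} (hd : 0 < d) (θ : ℝ) (N h : ℕ) :
    II d N (xx d θ h) = ∫ u in (xx d θ ((h : ℝ) - 1 / 2))..(xx d θ (((h + 1 : ℕ) : ℝ) - 1 / 2)), Dir N (d * log u - θ) * (d / u) * saw u := by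
  rw [II]
  have e1 : xx d θ h / exp (1 / (2 * d)) = xx d θ ((h : ℝ) - 1 / 2) := by
    rw [xx, xx, ← exp_sub]; congr 1; field_simp; ring
  have e2 : xx d θ h * exp (1 / (2 * d)) = xx d θ (((h + 1 : ℕ) : ℝ) - 1 / 2) := by
    rw [xx, xx, ← exp_add]; congr 1; push_cast; field_simp; ring
  rw [e1, e2]
  congr 1; ext u
  have : d * log u - θ = vv d (xx d θ h) u + ((h : ℤ) : ℝ) := by
    rw [vv, xx, log_exp]; push_cast; field_simp; ring
  rw [this, Dir_add_int]

theorem SN_red {d : ℝ} (hd : 0 < d) (θ : ℝ) (h0 : ℕ) (hA : 1 ≤ xx d θ ((h0 : ℝ) - 1 / 2)) :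
    ∃ C > 0, ∀ N H : ℕ, h0 ≤ H → (N : ℝ) ^ 2 ≤ xx d θ ((H : ℝ) - 1 / 2) →
      ‖TT θ N (fun y => riemannZeta (sn d y)) + ((∑ h ∈ Finset.Ico h0 H, II d N (xx d θ h) : ℝ) : ℂ)‖ ≤ C := by
  have hpi := pi_pos
  set A := xx d θ ((h0 : ℝ) - 1 / 2) with hAdef
  refine ⟨(2 * A + 1 + A / (d * π ^ 2)) + 2 * d * (2 + 2 * π * d) + 3 * d, by positivity, fun N H hH hN => ?_⟩
  have hmono : ∀ a b : ℝ, a ≤ b → xx d θ a ≤ xx d θ b := by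
    intro a b h; rw [xx, xx]; gcongr
  set U := xx d θ ((H : ℝ) - 1 / 2) with hU
  have hAU : A ≤ U := hmono _ _ (by have : (h0 : ℝ) ≤ H := by exact_mod_cast hH
                                    linarith)
  have hpos : ∀ a, 0 < xx d θ a := fun a => exp_pos _
  have hsaw : IntervalIntegrable (fun u => d / u * saw u) volume A U := by
    refine (saw_ii A U).continuousOn_mul ?_
    rw [uIcc_of_le hAU]
    intro u hu
    have hu0 : u ≠ 0 := by linarith [hu.1]
    exact (continuousAt_const.div continuousAt_id hu0).continuousWithinAt
  have hDi : ∀ a b : ℝ, 0 < a → a ≤ b → IntervalIntegrable (fun u => Dir N (d * log u - θ) * (d / u) * saw u) volume a b := by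
    intro a b ha hab
    refine (saw_ii a b).continuousOn_mul ?_
    rw [uIcc_of_le hab]
    intro u hu
    have hu0 : u ≠ 0 := by linarith [hu.1]
    apply ContinuousAt.continuousWithinAt
    have h1 := continuousAt_log hu0
    have h2 : ContinuousAt (fun u : ℝ => d / u) u := continuousAt_const.div continuousAt_id hu0
    have h3 : ContinuousAt (fun u : ℝ => Dir N (d * log u - θ)) u :=
      (Dir_cont N).continuousAt.comp (f := fun u : ℝ => d * log u - θ) (by fun_prop)
    exact h3.mul h2
  have hsum : ∑ h ∈ Finset.Ico h0 H, II d N (xx d θ h) = ∫ u in A..U, Dir N (d * log u - θ) * (d / u) * saw u := by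
    simp only [II_xx hd]
    exact intervalIntegral.sum_integral_adjacent_intervals_Ico (a := fun h : ℕ => xx d θ ((h : ℝ) - 1 / 2)) hH
      (fun k _ => hDi _ _ (hpos _) (hmono _ _ (by push_cast; linarith)))
  have hfun : (fun y => riemannZeta (sn d y)) = fun y => (ZU A (sn d y) - ∫ u in A..U, sn d y * (u : ℂ) ^ (-(sn d y) - 1) * (saw u : ℂ))
      + (riemannZeta (sn d y) - ZU U (sn d y)) := by
    ext y; rw [ZU_step hA hAU (sn_ne d y)]; ring
  rw [hsum, hfun, TT_add, TT_sub, TT_int d θ N hA hAU]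
  have hsplit : ∫ u in A..U, (Dir N (d * log u - θ) - 1) * (d / u) * saw u =
      (∫ u in A..U, Dir N (d * log u - θ) * (d / u) * saw u) - ∫ u in A..U, d / u * saw u := by
    rw [← intervalIntegral.integral_sub (hDi A U (hpos _) hAU) hsaw]
    congr 1; ext u; ring
  rw [hsplit]
  have b1 := TT_ZU hd θ N hA
  have b2 := TT_rem hd θ N (hA.trans hAU) hN
  have b3 : ‖((∫ u in A..U, d / u * saw u : ℝ) : ℂ)‖ ≤ 3 * d := by
    rw [Complex.norm_real]; exact saw_int_bound hd hA hAU
  have e : ∀ a b c e : ℂ, a - (b - c) + e + b = a + e + c := by intros; ring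
  rw [Complex.ofReal_sub, e]
  exact (norm_add₃_le).trans (by linarith)

end S3

namespace S3
open MeasureTheory Set Filter Topology Real

lemma sum_sym (N : ℕ) (f : ℤ → ℂ) :
    ∑ n ∈ (Finset.Icc (-(N : ℤ)) (N : ℤ)).erase 0, f n = ∑ n ∈ Finset.range N, (f ((n : ℤ) + 1) + f (-((n : ℤ) + 1))) := by
  induction N with
  | zero => simp
  | succ N ih =>
    have e : (Finset.Icc (-((N + 1 : ℕ) : ℤ)) ((N + 1 : ℕ) : ℤ)).erase 0 =
        insert ((N : ℤ) + 1) (insert (-((N : ℤ) + 1)) ((Finset.Icc (-(N : ℤ)) (N : ℤ)).erase 0)) := by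
      ext k; simp only [Finset.mem_erase, Finset.mem_Icc, Finset.mem_insert]; push_cast; omega
    rw [e, Finset.sum_insert, Finset.sum_insert, ih, Finset.sum_range_succ]
    · ring
    · simp
    · simp only [Finset.mem_erase, Finset.mem_Icc, Finset.mem_insert]; omega

lemma SN_eq (d θ : ℝ) (N : ℕ) :
    (1 / (2 * (Real.pi : ℂ) * Complex.I)) *
              (∑ n ∈ (Finset.Icc (-(N : ℤ)) (N : ℤ)).erase 0,
                riemannZeta (2 * (Real.pi : ℂ) * Complex.I * (d : ℂ) * (n : ℂ)) *
                  Complex.exp (2 * (Real.pi : ℂ) * Complex.I * (θ : ℂ) * (n : ℂ)) / (n : ℂ))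
      = TT θ N (fun y => riemannZeta (sn d y)) := by
  rw [sum_sym, TT, Finset.mul_sum]
  refine Finset.sum_congr rfl fun n _ => ?_
  rw [tm, sn, sn]
  push_cast
  rfl

lemma TT_diff {d : ℝ} (hd : 0 < d) (θ : ℝ) : ∃ C > 0, ∃ N2 : ℕ, ∀ N i : ℕ, N2 ≤ N → i ≤ N →
    ‖TT θ N (fun y => riemannZeta (sn d y)) - TT θ (N + i) (fun y => riemannZeta (sn d y))‖ ≤ C * i * log N / √N := by
  have hpi := pi_pos
  set c : ℝ := 4 * π * d with hc
  have hc0 : 0 < c := by positivity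
  refine ⟨√c * (12 + |log c|), by positivity, ⌈1 / (2 * π * d)⌉₊ + 3, fun N i hN hi => ?_⟩
  have hN3 : 3 ≤ N := by omega
  have hN3' : (3 : ℝ) ≤ N := by exact_mod_cast hN3
  have hNc : 1 / (2 * π * d) ≤ N := by
    refine (Nat.le_ceil _).trans ?_
    exact_mod_cast (by omega : ⌈1 / (2 * π * d)⌉₊ ≤ N)
  have hlog : 1 ≤ log N := by
    rw [le_log_iff_exp_le (by linarith)]
    linarith [exp_one_lt_d9]
  have e : TT θ (N + i) (fun y => riemannZeta (sn d y)) = TT θ N (fun y => riemannZeta (sn d y)) +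
      ∑ j ∈ Finset.range i, tm θ (fun y => riemannZeta (sn d y)) (((N + j : ℕ) : ℝ) + 1) := by
    rw [TT, TT, Finset.sum_range_add]
  rw [e, sub_add_cancel_left, norm_neg]
  have hz : ∀ y : ℝ, N ≤ |y| → |y| ≤ 2 * N → ‖riemannZeta (sn d y)‖ ≤ √c * √N * ((12 + |log c|) * log N) := by
    intro y h1 h2
    have e1 : sn d y = Complex.I * ((2 * π * d * y : ℝ) : ℂ) := by rw [sn]; push_cast; ring
    have e2 : |2 * π * d * y| = 2 * π * d * |y| := by rw [abs_mul, abs_of_pos (by positivity)]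
    have h3 : 2 * π * d * |y| ≤ c * N := by
      rw [hc]
      calc _ ≤ 2 * π * d * (2 * N) := by gcongr
        _ = _ := by ring
    have h4 : 1 ≤ 2 * π * d * |y| := by
      have := hNc.trans h1
      rw [div_le_iff₀ (by positivity)] at this
      linarith
    rw [e1]
    refine (zeta_zero_line (by rw [e2]; exact h4)).trans ?_
    rw [e2, ← sqrt_mul hc0.le]
    have h5 : log (2 * π * d * |y|) ≤ log c + log N := by
      rw [← log_mul hc0.ne' (by linarith)]
      exact log_le_log (by linarith) h3
    have h6 : 0 ≤ log (2 * π * d * |y|) := log_nonneg h4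
    gcongr
    have := le_abs_self (log c)
    have := abs_nonneg (log c)
    nlinarith
  have hterm : ∀ j ∈ Finset.range i, ‖tm θ (fun y => riemannZeta (sn d y)) (((N + j : ℕ) : ℝ) + 1)‖ ≤ √c * (12 + |log c|) * log N / √N := by
    intro j hj
    have hj' : N + j + 1 ≤ 2 * N := by have := Finset.mem_range.1 hj; omega
    have hj2 : ((N + j : ℕ) : ℝ) + 1 ≤ 2 * N := by exact_mod_cast hj'
    have hj3 : (N : ℝ) ≤ ((N + j : ℕ) : ℝ) + 1 := by push_cast; linarith [(Nat.cast_nonneg j : (0:ℝ) ≤ j)]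
    set y := ((N + j : ℕ) : ℝ) + 1 with hy
    have hyp : 0 < y := by linarith
    refine (tm_norm θ _ hyp).trans ?_
    have a1 := hz y (by rwa [abs_of_pos hyp]) (by rwa [abs_of_pos hyp])
    have a2 := hz (-y) (by rwa [abs_neg, abs_of_pos hyp]) (by rwa [abs_neg, abs_of_pos hyp])
    set B := √c * √N * ((12 + |log c|) * log N) with hB
    have hB0 : 0 ≤ B := by positivity
    calc _ ≤ (B + B) / (2 * π * y) := by gcongr
      _ ≤ (B + B) / (2 * 1 * N) := by
          gcongr
          linarith [pi_gt_three]
      _ = B / N := by field_simp; ring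
      _ = _ := by
          rw [hB]
          have hs : √(N:ℝ) * √(N:ℝ) = N := mul_self_sqrt (by linarith)
          have hs0 : 0 < √(N:ℝ) := sqrt_pos.2 (by linarith)
          rw [div_eq_div_iff (by linarith) hs0.ne']
          linear_combination (√c * ((12 + |log c|) * log N)) * hs
  refine (norm_sum_le_of_le _ hterm).trans (le_of_eq ?_)
  rw [Finset.sum_const, Finset.card_range, nsmul_eq_mul]; ring

lemma xx_pos (d θ h : ℝ) : 0 < xx d θ h := exp_pos _
lemma xx_succ (d θ h : ℝ) : xx d θ (h + 1) = xx d θ h * exp (1 / d) := by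
  rw [xx, xx, ← exp_add]; congr 1; ring

lemma xx_le {d : ℝ} (hd : 0 < d) (θ : ℝ) {h : ℝ} {Y : ℝ} (hY : 0 < Y) : xx d θ h ≤ Y ↔ h ≤ d * log Y - θ := by
  rw [xx, ← le_log_iff_exp_le hY, div_le_iff₀ hd]
  constructor <;> intro h <;> linarith

lemma geo1 {d : ℝ} (hd : 0 < d) (θ : ℝ) : ∃ K > 0, ∀ (S : Finset ℕ) (Y : ℝ), 0 < Y → (∀ h ∈ S, xx d θ h ≤ Y) →
    ∑ h ∈ S, xx d θ h ≤ K * Y := by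
  set E := exp (1 / d) with hE
  have hE1 : 1 < E := one_lt_exp_iff.2 (by positivity)
  have hE0 : 0 < E - 1 := by linarith
  refine ⟨E / (E - 1), by positivity, fun S Y hY hS => ?_⟩
  rcases S.eq_empty_or_nonempty with rfl | hne
  · simp; positivity
  · have hall : ∀ n : ℕ, ∑ h ∈ Finset.range n, xx d θ h ≤ xx d θ n / (E - 1) := by
      intro n
      induction n with
      | zero => simp; have := xx_pos d θ 0; positivity
      | succ n ih =>
        rw [Finset.sum_range_succ, Nat.cast_succ, xx_succ]
        calc _ ≤ xx d θ n / (E - 1) + xx d θ n := by linarith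
          _ = _ := by field_simp; ring
    have hM := hS _ (S.max'_mem hne)
    set M := S.max' hne
    calc _ ≤ ∑ h ∈ Finset.range (M + 1), xx d θ h := by
          refine Finset.sum_le_sum_of_subset_of_nonneg ?_ fun _ _ _ => (xx_pos _ _ _).le
          intro h hh
          exact Finset.mem_range.2 (Nat.lt_succ_of_le (S.le_max' h hh))
      _ ≤ _ := hall _
      _ = E / (E - 1) * xx d θ M := by rw [Nat.cast_succ, xx_succ]; ring
      _ ≤ _ := by gcongr

lemma geo2 {d : ℝ} (hd : 0 < d) (θ : ℝ) : ∃ K > 0, ∀ (S : Finset ℕ) (Y : ℝ), 0 < Y → (∀ h ∈ S, Y ≤ xx d θ h) →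
    ∑ h ∈ S, 1 / xx d θ h ≤ K / Y := by
  set E := exp (1 / d) with hE
  have hE1 : 1 < E := one_lt_exp_iff.2 (by positivity)
  have hE0 : 0 < E - 1 := by linarith
  refine ⟨E / (E - 1), by positivity, fun S Y hY hS => ?_⟩
  rcases S.eq_empty_or_nonempty with rfl | hne
  · simp; positivity
  · have hall : ∀ m n : ℕ, m ≤ n → ∑ h ∈ Finset.Ico m n, 1 / xx d θ h ≤ E / (E - 1) * (1 / xx d θ m - 1 / xx d θ n) := by
      intro m n hmn
      induction n, hmn using Nat.le_induction with
      | base => simp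
      | succ n hmn ih =>
        rw [Finset.sum_Ico_succ_top hmn, Nat.cast_succ, xx_succ]
        have := xx_pos d θ n
        calc _ ≤ E / (E - 1) * (1 / xx d θ m - 1 / xx d θ n) + 1 / xx d θ n := by linarith
          _ = _ := by rw [← hE]; field_simp; ring
    have hm := hS _ (S.min'_mem hne)
    have hmM := S.min'_le _ (S.max'_mem hne)
    have hsub : S ⊆ Finset.Ico (S.min' hne) (S.max' hne + 1) := fun h hh =>
      Finset.mem_Ico.2 ⟨S.min'_le h hh, Nat.lt_succ_of_le (S.le_max' h hh)⟩
    set M := S.max' hne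
    set m := S.min' hne
    have p1 := xx_pos d θ (M + 1 : ℕ)
    calc _ ≤ ∑ h ∈ Finset.Ico m (M + 1), 1 / xx d θ h := by
          refine Finset.sum_le_sum_of_subset_of_nonneg hsub fun h _ _ => ?_
          have := xx_pos d θ h
          positivity
      _ ≤ _ := hall _ _ (by omega)
      _ ≤ E / (E - 1) * (1 / xx d θ m) := by
          gcongr
          have : 0 < 1 / xx d θ (M + 1 : ℕ) := by positivity
          linarith
      _ ≤ E / (E - 1) * (1 / Y) := by gcongr
      _ = _ := by ring

lemma count_le (S : Finset ℕ) {a b : ℝ} (hab : a ≤ b) (hS : ∀ h ∈ S, a ≤ (h : ℝ) ∧ (h : ℝ) ≤ b) : (S.card : ℝ) ≤ b - a + 1 := by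
  rcases S.eq_empty_or_nonempty with rfl | hne
  · simp; linarith
  · have h1 := (hS _ (S.min'_mem hne)).1
    have h2 := (hS _ (S.max'_mem hne)).2
    have hmM := S.min'_le _ (S.max'_mem hne)
    have hsub : S ⊆ Finset.Ico (S.min' hne) (S.max' hne + 1) := fun h hh =>
      Finset.mem_Ico.2 ⟨S.min'_le h hh, Nat.lt_succ_of_le (S.le_max' h hh)⟩
    have h3 := Finset.card_le_card hsub
    rw [Nat.card_Ico] at h3
    have h4 : S.card + S.min' hne ≤ S.max' hne + 1 := by omega
    have h5 : (S.card : ℝ) + (S.min' hne : ℕ) ≤ (S.max' hne : ℕ) + 1 := by exact_mod_cast h4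
    linarith

lemma assemble {L : ℕ} (hL : 0 < L) (T0 : ℂ) (T : ℕ → ℂ) (R1 R2 R3 P : Finset ℕ) (I E : ℕ → ℕ → ℝ) (ψ : ℕ → ℝ)
    {b1 b2 b3 b4 b5 b6 : ℝ} (h1 : ∀ i < L, ‖T0 - T i‖ ≤ b1)
    (h2 : ∀ i < L, ‖T i + ((∑ h ∈ R1, I i h + ∑ h ∈ R2, I i h + ∑ h ∈ R3, I i h : ℝ) : ℂ)‖ ≤ b2)
    (h3 : ∀ i < L, |∑ h ∈ R1, (I i h - ψ h - E i h)| ≤ b3)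
    (h4 : ∀ i < L, |∑ h ∈ R3, I i h| ≤ b4)
    (h5 : |∑ h ∈ R2, ∑ i ∈ Finset.range L, I i h| ≤ L * b5)
    (h6 : |∑ h ∈ P, ψ h - ∑ h ∈ R1, ψ h| ≤ b6) :
    ‖T0 - (((-(∑ h ∈ P, ψ h) : ℝ) : ℂ) + ((-((∑ i ∈ Finset.range L, ∑ h ∈ R1, E i h) / L) : ℝ) : ℂ))‖ ≤ b1 + b2 + b3 + b4 + b5 + b6 := by
  have hL0 : (0 : ℝ) < L := by exact_mod_cast hL
  have hLc : (L : ℂ) ≠ 0 := by exact_mod_cast hL.ne'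
  have e1 : ∀ i, ∑ h ∈ R1, (I i h - ψ h - E i h) = ∑ h ∈ R1, I i h - ∑ h ∈ R1, ψ h - ∑ h ∈ R1, E i h := by
    intro i; rw [Finset.sum_sub_distrib, Finset.sum_sub_distrib]
  have hk : (L : ℂ) * (T0 - (((-(∑ h ∈ P, ψ h) : ℝ) : ℂ) + ((-((∑ i ∈ Finset.range L, ∑ h ∈ R1, E i h) / L) : ℝ) : ℂ))) =
      ∑ i ∈ Finset.range L, ((T0 - T i) + (T i + ((∑ h ∈ R1, I i h + ∑ h ∈ R2, I i h + ∑ h ∈ R3, I i h : ℝ) : ℂ))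
        - ((∑ h ∈ R1, (I i h - ψ h - E i h) : ℝ) : ℂ) - ((∑ h ∈ R3, I i h : ℝ) : ℂ) + ((∑ h ∈ P, ψ h - ∑ h ∈ R1, ψ h : ℝ) : ℂ))
      - ((∑ h ∈ R2, ∑ i ∈ Finset.range L, I i h : ℝ) : ℂ) := by
    have e2 : ∀ i, (T0 - T i) + (T i + ((∑ h ∈ R1, I i h + ∑ h ∈ R2, I i h + ∑ h ∈ R3, I i h : ℝ) : ℂ))
        - ((∑ h ∈ R1, (I i h - ψ h - E i h) : ℝ) : ℂ) - ((∑ h ∈ R3, I i h : ℝ) : ℂ) + ((∑ h ∈ P, ψ h - ∑ h ∈ R1, ψ h : ℝ) : ℂ)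
        = (T0 + ((∑ h ∈ P, ψ h : ℝ) : ℂ)) + ((∑ h ∈ R2, I i h : ℝ) : ℂ) + ((∑ h ∈ R1, E i h : ℝ) : ℂ) := by
      intro i
      rw [e1]
      simp only [Complex.ofReal_add, Complex.ofReal_sub]
      ring
    rw [Finset.sum_congr rfl fun i _ => e2 i, Finset.sum_add_distrib, Finset.sum_add_distrib, Finset.sum_const, Finset.card_range,
      nsmul_eq_mul, Finset.sum_comm (s := R2), ← Complex.ofReal_sum, ← Complex.ofReal_sum, Complex.ofReal_neg, Complex.ofReal_neg, Complex.ofReal_div,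
      Complex.ofReal_natCast]
    field_simp
    ring
  have hn := congrArg norm hk
  rw [norm_mul, Complex.norm_natCast] at hn
  have hb : ‖∑ i ∈ Finset.range L, ((T0 - T i) + (T i + ((∑ h ∈ R1, I i h + ∑ h ∈ R2, I i h + ∑ h ∈ R3, I i h : ℝ) : ℂ))
        - ((∑ h ∈ R1, (I i h - ψ h - E i h) : ℝ) : ℂ) - ((∑ h ∈ R3, I i h : ℝ) : ℂ) + ((∑ h ∈ P, ψ h - ∑ h ∈ R1, ψ h : ℝ) : ℂ))‖
      ≤ L * (b1 + b2 + b3 + b4 + b6) := by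
    refine (norm_sum_le_of_le _ (n := fun _ => b1 + b2 + b3 + b4 + b6) ?_).trans (by rw [Finset.sum_const, Finset.card_range, nsmul_eq_mul])
    intro i hi
    have hi := Finset.mem_range.1 hi
    refine (norm_add_le _ _).trans (add_le_add ?_ ?_)
    · refine (norm_sub_le _ _).trans (add_le_add ?_ ?_)
      · refine (norm_sub_le _ _).trans (add_le_add ?_ ?_)
        · exact (norm_add_le _ _).trans (add_le_add (h1 i hi) (h2 i hi))
        · rw [Complex.norm_real]; exact h3 i hi
      · rw [Complex.norm_real]; exact h4 i hi
    · rw [Complex.norm_real]; exact h6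
  have hb5 : ‖((∑ h ∈ R2, ∑ i ∈ Finset.range L, I i h : ℝ) : ℂ)‖ ≤ L * b5 := by
    rw [Complex.norm_real]; exact h5
  have := norm_sub_le (∑ i ∈ Finset.range L, ((T0 - T i) + (T i + ((∑ h ∈ R1, I i h + ∑ h ∈ R2, I i h + ∑ h ∈ R3, I i h : ℝ) : ℂ))
        - ((∑ h ∈ R1, (I i h - ψ h - E i h) : ℝ) : ℂ) - ((∑ h ∈ R3, I i h : ℝ) : ℂ) + ((∑ h ∈ P, ψ h - ∑ h ∈ R1, ψ h : ℝ) : ℂ))) ((∑ h ∈ R2, ∑ i ∈ Finset.range L, I i h : ℝ) : ℂ)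
  rw [← hn] at this
  have h7 : (L : ℝ) * ‖T0 - (((-(∑ h ∈ P, ψ h) : ℝ) : ℂ) + ((-((∑ i ∈ Finset.range L, ∑ h ∈ R1, E i h) / L) : ℝ) : ℂ))‖ ≤ L * (b1 + b2 + b3 + b4 + b5 + b6) := by
    linarith
  exact le_of_mul_le_mul_left h7 hL0

end S3

namespace S3
open MeasureTheory Set Filter Topology Real

lemma xx_large {d : ℝ} (hd : 0 < d) (θ B : ℝ) : ∃ h1 : ℕ, ∀ h : ℕ, h1 ≤ h → B ≤ xx d θ ((h : ℝ) - 1 / 2) := by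
  refine ⟨⌈d * B + |θ| + 1⌉₊, fun h hh => ?_⟩
  have h1 : d * B + |θ| + 1 ≤ h := (Nat.le_ceil _).trans (by exact_mod_cast hh)
  have h2 : B ≤ ((h : ℝ) - 1 / 2 + θ) / d := by
    rw [le_div_iff₀ hd]; linarith [neg_abs_le θ]
  have h3 := add_one_le_exp (((h : ℝ) - 1 / 2 + θ) / d)
  rw [xx]; linarith

lemma xx_mono {d : ℝ} (hd : 0 < d) (θ : ℝ) {a b : ℝ} (h : a ≤ b) : xx d θ a ≤ xx d θ b := by
  rw [xx, xx]; gcongr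

lemma psi_abs (x : ℝ) : |psiOne x| ≤ 1 / 2 := by
  rw [psiOne]
  split_ifs
  · norm_num
  · exact saw_abs x

lemma ev_large (d θ : ℝ) : ∀ᶠ N : ℕ in atTop, exp 1 ≤ log N ∧ 2 / d ≤ (log N) ^ (1 / 3 : ℝ) ∧ -θ < d * log ((log N) ^ (1 / 3 : ℝ)) ∨ d ≤ 0 := by
  by_cases hd : d ≤ 0
  · filter_upwards with N; right; exact hd
  push Not at hd
  have t1 : Tendsto (fun N : ℕ => log (N : ℝ)) atTop atTop := tendsto_log_atTop.comp tendsto_natCast_atTop_atTop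
  have t2 : Tendsto (fun N : ℕ => (log (N : ℝ)) ^ (1 / 3 : ℝ)) atTop atTop := (tendsto_rpow_atTop (by norm_num)).comp t1
  have t3 : Tendsto (fun N : ℕ => d * log ((log (N : ℝ)) ^ (1 / 3 : ℝ))) atTop atTop := (tendsto_log_atTop.comp t2).const_mul_atTop hd
  filter_upwards [t1.eventually_ge_atTop (exp 1), t2.eventually_ge_atTop (2 / d), t3.eventually_gt_atTop (-θ)] with N a b c
  exact Or.inl ⟨a, b, c⟩

set_option maxHeartbeats 2000000 in
theorem final {d : ℝ} (hd : 0 < d) (θ : ℝ) : ∃ C > 0, ∃ N₀ : ℕ, ∀ N : ℕ, N₀ ≤ N → ∃ G : ℝ,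
    |G| ≤ ∑ h ∈ Finset.Ico 1 ⌈d * log N⌉₊, MB d N (xx d θ h) ∧
    ‖TT θ N (fun y => riemannZeta (sn d y)) - (((-(∑ h ∈ Finset.Ico 1 ⌈d * log N⌉₊, psiOne (xx d θ h)) : ℝ) : ℂ) + (G : ℂ))‖
      ≤ C * (log N) ^ ((2 : ℝ) / 3) * (log (log N)) ^ ((5 : ℝ) / 9) := by
  obtain ⟨C1, hC1, X0, hX0, hr1⟩ := range1 hd
  obtain ⟨C2, hC2, N1, X1, hX1, hr2⟩ := range2 hd
  obtain ⟨C3, hC3, hr3⟩ := range3 hd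
  obtain ⟨C4, hC4, N2, hdiff⟩ := TT_diff hd θ
  obtain ⟨K1, hK1, hg1⟩ := geo1 hd θ
  obtain ⟨K2, hK2, hg2⟩ := geo2 hd θ
  obtain ⟨h1, hh1⟩ := xx_large hd θ (max X0 X1)
  set h0 := h1 + 1 with hh0
  have hbase : max X0 X1 ≤ xx d θ ((h0 : ℝ) - 1 / 2) := hh1 h0 (by omega)
  obtain ⟨C5, hC5, hred⟩ := SN_red hd θ h0 (hX0.trans ((le_max_left _ _).trans hbase))
  obtain ⟨Ne, hNe⟩ := eventually_atTop.1 (ev_large d θ)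
  refine ⟨2 * C4 + C5 + C1 * K1 + C3 * K2 + 2 * C2 * (4 * d + 1) + (h0 + 2 * d + |θ| + 1), by positivity, Ne + N1 + N2 + 4, fun N hN => ?_⟩
  obtain ⟨hl, hlam, hth⟩ := (hNe N (by omega)).resolve_right (by linarith)
  have hN4 : 4 ≤ N := by omega
  have hN4' : (4 : ℝ) ≤ N := by exact_mod_cast hN4
  have hN0 : (0 : ℝ) < N := by linarith
  set ℓ := log (N : ℝ) with hℓ
  have hℓ1 : 1 ≤ ℓ := by linarith [add_one_le_exp (1 : ℝ)]
  have hℓ0 : 0 < ℓ := by linarith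
  set lam := ℓ ^ (1 / 3 : ℝ) with hlamd
  have hlam1 : 1 ≤ lam := one_le_rpow hℓ1 (by norm_num)
  have hlam0 : 0 < lam := by linarith
  have hloglam : 0 ≤ log lam := log_nonneg hlam1
  set W := ℓ ^ ((2 : ℝ) / 3) with hW
  have hW1 : 1 ≤ W := one_le_rpow hℓ1 (by norm_num)
  have hsq : √ℓ ≤ W := by
    rw [sqrt_eq_rpow]; exact rpow_le_rpow_of_exponent_le hℓ1 (by norm_num)
  have hsq1 : 1 ≤ √ℓ := one_le_sqrt.2 hℓ1
  have hlamsq : lam ≤ √ℓ := by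
    rw [sqrt_eq_rpow]; exact rpow_le_rpow_of_exponent_le hℓ1 (by norm_num)
  have hWl : ℓ / lam = W := by
    rw [hlamd, hW, div_eq_iff (by positivity), ← rpow_add hℓ0]; norm_num
  have hlogW : √ℓ * log lam ≤ 2 * W := by
    have := log_le_rpow_div hℓ0.le (ε := 1 / 6) (by norm_num)
    rw [hlamd, log_rpow hℓ0, sqrt_eq_rpow]
    calc ℓ ^ (1 / 2 : ℝ) * (1 / 3 * log ℓ) ≤ ℓ ^ (1 / 2 : ℝ) * (1 / 3 * (ℓ ^ (1 / 6 : ℝ) / (1 / 6))) := by gcongr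
      _ = 2 * (ℓ ^ (1 / 2 : ℝ) * ℓ ^ (1 / 6 : ℝ)) := by ring
      _ = _ := by rw [← rpow_add hℓ0, hW]; norm_num
  have hsN : 2 ≤ √(N : ℝ) := by
    rw [le_sqrt (by norm_num) hN0.le]; linarith
  have hss : √(N : ℝ) * √(N : ℝ) = N := mul_self_sqrt hN0.le
  have hsl : √ℓ * √ℓ = ℓ := mul_self_sqrt hℓ0.le
  have hlN : √ℓ ≤ √(N : ℝ) := sqrt_le_sqrt (by linarith [log_le_sub_one_of_pos hN0])
  set L := ⌈√(N : ℝ) / √ℓ⌉₊ with hL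
  have hLlo : √(N : ℝ) / √ℓ ≤ L := Nat.le_ceil _
  have hquo : 1 ≤ √(N : ℝ) / √ℓ := by rw [le_div_iff₀ (by linarith)]; linarith
  have hLhi : (L : ℝ) ≤ 2 * (√(N : ℝ) / √ℓ) := by
    have := Nat.ceil_lt_add_one (by linarith : 0 ≤ √(N : ℝ) / √ℓ)
    linarith
  have hLpos : 0 < L := Nat.ceil_pos.2 (by linarith)
  have hLpos' : (0 : ℝ) < L := by exact_mod_cast hLpos
  have hLN : L ≤ N := by
    have : (L : ℝ) ≤ N := by
      have h2 : √(N : ℝ) / √ℓ ≤ √(N : ℝ) := div_le_self (by linarith) hsq1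
      have h3 : 2 * √(N : ℝ) ≤ √(N : ℝ) * √(N : ℝ) := mul_le_mul_of_nonneg_right hsN (by linarith)
      linarith
    exact_mod_cast this
  obtain ⟨H', hH'⟩ := xx_large hd θ (4 * (N : ℝ) ^ 2)
  set H := H' + h0 with hH
  have hHbig := hH' H (by omega)
  set Y := (N : ℝ) / lam with hY
  have hY0 : 0 < Y := by positivity
  have hYN : Y ≤ N := div_le_self hN0.le hlam1
  set x : ℕ → ℝ := fun h => xx d θ h with hx
  have hxp : ∀ h, 0 < x h := fun h => xx_pos d θ h
  have hxh0 : ∀ h : ℕ, h0 ≤ h → max X0 X1 ≤ x h := fun h hh => hbase.trans (xx_mono hd θ (by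
    have : (h0 : ℝ) ≤ h := by exact_mod_cast hh
    linarith))
  set A := Finset.Ico h0 H with hA
  set R1 := A.filter (fun h => x h ≤ Y) with hR1
  set R3 := (A.filter (fun h => ¬ x h ≤ Y)).filter (fun h => N * lam ≤ x h) with hR3
  set R2 := (A.filter (fun h => ¬ x h ≤ Y)).filter (fun h => ¬ N * lam ≤ x h) with hR2
  set P := Finset.Ico 1 ⌈d * ℓ⌉₊ with hP
  have hlogY : log Y = ℓ - log lam := by rw [hY, log_div hN0.ne' hlam0.ne']
  have hR1P : R1 ⊆ P := by
    intro h hh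
    obtain ⟨hhA, hhY⟩ := Finset.mem_filter.1 hh
    have := (xx_le hd θ hY0).1 hhY
    rw [hlogY] at this
    refine Finset.mem_Ico.2 ⟨by have := (Finset.mem_Ico.1 hhA).1; omega, Nat.lt_ceil.2 ?_⟩
    linarith
  have hr1' : ∀ i < L, ∀ h ∈ R1, |II d (N + i) (x h) - psiOne (x h) - Ef (N + i) (vv d (x h) (round (x h) : ℤ))| ≤ C1 * (x h / N) * ℓ ∧
      |Ef (N + i) (vv d (x h) (round (x h) : ℤ))| ≤ MB d N (x h) := by
    intro i hi h hh
    obtain ⟨hhA, hhY⟩ := Finset.mem_filter.1 hh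
    refine hr1 N (N + i) (by omega) (by omega) (by omega) (x h) ((le_max_left _ _).trans (hxh0 h (Finset.mem_Ico.1 hhA).1)) ?_
    have : Y * lam = N := div_mul_cancel₀ _ hlam0.ne'
    rw [div_le_iff₀ hd] at hlam
    have h2 : Y * 2 ≤ Y * (lam * d) := mul_le_mul_of_nonneg_left hlam hY0.le
    have h3 : Y * (lam * d) = d * N := by rw [← this]; ring
    linarith
  have key := assemble hLpos (TT θ N (fun y => riemannZeta (sn d y))) (fun i => TT θ (N + i) (fun y => riemannZeta (sn d y)))
    R1 R2 R3 P (fun i h => II d (N + i) (x h)) (fun i h => Ef (N + i) (vv d (x h) (round (x h) : ℤ))) (fun h => psiOne (x h))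
    (b1 := 2 * C4 * W) (b2 := C5 * W) (b3 := C1 * K1 * W) (b4 := C3 * K2 * W) (b5 := 2 * C2 * (4 * d + 1) * W) (b6 := (h0 + 2 * d + |θ| + 1) * W)
    ?_ ?_ ?_ ?_ ?_ ?_
  · refine ⟨_, ?_, key.trans ?_⟩
    · rw [abs_neg, abs_div, abs_of_pos hLpos', div_le_iff₀ hLpos']
      have hs : ∀ i ∈ Finset.range L, |∑ h ∈ R1, Ef (N + i) (vv d (x h) (round (x h) : ℤ))| ≤ ∑ h ∈ P, MB d N (x h) := by
        intro i hi
        calc _ ≤ ∑ h ∈ R1, |Ef (N + i) (vv d (x h) (round (x h) : ℤ))| := Finset.abs_sum_le_sum_abs _ _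
          _ ≤ ∑ h ∈ R1, MB d N (x h) := Finset.sum_le_sum fun h hh => (hr1' i (Finset.mem_range.1 hi) h hh).2
          _ ≤ _ := Finset.sum_le_sum_of_subset_of_nonneg hR1P fun h _ _ => MB_nonneg hd N (hxp h)
      refine (Finset.abs_sum_le_sum_abs _ _).trans ((Finset.sum_le_sum hs).trans (le_of_eq ?_))
      rw [Finset.sum_const, Finset.card_range, nsmul_eq_mul, mul_comm]
    · have hq : 1 ≤ (log ℓ) ^ ((5 : ℝ) / 9) := by
        apply one_le_rpow _ (by norm_num)
        rw [le_log_iff_exp_le hℓ0]; exact hl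
      rw [← add_mul, ← add_mul, ← add_mul, ← add_mul, ← add_mul]
      exact le_mul_of_one_le_right (by positivity) hq
  · intro i hi
    refine (hdiff N i (by omega) (by omega)).trans ?_
    have hi' : (i : ℝ) ≤ 2 * (√(N : ℝ) / √ℓ) := le_trans (by exact_mod_cast hi.le) hLhi
    calc C4 * i * ℓ / √(N : ℝ) ≤ C4 * (2 * (√(N : ℝ) / √ℓ)) * ℓ / √(N : ℝ) := by gcongr
      _ = 2 * C4 * √ℓ := by
        have a1 : √(N : ℝ) ≠ 0 := by linarith
        have a2 : √ℓ ≠ 0 := by linarith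
        field_simp
        rw [sq, hsl]
      _ ≤ _ := by gcongr
  · intro i hi
    have := hred (N + i) H (by omega) (by
      refine le_trans ?_ hHbig
      have : ((N + i : ℕ) : ℝ) ≤ 2 * N := by exact_mod_cast (by omega : N + i ≤ 2 * N)
      calc ((N + i : ℕ) : ℝ) ^ 2 ≤ (2 * N) ^ 2 := pow_le_pow_left₀ (Nat.cast_nonneg _) this 2
        _ = _ := by ring)
    have e : ∑ h ∈ R1, II d (N + i) (x h) + ∑ h ∈ R2, II d (N + i) (x h) + ∑ h ∈ R3, II d (N + i) (x h) = ∑ h ∈ A, II d (N + i) (x h) := by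
      rw [← Finset.sum_filter_add_sum_filter_not A (fun h => x h ≤ Y), add_assoc]
      congr 1
      rw [← Finset.sum_filter_add_sum_filter_not (A.filter (fun h => ¬ x h ≤ Y)) (fun h => N * lam ≤ x h), add_comm]
    rw [e]
    refine this.trans (le_mul_of_one_le_right hC5.le hW1)
  · intro i hi
    calc _ ≤ ∑ h ∈ R1, |II d (N + i) (x h) - psiOne (x h) - Ef (N + i) (vv d (x h) (round (x h) : ℤ))| := Finset.abs_sum_le_sum_abs _ _
      _ ≤ ∑ h ∈ R1, C1 * ℓ / N * x h := Finset.sum_le_sum fun h hh => ((hr1' i hi h hh).1).trans (le_of_eq (by ring))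
      _ = C1 * ℓ / N * ∑ h ∈ R1, x h := by rw [Finset.mul_sum]
      _ ≤ C1 * ℓ / N * (K1 * Y) := by
          gcongr
          exact hg1 R1 Y hY0 fun h hh => (Finset.mem_filter.1 hh).2
      _ = C1 * K1 * (ℓ / lam) := by rw [hY]; field_simp
      _ = _ := by rw [hWl]
  · intro i hi
    calc _ ≤ ∑ h ∈ R3, |II d (N + i) (x h)| := Finset.abs_sum_le_sum_abs _ _
      _ ≤ ∑ h ∈ R3, C3 * N * ℓ * (1 / x h) := Finset.sum_le_sum fun h hh =>
          (hr3 N (N + i) (by omega) (by omega) (x h) (hxp h)).trans (le_of_eq (by ring))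
      _ = C3 * N * ℓ * ∑ h ∈ R3, 1 / x h := by rw [Finset.mul_sum]
      _ ≤ C3 * N * ℓ * (K2 / (N * lam)) := by
          gcongr
          exact hg2 R3 _ (by positivity) fun h hh => (Finset.mem_filter.1 hh).2
      _ = C3 * K2 * (ℓ / lam) := by field_simp
      _ = _ := by rw [hWl]
  · have hcard : (R2.card : ℝ) ≤ (ℓ + log lam) * d - θ - ((ℓ - log lam) * d - θ) + 1 := by
      refine count_le R2 (by have := mul_nonneg hloglam hd.le; linarith) fun h hh => ?_
      obtain ⟨hh1, hh2⟩ := Finset.mem_filter.1 hh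
      have hh3 := (Finset.mem_filter.1 hh1).2
      constructor
      · have := (not_congr (xx_le hd θ (h := h) hY0)).1 hh3
        rw [hlogY] at this
        linarith
      · have := (xx_le hd θ (h := h) (Y := N * lam) (by positivity)).1 (not_le.1 hh2).le
        rw [log_mul hN0.ne' hlam0.ne'] at this
        linarith
    have hone : ∀ h ∈ R2, |∑ i ∈ Finset.range L, II d (N + i) (x h)| ≤ L * (2 * C2 * √ℓ) := by
      intro h hh
      obtain ⟨hh1, hh2⟩ := Finset.mem_filter.1 hh
      obtain ⟨hhA, hh3⟩ := Finset.mem_filter.1 hh1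
      have hNx : (N : ℝ) ≤ lam * x h := by
        have := (not_le.1 hh3).le
        rw [hY, div_le_iff₀ hlam0] at this
        linarith
      refine (hr2 N L (by omega) (by omega) hLN lam (x h) hlam1 ((le_max_right _ _).trans (hxh0 h (Finset.mem_Ico.1 hhA).1)) hNx).trans ?_
      have h5 : √(N : ℝ) ≤ L * √ℓ := by
        rw [div_le_iff₀ (by linarith)] at hLlo; exact hLlo
      have h6 : L * lam ≤ L * √ℓ := by gcongr
      calc C2 * (L * lam + √(N : ℝ)) ≤ C2 * (L * √ℓ + L * √ℓ) := by gcongr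
        _ = _ := by ring
    calc _ ≤ ∑ h ∈ R2, |∑ i ∈ Finset.range L, II d (N + i) (x h)| := Finset.abs_sum_le_sum_abs _ _
      _ ≤ ∑ h ∈ R2, L * (2 * C2 * √ℓ) := Finset.sum_le_sum hone
      _ = R2.card * (L * (2 * C2 * √ℓ)) := by rw [Finset.sum_const, nsmul_eq_mul]
      _ ≤ (2 * d * log lam + 1) * (L * (2 * C2 * √ℓ)) := by
          gcongr
          linarith
      _ = L * (2 * C2 * (2 * d * (√ℓ * log lam) + √ℓ)) := by ring
      _ ≤ L * (2 * C2 * (2 * d * (2 * W) + W)) := by gcongr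
      _ = _ := by ring
  · rw [← Finset.sum_sdiff hR1P, add_sub_cancel_right]
    have hb : |∑ h ∈ P \ R1, psiOne (x h)| ≤ ((P \ R1).card : ℝ) * (1 / 2) := by
      refine (Finset.abs_sum_le_sum_abs _ _).trans ((Finset.sum_le_sum fun h _ => psi_abs (x h)).trans (le_of_eq ?_))
      rw [Finset.sum_const, nsmul_eq_mul]
    have hc : (((P \ R1).filter (fun h => ¬ h < h0)).card : ℝ) ≤ d * ℓ - (d * (ℓ - log lam) - |θ|) + 1 := by
      refine count_le _ (by have := abs_nonneg θ; have := mul_nonneg hd.le hloglam; linarith) fun h hh => ?_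
      obtain ⟨hh1, hh2⟩ := Finset.mem_filter.1 hh
      obtain ⟨hhP, hhR⟩ := Finset.mem_sdiff.1 hh1
      have hup := Nat.lt_ceil.1 (Finset.mem_Ico.1 hhP).2
      refine ⟨?_, hup.le⟩
      by_contra hcon
      push Not at hcon
      apply hhR
      have hxY : x h ≤ Y := (xx_le hd θ hY0).2 (by rw [hlogY]; linarith [le_abs_self θ])
      refine Finset.mem_filter.2 ⟨Finset.mem_Ico.2 ⟨by omega, ?_⟩, hxY⟩
      by_contra hHh
      push Not at hHh
      have h7 : xx d θ ((H : ℝ) - 1 / 2) ≤ x h := xx_mono hd θ (by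
        have : (H : ℝ) ≤ h := by exact_mod_cast hHh
        linarith)
      have h12 : (N : ℝ) * 1 ≤ N * N := mul_le_mul_of_nonneg_left (by linarith) hN0.le
      have h13 : (N : ℝ) ^ 2 = N * N := sq _
      linarith
    have hc2 : (((P \ R1).filter (fun h => h < h0)).card : ℝ) ≤ h0 := by
      have : ((P \ R1).filter (fun h => h < h0)).card ≤ h0 := by
        refine (Finset.card_le_card (t := Finset.range h0) fun h hh => ?_).trans (by simp)
        exact Finset.mem_range.2 (Finset.mem_filter.1 hh).2
      exact_mod_cast this
    have hc3 : (((P \ R1).filter (fun h => h < h0)).card : ℝ) + (((P \ R1).filter (fun h => ¬ h < h0)).card : ℝ) = ((P \ R1).card : ℝ) := by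
      exact_mod_cast Finset.card_filter_add_card_filter_not (s := P \ R1) (fun h => h < h0)
    have hll : log lam ≤ 2 * W := by
      refine le_trans ?_ hlogW
      exact le_mul_of_one_le_left hloglam hsq1
    have h8 : (h0 : ℝ) + |θ| + 1 ≤ (h0 + |θ| + 1) * W := le_mul_of_one_le_right (by positivity) hW1
    have h9 : d * log lam ≤ d * (2 * W) := by gcongr
    have h10 : 0 ≤ (h0 : ℝ) + |θ| + 1 := by positivity
    refine hb.trans ?_
    have h14 : 0 ≤ d * log lam := mul_nonneg hd.le hloglam
    linarith
end S3

theorem statement3 (d θ : ℝ) (hd : 0 < d) :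
    ∃ C > (0 : ℝ), ∃ N₀ : ℕ, ∀ N : ℕ, N₀ ≤ N → 2 ≤ N →
      ∃ G : ℂ,
        ‖G‖ ≤ (∑ h ∈ Finset.Ioo (0 : ℤ) ⌈d * Real.log N⌉,
            min (1 / 2)
              (1 / (2 * Real.pi * nearestIntDist (Real.exp (((h : ℝ) + θ) / d)) *
                (2 * d * N * Real.exp (-(((h : ℝ) + θ) / d)) + 1)))) ∧
        ‖(1 / (2 * (Real.pi : ℂ) * Complex.I)) *
              (∑ n ∈ (Finset.Icc (-(N : ℤ)) (N : ℤ)).erase 0,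
                riemannZeta (2 * (Real.pi : ℂ) * Complex.I * (d : ℂ) * (n : ℂ)) *
                  Complex.exp (2 * (Real.pi : ℂ) * Complex.I * (θ : ℂ) * (n : ℂ)) / (n : ℂ))
            - (((-(∑ h ∈ Finset.Ioo (0 : ℤ) ⌈d * Real.log N⌉,
                  psiOne (Real.exp (((h : ℝ) + θ) / d))) : ℝ) : ℂ) + G)‖
          ≤ C * (Real.log N) ^ ((2 : ℝ) / 3) * (Real.log (Real.log N)) ^ ((5 : ℝ) / 9) := by
  obtain ⟨C, hC, N₀, h⟩ := S3.final hd θ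
  refine ⟨C, hC, N₀, fun N hN _ => ?_⟩
  obtain ⟨G, hG, hT⟩ := h N hN
  have hs : ∀ (f : ℝ → ℝ) (z : ℝ), ∑ h ∈ Finset.Ioo (0 : ℤ) ⌈z⌉, f (h : ℝ) = ∑ h ∈ Finset.Ico 1 ⌈z⌉₊, f (h : ℝ) := by
    intro f z
    symm
    refine Finset.sum_bij (fun (k : ℕ) _ => (k : ℤ)) ?_ ?_ ?_ ?_
    · intro k hk
      rw [Finset.mem_Ico] at hk
      have h2 := Nat.lt_ceil.1 hk.2
      exact Finset.mem_Ioo.2 ⟨by have := hk.1; omega, Int.lt_ceil.2 (by exact_mod_cast h2)⟩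
    · intro a _ b _ hab
      exact_mod_cast hab
    · intro b hb
      rw [Finset.mem_Ioo] at hb
      lift b to ℕ using hb.1.le
      refine ⟨b, Finset.mem_Ico.2 ⟨by have := hb.1; omega, Nat.lt_ceil.2 ?_⟩, rfl⟩
      have := Int.lt_ceil.1 hb.2
      exact_mod_cast this
    · intro k _
      simp
  refine ⟨(G : ℂ), ?_, ?_⟩
  · rw [Complex.norm_real, Real.norm_eq_abs]
    refine hG.trans (le_of_eq ?_)
    rw [hs (fun h => min (1 / 2)
              (1 / (2 * Real.pi * nearestIntDist (Real.exp ((h + θ) / d)) *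
                (2 * d * N * Real.exp (-((h + θ) / d)) + 1))))]
    refine Finset.sum_congr rfl fun k _ => ?_
    rw [S3.MB, S3.xx, Real.exp_neg]
  · rw [S3.SN_eq, hs (fun h => psiOne (Real.exp ((h + θ) / d)))]
    exact hT
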